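/- Let c > 2, let X be a large real number, τ = X^{1−c−η}, K = log^{10} X, and S(x) = ∑_{X < p ≤ 2X} (log p) e(p^c x) over primes p. Assume the Robert–Sargos bound A(X; c, γ) ≪ (γ X^{4−c} + X²) X^η for the number of integer quadruples X < n₁,...,n₄ ≤ 2X with |n₁^c + n₂^c − n₃^c − n₄^c| < γ. Then ∑_{X < n₁,n₂,n₃,n₄ ≤ 2X} min(K, 1/|n₁^c + n₂^c − n₃^c − n₄^c|) ≪ X^{2+η}, and consequently ∫_τ^K |S(x)|⁴ |Φ(x)| dx ≪ X^{2+η}, where Φ is any function with |Φ(x)| ≤ ε := log^{−4} X. -/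

import Mathlib

open MeasureTheory Finset

namespace RobertSargos

/-- The additive character `e(t) = exp(2πit)`. -/
noncomputable def ex (t : ℝ) : ℂ := Complex.exp (2 * Real.pi * Complex.I * (t : ℂ))

lemma ex_eq (t : ℝ) : ex t = Complex.exp (((2 * Real.pi * t : ℝ) : ℂ) * Complex.I) := by
  unfold ex; congr 1; push_cast; ring

lemma ex_add (s t : ℝ) : ex (s + t) = ex s * ex t := by
  unfold ex; rw [← Complex.exp_add]; congr 1; push_cast; ring

@[simp] lemma ex_zero : ex 0 = 1 := by simp [ex]

@[simp] lemma norm_ex (t : ℝ) : ‖ex t‖ = 1 := by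
  rw [ex_eq, Complex.norm_exp_ofReal_mul_I]

lemma conj_ex (t : ℝ) : (starRingEnd ℂ) (ex t) = ex (-t) := by
  rw [ex_eq, ex_eq, ← Complex.exp_conj]
  rw [map_mul, Complex.conj_ofReal, Complex.conj_I]
  congr 1
  push_cast
  ring

lemma hasDerivAt_ex (t : ℝ) : HasDerivAt ex (2 * Real.pi * Complex.I * ex t) t := by
  have h : HasDerivAt (fun t : ℝ => 2 * Real.pi * Complex.I * (t : ℂ))
      (2 * Real.pi * Complex.I) t := by
    simpa using (Complex.ofRealCLM.hasDerivAt (x := t)).const_mul (2 * Real.pi * Complex.I)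
  have := h.cexp
  unfold ex
  convert this using 1
  ring

@[fun_prop] lemma contDiff_ex {n : WithTop ℕ∞} : ContDiff ℝ n ex := by
  unfold ex
  exact (contDiff_const.mul Complex.ofRealCLM.contDiff).cexp

@[fun_prop] lemma continuous_ex : Continuous ex := (contDiff_ex (n := 0)).continuous

/-- The exponential polynomial with frequencies `f n` and coefficients `a n`. -/
noncomputable def expSum (J : Finset ℕ) (a f : ℕ → ℝ) (x : ℝ) : ℂ :=
  ∑ n ∈ J, (a n : ℂ) * ex (f n * x)

@[fun_prop] lemma continuous_expSum (J : Finset ℕ) (a f : ℕ → ℝ) : Continuous (expSum J a f) := by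
  unfold expSum; fun_prop

lemma norm_expSum_le (J : Finset ℕ) (a f : ℕ → ℝ) (x : ℝ) :
    ‖expSum J a f x‖ ≤ ∑ n ∈ J, |a n| := by
  refine (norm_sum_le _ _).trans (sum_le_sum fun n _ => ?_)
  simp

lemma expSum_neg (J : Finset ℕ) (a f : ℕ → ℝ) (x : ℝ) :
    ‖expSum J a f (-x)‖ = ‖expSum J a f x‖ := by
  rw [← Complex.norm_conj (expSum J a f x)]
  congr 1
  simp [expSum, map_sum, conj_ex]

/-- All quadruples with entries in `J`. -/
abbrev quads (J : Finset ℕ) : Finset ((ℕ × ℕ) × (ℕ × ℕ)) := (J ×ˢ J) ×ˢ (J ×ˢ J)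

/-- The quantity `f n₁ + f n₂ - f n₃ - f n₄`. -/
def gap (f : ℕ → ℝ) (q : (ℕ × ℕ) × (ℕ × ℕ)) : ℝ := f q.1.1 + f q.1.2 - f q.2.1 - f q.2.2

lemma norm_expSum_pow_four (J : Finset ℕ) (a f : ℕ → ℝ) (x : ℝ) :
    ((‖expSum J a f x‖ ^ 4 : ℝ) : ℂ) =
      ∑ q ∈ quads J, ((a q.1.1 * a q.1.2 * (a q.2.1 * a q.2.2) : ℝ) : ℂ) * ex (gap f q * x) := by
  have h1 : ((‖expSum J a f x‖ ^ 4 : ℝ) : ℂ) =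
      (expSum J a f x * expSum J a f x) *
        ((starRingEnd ℂ) (expSum J a f x) * (starRingEnd ℂ) (expSum J a f x)) := by
    have := Complex.mul_conj' (expSum J a f x)
    push_cast
    linear_combination -(‖expSum J a f x‖ ^ 2 +
      expSum J a f x * (starRingEnd ℂ) (expSum J a f x)) * this
  rw [h1]
  simp only [expSum, map_sum, map_mul, conj_ex, Complex.conj_ofReal]
  rw [sum_mul_sum, sum_mul_sum, ← sum_product', ← sum_product', sum_mul_sum, ← sum_product']
  refine sum_congr rfl fun q _ => ?_
  have : gap f q * x = (f q.1.1 * x + f q.1.2 * x) + (-(f q.2.1 * x) + -(f q.2.2 * x)) := by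
    unfold gap; ring
  rw [this, ex_add, ex_add, ex_add]
  push_cast
  ring

lemma integral_gaussian_ex {T : ℝ} (hT : 0 < T) (u : ℝ) :
    ∫ x : ℝ, (Real.exp (-(Real.pi / T ^ 2) * x ^ 2) : ℂ) * ex (u * x) =
      ((T * Real.exp (-Real.pi * T ^ 2 * u ^ 2) : ℝ) : ℂ) := by
  have hb : 0 < (((Real.pi / T ^ 2 : ℝ) : ℂ)).re := by
    rw [Complex.ofReal_re]; positivity
  have h := fourierIntegral_gaussian hb ((2 * Real.pi * u : ℝ) : ℂ)
  have h2 : (fun x : ℝ => (Real.exp (-(Real.pi / T ^ 2) * x ^ 2) : ℂ) * ex (u * x)) =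
      fun x : ℝ => Complex.exp (Complex.I * ((2 * Real.pi * u : ℝ) : ℂ) * ↑x) *
        Complex.exp (-((Real.pi / T ^ 2 : ℝ) : ℂ) * ↑x ^ 2) := by
    funext x
    rw [mul_comm, ex]
    push_cast
    congr 2
    ring
  rw [h2, h]
  have h3 : (Real.pi : ℂ) / ((Real.pi / T ^ 2 : ℝ) : ℂ) = ((T ^ 2 : ℝ) : ℂ) := by
    rw [← Complex.ofReal_div]; congr 1; field_simp
  rw [h3, show (1 / 2 : ℂ) = ((1 / 2 : ℝ) : ℂ) by push_cast; rfl,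
    ← Complex.ofReal_cpow (by positivity), ← Real.sqrt_eq_rpow, Real.sqrt_sq hT.le]
  push_cast
  congr 2
  have : (Real.pi : ℂ) ≠ 0 := by exact_mod_cast Real.pi_ne_zero
  have hT' : (T : ℂ) ≠ 0 := by exact_mod_cast hT.ne'
  field_simp
  ring

lemma integrable_gaussian_mul {T : ℝ} (hT : 0 < T) {h : ℝ → ℝ} (hc : Continuous h) {B : ℝ}
    (hB : ∀ x, |h x| ≤ B) :
    Integrable fun x : ℝ => Real.exp (-(Real.pi / T ^ 2) * x ^ 2) * h x := by
  have := (integrable_exp_neg_mul_sq (b := Real.pi / T ^ 2) (by positivity))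
  exact this.mul_bdd (c := B) hc.aestronglyMeasurable (Filter.Eventually.of_forall hB)

lemma integrable_gaussian_expSum {T : ℝ} (hT : 0 < T) (J : Finset ℕ) (a f : ℕ → ℝ) :
    Integrable fun x : ℝ => Real.exp (-(Real.pi / T ^ 2) * x ^ 2) * ‖expSum J a f x‖ ^ 4 := by
  refine integrable_gaussian_mul hT (by fun_prop) (B := (∑ n ∈ J, |a n|) ^ 4) fun x => ?_
  rw [abs_of_nonneg (by positivity)]
  gcongr
  exact norm_expSum_le J a f x

/-- The fourth moment of an exponential sum against a Gaussian weight is a smoothed count of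
quadruples. -/
lemma integral_gaussian_expSum {T : ℝ} (hT : 0 < T) (J : Finset ℕ) (a f : ℕ → ℝ) :
    ∫ x : ℝ, Real.exp (-(Real.pi / T ^ 2) * x ^ 2) * ‖expSum J a f x‖ ^ 4 =
      T * ∑ q ∈ quads J, a q.1.1 * a q.1.2 * (a q.2.1 * a q.2.2) *
        Real.exp (-Real.pi * T ^ 2 * gap f q ^ 2) := by
  apply Complex.ofReal_injective
  rw [← integral_complex_ofReal]
  have h1 : (fun x : ℝ =>
      ((Real.exp (-(Real.pi / T ^ 2) * x ^ 2) * ‖expSum J a f x‖ ^ 4 : ℝ) : ℂ)) =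
      fun x : ℝ => ∑ q ∈ quads J, ((a q.1.1 * a q.1.2 * (a q.2.1 * a q.2.2) : ℝ) : ℂ) *
        ((Real.exp (-(Real.pi / T ^ 2) * x ^ 2) : ℂ) * ex (gap f q * x)) := by
    funext x
    rw [Complex.ofReal_mul, norm_expSum_pow_four, mul_sum]
    refine sum_congr rfl fun q _ => ?_
    ring
  rw [h1, integral_finsetSum]
  · rw [Complex.ofReal_mul, Complex.ofReal_sum, mul_sum]
    refine sum_congr rfl fun q _ => ?_
    rw [integral_const_mul, integral_gaussian_ex hT]
    push_cast
    ring
  · intro q _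
    refine Integrable.const_mul ?_ _
    have h2 : Integrable fun x : ℝ => ((Real.exp (-(Real.pi / T ^ 2) * x ^ 2) : ℝ) : ℂ) :=
      (integrable_exp_neg_mul_sq (b := Real.pi / T ^ 2) (by positivity)).ofReal
    exact h2.mul_bdd (c := 1) (by fun_prop) (Filter.Eventually.of_forall fun x => by simp)

section Oscillatory

variable {a b : ℝ} {F F' φ φ' : ℝ → ℝ}

lemma integral_by_parts_ex (hF : ∀ s ∈ Set.uIcc a b, HasDerivAt F (F' s) s)
    (hφ : ∀ s ∈ Set.uIcc a b, HasDerivAt φ (φ' s) s)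
    (hF' : ContinuousOn F' (Set.uIcc a b)) (hφ' : ContinuousOn φ' (Set.uIcc a b)) :
    2 * Real.pi * Complex.I * ∫ s in a..b, ((F s * φ' s : ℝ) : ℂ) * ex (φ s) =
      F b * ex (φ b) - F a * ex (φ a) - ∫ s in a..b, ((F' s : ℝ) : ℂ) * ex (φ s) := by
  have hφc : ContinuousOn φ (Set.uIcc a b) := fun s hs => (hφ s hs).continuousAt.continuousWithinAt
  have hexc : ContinuousOn (fun s => ex (φ s)) (Set.uIcc a b) :=
    continuous_ex.comp_continuousOn hφc
  have h := intervalIntegral.integral_mul_deriv_eq_deriv_mul (a := a) (b := b)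
    (u := fun s => ((F s : ℝ) : ℂ)) (u' := fun s => ((F' s : ℝ) : ℂ))
    (v := fun s => ex (φ s)) (v' := fun s => φ' s • (2 * Real.pi * Complex.I * ex (φ s)))
    (fun s hs => (hF s hs).ofReal_comp)
    (fun s hs => (hasDerivAt_ex (φ s)).scomp s (hφ s hs))
    (Complex.continuous_ofReal.comp_continuousOn hF').intervalIntegrable
    (hφ'.smul (continuousOn_const.mul hexc)).intervalIntegrable
  rw [← h, ← intervalIntegral.integral_const_mul]
  congr 1
  funext s
  rw [Complex.real_smul]
  push_cast
  ring

lemma norm_two_pi_I_mul (z : ℂ) : ‖2 * Real.pi * Complex.I * z‖ = 2 * Real.pi * ‖z‖ := by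
  simp [abs_of_pos Real.pi_pos]

lemma norm_le_norm_two_pi_I_mul (z : ℂ) : ‖z‖ ≤ ‖2 * Real.pi * Complex.I * z‖ := by
  rw [norm_two_pi_I_mul]
  nlinarith [Real.pi_gt_three, norm_nonneg z]

/-- Integration by parts with vanishing boundary terms. -/
lemma norm_integral_by_parts_le (hF : ∀ s ∈ Set.uIcc a b, HasDerivAt F (F' s) s)
    (hφ : ∀ s ∈ Set.uIcc a b, HasDerivAt φ (φ' s) s)
    (hF' : ContinuousOn F' (Set.uIcc a b)) (hφ' : ContinuousOn φ' (Set.uIcc a b))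
    (ha : F a = 0) (hb : F b = 0) :
    ‖∫ s in a..b, ((F s * φ' s : ℝ) : ℂ) * ex (φ s)‖ ≤
      ‖∫ s in a..b, ((F' s : ℝ) : ℂ) * ex (φ s)‖ := by
  refine (norm_le_norm_two_pi_I_mul _).trans ?_
  rw [integral_by_parts_ex hF hφ hF' hφ', ha, hb]
  simp

lemma norm_integral_ex_le {G : ℝ → ℝ} {B : ℝ} (hab : a ≤ b)
    (hG : ∀ s ∈ Set.Icc a b, |G s| ≤ B) :
    ‖∫ s in a..b, ((G s : ℝ) : ℂ) * ex (φ s)‖ ≤ B * (b - a) := by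
  have := intervalIntegral.norm_integral_le_of_norm_le_const (a := a) (b := b) (C := B)
    (f := fun s => ((G s : ℝ) : ℂ) * ex (φ s)) (fun s hs => by
      rw [Set.uIoc_of_le hab] at hs
      simpa using hG s ⟨hs.1.le, hs.2⟩)
  rwa [abs_of_nonneg (sub_nonneg.2 hab)] at this

/-- The part of an oscillatory integral away from the stationary point `σ`. -/
lemma norm_integral_off_stationary_le {G G' H H' Θ : ℝ → ℝ} {l σ δ g μ h : ℝ} (hab : a ≤ b)
    (hl : 0 < l) (hδ : 0 < δ) (hμ : 0 < μ)
    (hside : (∀ s ∈ Set.Icc a b, δ ≤ s - σ) ∨ (∀ s ∈ Set.Icc a b, δ ≤ σ - s))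
    (hΘ : ∀ s ∈ Set.Icc a b, HasDerivAt Θ ((s - σ) * H s) s)
    (hG : ∀ s ∈ Set.Icc a b, HasDerivAt G (G' s) s) (hG' : ContinuousOn G' (Set.Icc a b))
    (hH : ∀ s ∈ Set.Icc a b, HasDerivAt H (H' s) s) (hH' : ContinuousOn H' (Set.Icc a b))
    (bG : ∀ s ∈ Set.Icc a b, |G s| ≤ g) (bG' : ∀ s ∈ Set.Icc a b, |G' s| ≤ g)
    (bH : ∀ s ∈ Set.Icc a b, μ ≤ H s) (bH' : ∀ s ∈ Set.Icc a b, |H' s| ≤ h) :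
    ‖∫ s in a..b, ((G s : ℝ) : ℂ) * ex (l * Θ s)‖ ≤
      (g / μ + g * h / μ ^ 2) * (4 + (b - a)) / (l * δ) := by
  have haI : a ∈ Set.Icc a b := ⟨le_rfl, hab⟩
  have hbI : b ∈ Set.Icc a b := ⟨hab, le_rfl⟩
  have hg : 0 ≤ g := (abs_nonneg _).trans (bG a haI)
  have hh : 0 ≤ h := (abs_nonneg _).trans (bH' a haI)
  set B : ℝ := g / μ + g * h / μ ^ 2 with hB
  have hB0 : 0 ≤ B := by positivity
  have hd : ∀ s ∈ Set.Icc a b, δ ≤ |s - σ| := by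
    intro s hs
    rcases hside with h1 | h1
    · exact (h1 s hs).trans (le_abs_self _)
    · rw [abs_sub_comm]; exact (h1 s hs).trans (le_abs_self _)
  have hd0 : ∀ s ∈ Set.Icc a b, s - σ ≠ 0 := fun s hs h0 => by
    have := hd s hs; rw [h0, abs_zero] at this; linarith
  have hH0 : ∀ s ∈ Set.Icc a b, H s ≠ 0 := fun s hs => (hμ.trans_le (bH s hs)).ne'
  have hHc : ContinuousOn H (Set.Icc a b) := fun s hs => (hH s hs).continuousAt.continuousWithinAt
  have hGc : ContinuousOn G (Set.Icc a b) := fun s hs => (hG s hs).continuousAt.continuousWithinAt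
  set Q : ℝ → ℝ := fun s => G s / H s
  set Q' : ℝ → ℝ := fun s => (G' s * H s - G s * H' s) / H s ^ 2
  have hQ : ∀ s ∈ Set.Icc a b, HasDerivAt Q (Q' s) s := fun s hs => (hG s hs).div (hH s hs) (hH0 s hs)
  have bHpos : ∀ s ∈ Set.Icc a b, 0 < H s := fun s hs => hμ.trans_le (bH s hs)
  have bQ : ∀ s ∈ Set.Icc a b, |Q s| ≤ B := by
    intro s hs
    have : |Q s| ≤ g / μ := by
      simp only [Q]
      rw [abs_div, abs_of_pos (bHpos s hs)]
      exact div_le_div₀ hg (bG s hs) hμ (bH s hs)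
    have : 0 ≤ g * h / μ ^ 2 := by positivity
    linarith
  have bQ' : ∀ s ∈ Set.Icc a b, |Q' s| ≤ B := by
    intro s hs
    have e : Q' s = G' s / H s - G s * H' s / H s ^ 2 := by
      simp only [Q']; field_simp [hH0 s hs]
    rw [e]
    refine (abs_sub _ _).trans ?_
    rw [abs_div, abs_div, abs_mul, abs_of_pos (bHpos s hs), abs_of_pos (pow_pos (bHpos s hs) 2)]
    refine add_le_add (div_le_div₀ hg (bG' s hs) hμ (bH s hs)) (div_le_div₀ (by positivity)
      (mul_le_mul (bG s hs) (bH' s hs) (abs_nonneg _) hg) (by positivity) ?_)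
    exact pow_le_pow_left₀ hμ.le (bH s hs) 2
  set F : ℝ → ℝ := fun s => Q s / (s - σ) / l
  set F' : ℝ → ℝ := fun s => (Q' s * (s - σ) - Q s * 1) / (s - σ) ^ 2 / l
  have hu : Set.uIcc a b = Set.Icc a b := Set.uIcc_of_le hab
  have hF : ∀ s ∈ Set.uIcc a b, HasDerivAt F (F' s) s := by
    intro s hs
    rw [hu] at hs
    exact ((hQ s hs).div ((hasDerivAt_id s).sub_const σ) (hd0 s hs)).div_const l
  have hQc : ContinuousOn Q (Set.Icc a b) := hGc.div hHc hH0
  have hQc' : ContinuousOn Q' (Set.Icc a b) :=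
    ((hG'.mul hHc).sub (hGc.mul hH')).div (hHc.pow 2) fun s hs => pow_ne_zero 2 (hH0 s hs)
  have hsc : ContinuousOn (fun s : ℝ => s - σ) (Set.Icc a b) := by fun_prop
  have hF'c : ContinuousOn F' (Set.uIcc a b) := by
    rw [hu]
    exact (((hQc'.mul hsc).sub (hQc.mul continuousOn_const)).div (hsc.pow 2)
      fun s hs => pow_ne_zero 2 (hd0 s hs)).div_const l
  have key := integral_by_parts_ex (a := a) (b := b) (F := F) (F' := F')
    (φ := fun s => l * Θ s) (φ' := fun s => l * ((s - σ) * H s)) hF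
    (fun s hs => (hΘ s (hu ▸ hs)).const_mul l) hF'c
    (by rw [hu]; exact continuousOn_const.mul (hsc.mul hHc))
  have e1 : ∫ s in a..b, ((F s * (l * ((s - σ) * H s)) : ℝ) : ℂ) * ex (l * Θ s) =
      ∫ s in a..b, ((G s : ℝ) : ℂ) * ex (l * Θ s) := by
    refine intervalIntegral.integral_congr fun s hs => ?_
    rw [hu] at hs
    have := hd0 s hs
    have := hH0 s hs
    simp only [F, Q]
    congr 2
    field_simp
  rw [e1] at key
  refine (norm_le_norm_two_pi_I_mul _).trans ?_
  rw [key]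
  have bF : ∀ s ∈ Set.Icc a b, ‖((F s : ℝ) : ℂ) * ex (l * Θ s)‖ ≤ B / (l * δ) := by
    intro s hs
    rw [norm_mul, norm_ex, mul_one, Complex.norm_real, Real.norm_eq_abs]
    simp only [F]
    rw [abs_div, abs_div, abs_of_pos hl, div_div, mul_comm l δ]
    exact div_le_div₀ hB0 (bQ s hs) (by positivity)
      (mul_le_mul_of_nonneg_right (hd s hs) hl.le)
  have bInt : ‖∫ s in a..b, ((F' s : ℝ) : ℂ) * ex (l * Θ s)‖ ≤
      ∫ s in a..b, (B / (l * δ) + B / l * ((s - σ) ^ 2)⁻¹) := by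
    refine intervalIntegral.norm_integral_le_of_norm_le hab (ae_of_all _ fun s hs => ?_) ?_
    · have hs' : s ∈ Set.Icc a b := ⟨hs.1.le, hs.2⟩
      have h0 := hd0 s hs'
      rw [norm_mul, norm_ex, mul_one, Complex.norm_real, Real.norm_eq_abs]
      have e : F' s = Q' s / (s - σ) / l - Q s / l * ((s - σ) ^ 2)⁻¹ := by
        simp only [F']; field_simp
      rw [e]
      refine (abs_sub _ _).trans (add_le_add ?_ ?_)
      · rw [abs_div, abs_div, abs_of_pos hl, div_div, mul_comm l δ]
        exact div_le_div₀ hB0 (bQ' s hs') (by positivity)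
          (mul_le_mul_of_nonneg_right (hd s hs') hl.le)
      · rw [abs_mul, abs_div, abs_of_pos hl, abs_of_nonneg (by positivity : 0 ≤ ((s - σ) ^ 2)⁻¹)]
        gcongr
        exact bQ s hs'
    · apply ContinuousOn.intervalIntegrable
      rw [hu]
      exact continuousOn_const.add (continuousOn_const.mul ((hsc.pow 2).inv₀
        fun s hs => pow_ne_zero 2 (hd0 s hs)))
  have eInt : ∫ s in a..b, (B / (l * δ) + B / l * ((s - σ) ^ 2)⁻¹) =
      (B / (l * δ) * b - B / l * (b - σ)⁻¹) - (B / (l * δ) * a - B / l * (a - σ)⁻¹) := by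
    refine intervalIntegral.integral_eq_sub_of_hasDerivAt
      (f := fun s => B / (l * δ) * s - B / l * (s - σ)⁻¹) (fun s hs => ?_) ?_
    · rw [hu] at hs
      have h1 : HasDerivAt (fun s => B / (l * δ) * s - B / l * (s - σ)⁻¹)
          (B / (l * δ) * 1 - B / l * (-1 / (s - σ) ^ 2)) s :=
        ((hasDerivAt_id s).const_mul (B / (l * δ))).sub
          ((((hasDerivAt_id s).sub_const σ).fun_inv (hd0 s hs)).const_mul (B / l))
      exact h1.congr_deriv (by ring)
    · apply ContinuousOn.intervalIntegrable
      rw [hu]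
      exact continuousOn_const.add (continuousOn_const.mul ((hsc.pow 2).inv₀
        fun s hs => pow_ne_zero 2 (hd0 s hs)))
  have hinv : ∀ s ∈ Set.Icc a b, |(s - σ)⁻¹| ≤ δ⁻¹ := fun s hs => by
    rw [abs_inv]; exact inv_anti₀ hδ (hd s hs)
  have h1 := abs_le.1 (hinv a haI)
  have h2 := abs_le.1 (hinv b hbI)
  have hBl : 0 ≤ B / l := by positivity
  have e3 : B / (l * δ) = B / l * δ⁻¹ := by field_simp
  calc _ ≤ B / (l * δ) + B / (l * δ) + (B / (l * δ) * (b - a) + B / l * (2 * δ⁻¹)) := by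
        refine (norm_sub_le _ _).trans (add_le_add ((norm_sub_le _ _).trans
          (add_le_add (bF b hbI) (bF a haI))) (bInt.trans ?_))
        rw [eInt]
        nlinarith
    _ = B * (4 + (b - a)) / (l * δ) := by
        rw [e3]; field_simp; ring

/-- The second derivative bound of van der Corput for a phase with an explicit stationary point. -/
lemma norm_integral_stationary_le {G G' H H' Θ : ℝ → ℝ} {l σ g μ h : ℝ} (hab : a ≤ b)
    (hl : 0 < l) (hμ : 0 < μ)
    (hΘ : ∀ s ∈ Set.Icc a b, HasDerivAt Θ ((s - σ) * H s) s)
    (hG : ∀ s ∈ Set.Icc a b, HasDerivAt G (G' s) s) (hG' : ContinuousOn G' (Set.Icc a b))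
    (hH : ∀ s ∈ Set.Icc a b, HasDerivAt H (H' s) s) (hH' : ContinuousOn H' (Set.Icc a b))
    (bG : ∀ s ∈ Set.Icc a b, |G s| ≤ g) (bG' : ∀ s ∈ Set.Icc a b, |G' s| ≤ g)
    (bH : ∀ s ∈ Set.Icc a b, μ ≤ H s) (bH' : ∀ s ∈ Set.Icc a b, |H' s| ≤ h) :
    ‖∫ s in a..b, ((G s : ℝ) : ℂ) * ex (l * Θ s)‖ ≤
      (2 * g + 2 * ((g / μ + g * h / μ ^ 2) * (4 + (b - a)))) / √l := by
  have haI : a ∈ Set.Icc a b := ⟨le_rfl, hab⟩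
  have hg : 0 ≤ g := (abs_nonneg _).trans (bG a haI)
  have hh : 0 ≤ h := (abs_nonneg _).trans (bH' a haI)
  have hsl : 0 < √l := Real.sqrt_pos.2 hl
  set δ : ℝ := (√l)⁻¹ with hδd
  have hδ : 0 < δ := by positivity
  have hlδ : l * δ = √l := by
    rw [hδd]; nth_rewrite 1 [← Real.mul_self_sqrt hl.le]; field_simp
  set p : ℝ := max a (min b (σ - δ)) with hp
  set r : ℝ := max a (min b (σ + δ)) with hr
  have hap : a ≤ p := le_max_left _ _
  have hpr : p ≤ r := max_le_max le_rfl (min_le_min le_rfl (by linarith))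
  have hrb : r ≤ b := max_le hab (min_le_left _ _)
  have hpb : p ≤ b := hpr.trans hrb
  have har : a ≤ r := hap.trans hpr
  have hcont : ContinuousOn (fun s => ((G s : ℝ) : ℂ) * ex (l * Θ s)) (Set.Icc a b) :=
    (Complex.continuous_ofReal.comp_continuousOn
      fun s hs => (hG s hs).continuousAt.continuousWithinAt).mul
      (continuous_ex.comp_continuousOn (continuousOn_const.mul
        fun s hs => (hΘ s hs).continuousAt.continuousWithinAt))
  have hint : ∀ x y, a ≤ x → x ≤ y → y ≤ b →
      IntervalIntegrable (fun s => ((G s : ℝ) : ℂ) * ex (l * Θ s)) volume x y := by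
    intro x y hx hxy hy
    apply ContinuousOn.intervalIntegrable
    rw [Set.uIcc_of_le hxy]
    exact hcont.mono (Set.Icc_subset_Icc hx hy)
  rw [← intervalIntegral.integral_add_adjacent_intervals (hint a r le_rfl har hrb)
    (hint r b har hrb le_rfl), ← intervalIntegral.integral_add_adjacent_intervals
    (hint a p le_rfl hap hpb) (hint p r hap hpr hrb)]
  set W : ℝ := g / μ + g * h / μ ^ 2 with hW
  have hW0 : 0 ≤ W := by positivity
  have outer : ∀ x y, a ≤ x → x ≤ y → y ≤ b →
      (x = y ∨ (∀ s ∈ Set.Icc x y, δ ≤ s - σ) ∨ (∀ s ∈ Set.Icc x y, δ ≤ σ - s)) →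
      ‖∫ s in x..y, ((G s : ℝ) : ℂ) * ex (l * Θ s)‖ ≤ W * (4 + (b - a)) / √l := by
    intro x y hx hxy hy hs
    rcases hs with hs | hs
    · rw [hs, intervalIntegral.integral_same, norm_zero]
      have : 0 ≤ b - a := sub_nonneg.2 hab
      positivity
    · have hsub : Set.Icc x y ⊆ Set.Icc a b := Set.Icc_subset_Icc hx hy
      have := norm_integral_off_stationary_le hxy hl hδ hμ hs (fun s h => hΘ s (hsub h))
        (fun s h => hG s (hsub h)) (hG'.mono hsub) (fun s h => hH s (hsub h)) (hH'.mono hsub)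
        (fun s h => bG s (hsub h)) (fun s h => bG' s (hsub h)) (fun s h => bH s (hsub h))
        (fun s h => bH' s (hsub h))
      rw [hlδ] at this
      refine this.trans ?_
      gcongr
  have left := outer a p le_rfl hap hpb (by
    rcases le_or_gt (min b (σ - δ)) a with h1 | h1
    · exact Or.inl (by rw [hp, max_eq_left h1])
    · refine Or.inr (Or.inr fun s hs => ?_)
      have : p ≤ σ - δ := by rw [hp, max_eq_right h1.le]; exact min_le_right _ _
      linarith [hs.2])
  have right := outer r b har hrb le_rfl (by
    rcases le_or_gt b (σ + δ) with h1 | h1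
    · exact Or.inl (by rw [hr, min_eq_left h1, max_eq_right hab])
    · refine Or.inr (Or.inl fun s hs => ?_)
      have : σ + δ ≤ r := by rw [hr, min_eq_right h1.le]; exact le_max_right _ _
      linarith [hs.1])
  have hmid : r - p ≤ 2 * δ := by
    have : r ≤ p + 2 * δ := by
      refine max_le (by linarith) ?_
      rcases le_total b (σ - δ) with h1 | h1
      · have : b ≤ p := by rw [hp, min_eq_left h1]; exact le_max_right _ _
        linarith [min_le_left b (σ + δ)]
      · have : σ - δ ≤ p := by rw [hp, min_eq_right h1]; exact le_max_right _ _
        linarith [min_le_right b (σ + δ)]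
    linarith
  have mid := norm_integral_ex_le (φ := fun s => l * Θ s) (G := G) (B := g) hpr
    fun s hs => bG s ⟨hap.trans hs.1, hs.2.trans hrb⟩
  have mid' : ‖∫ s in p..r, ((G s : ℝ) : ℂ) * ex (l * Θ s)‖ ≤ 2 * g / √l := by
    refine mid.trans ?_
    rw [div_eq_mul_inv, mul_comm 2 g, mul_assoc]
    exact mul_le_mul_of_nonneg_left hmid hg
  calc _ ≤ W * (4 + (b - a)) / √l + 2 * g / √l + W * (4 + (b - a)) / √l :=
        (norm_add_le _ _).trans (add_le_add ((norm_add_le _ _).trans (add_le_add left mid')) right)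
    _ = _ := by ring

end Oscillatory

/-- Two integrations by parts for a phase without stationary points. -/
lemma norm_integral_nonstationary_le {a b Δ μ B W : ℝ} {w w' w'' φ q q' q'' : ℝ → ℝ} (hab : a ≤ b)
    (hΔ : 0 < Δ) (hμ : 0 < μ)
    (hw : ∀ s ∈ Set.Icc a b, HasDerivAt w (w' s) s)
    (hw' : ∀ s ∈ Set.Icc a b, HasDerivAt w' (w'' s) s) (hw'' : ContinuousOn w'' (Set.Icc a b))
    (hφ : ∀ s ∈ Set.Icc a b, HasDerivAt φ (q s) s)
    (hq : ∀ s ∈ Set.Icc a b, HasDerivAt q (q' s) s)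
    (hq' : ∀ s ∈ Set.Icc a b, HasDerivAt q' (q'' s) s) (hq'' : ContinuousOn q'' (Set.Icc a b))
    (wa : w a = 0) (wb : w b = 0) (wa' : w' a = 0) (wb' : w' b = 0)
    (bw : ∀ s ∈ Set.Icc a b, |w s| ≤ W) (bw' : ∀ s ∈ Set.Icc a b, |w' s| ≤ W)
    (bw'' : ∀ s ∈ Set.Icc a b, |w'' s| ≤ W) (bq : ∀ s ∈ Set.Icc a b, μ * Δ ≤ |q s|)
    (bq' : ∀ s ∈ Set.Icc a b, |q' s| ≤ B * Δ) (bq'' : ∀ s ∈ Set.Icc a b, |q'' s| ≤ B * Δ) :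
    ‖∫ s in a..b, ((w s : ℝ) : ℂ) * ex (φ s)‖ ≤
      W * (1 / μ ^ 2 + 4 * B / μ ^ 3 + 3 * B ^ 2 / μ ^ 4) * (b - a) / Δ ^ 2 := by
  have hu : Set.uIcc a b = Set.Icc a b := Set.uIcc_of_le hab
  have haI : a ∈ Set.Icc a b := ⟨le_rfl, hab⟩
  have hW : 0 ≤ W := (abs_nonneg _).trans (bw a haI)
  have hB : 0 ≤ B := by
    have := (abs_nonneg _).trans (bq' a haI)
    exact nonneg_of_mul_nonneg_left this hΔ
  have q0 : ∀ s ∈ Set.Icc a b, q s ≠ 0 := fun s hs h0 => by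
    have := bq s hs; rw [h0, abs_zero] at this; nlinarith [mul_pos hμ hΔ]
  have cw : ContinuousOn w (Set.Icc a b) := fun s hs => (hw s hs).continuousAt.continuousWithinAt
  have cw' : ContinuousOn w' (Set.Icc a b) := fun s hs => (hw' s hs).continuousAt.continuousWithinAt
  have cq : ContinuousOn q (Set.Icc a b) := fun s hs => (hq s hs).continuousAt.continuousWithinAt
  have cq' : ContinuousOn q' (Set.Icc a b) := fun s hs => (hq' s hs).continuousAt.continuousWithinAt
  set F₁ : ℝ → ℝ := fun s => w s / q s
  set F₁' : ℝ → ℝ := fun s => (w' s * q s - w s * q' s) / q s ^ 2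
  set F₂ : ℝ → ℝ := fun s => F₁' s / q s
  set F₂' : ℝ → ℝ := fun s =>
    w'' s / q s ^ 2 - 3 * (w' s * q' s) / q s ^ 3 - w s * q'' s / q s ^ 3
      + 3 * (w s * q' s ^ 2) / q s ^ 4
  have hF₁ : ∀ s ∈ Set.uIcc a b, HasDerivAt F₁ (F₁' s) s := fun s hs => by
    rw [hu] at hs
    exact (hw s hs).div (hq s hs) (q0 s hs)
  have hF₂ : ∀ s ∈ Set.uIcc a b, HasDerivAt F₂ (F₂' s) s := fun s hs => by
    rw [hu] at hs
    have hq0 := q0 s hs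
    have h1 := (((hw' s hs).mul (hq s hs)).sub ((hw s hs).mul (hq' s hs))).div ((hq s hs).pow 2)
      (pow_ne_zero 2 hq0)
    refine (h1.div (hq s hs) hq0).congr_deriv ?_
    simp only [F₂', Pi.sub_apply, Pi.mul_apply, Pi.pow_apply, Pi.div_apply]
    field_simp
    ring
  have cF₁' : ContinuousOn F₁' (Set.uIcc a b) := by
    rw [hu]
    exact ((cw'.mul cq).sub (cw.mul cq')).div (cq.pow 2) fun s hs => pow_ne_zero 2 (q0 s hs)
  have cF₂' : ContinuousOn F₂' (Set.uIcc a b) := by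
    rw [hu]
    exact (((hw''.div (cq.pow 2) fun s hs => pow_ne_zero 2 (q0 s hs)).sub
      ((continuousOn_const.mul (cw'.mul cq')).div (cq.pow 3)
        fun s hs => pow_ne_zero 3 (q0 s hs))).sub
      ((cw.mul hq'').div (cq.pow 3) fun s hs => pow_ne_zero 3 (q0 s hs))).add
      ((continuousOn_const.mul (cw.mul (cq'.pow 2))).div (cq.pow 4)
        fun s hs => pow_ne_zero 4 (q0 s hs))
  have hφu : ∀ s ∈ Set.uIcc a b, HasDerivAt φ (q s) s := fun s hs => hφ s (hu ▸ hs)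
  have cqu : ContinuousOn q (Set.uIcc a b) := hu ▸ cq
  have e₁ : ∫ s in a..b, ((w s : ℝ) : ℂ) * ex (φ s) =
      ∫ s in a..b, ((F₁ s * q s : ℝ) : ℂ) * ex (φ s) :=
    intervalIntegral.integral_congr fun s hs => by
      simp only [F₁]
      rw [div_mul_cancel₀ _ (q0 s (hu ▸ hs))]
  have e₂ : ∫ s in a..b, ((F₁' s : ℝ) : ℂ) * ex (φ s) =
      ∫ s in a..b, ((F₂ s * q s : ℝ) : ℂ) * ex (φ s) :=
    intervalIntegral.integral_congr fun s hs => by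
      simp only [F₂]
      rw [div_mul_cancel₀ _ (q0 s (hu ▸ hs))]
  rw [e₁]
  refine (norm_integral_by_parts_le hF₁ hφu cF₁' cqu (by simp [F₁, wa]) (by simp [F₁, wb])).trans ?_
  rw [e₂]
  refine (norm_integral_by_parts_le hF₂ hφu cF₂' cqu (by simp [F₂, F₁', wa, wa'])
    (by simp [F₂, F₁', wb, wb'])).trans ?_
  refine (norm_integral_ex_le hab (B := W * (1 / μ ^ 2 + 4 * B / μ ^ 3 + 3 * B ^ 2 / μ ^ 4) / Δ ^ 2)
    fun s hs => ?_).trans_eq (by ring)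
  have hpow : ∀ n : ℕ, (μ * Δ) ^ n ≤ |q s ^ n| := fun n => by
    rw [abs_pow]; exact pow_le_pow_left₀ (by positivity) (bq s hs) n
  have hs2 := bq' s hs
  have hBΔ : 0 ≤ B * Δ := by positivity
  have t1 : |w'' s / q s ^ 2| ≤ W / (μ * Δ) ^ 2 := by
    rw [abs_div]; exact div_le_div₀ hW (bw'' s hs) (by positivity) (hpow 2)
  have t2 : |3 * (w' s * q' s) / q s ^ 3| ≤ 3 * (W * (B * Δ)) / (μ * Δ) ^ 3 := by
    rw [abs_div, abs_mul, abs_mul, abs_of_pos (by norm_num : (0:ℝ) < 3)]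
    exact div_le_div₀ (by positivity) (mul_le_mul_of_nonneg_left
      (mul_le_mul (bw' s hs) hs2 (abs_nonneg _) hW) (by norm_num)) (by positivity) (hpow 3)
  have t3 : |w s * q'' s / q s ^ 3| ≤ (W * (B * Δ)) / (μ * Δ) ^ 3 := by
    rw [abs_div, abs_mul]
    exact div_le_div₀ (by positivity)
      (mul_le_mul (bw s hs) (bq'' s hs) (abs_nonneg _) hW) (by positivity) (hpow 3)
  have t4 : |3 * (w s * q' s ^ 2) / q s ^ 4| ≤ 3 * (W * (B * Δ) ^ 2) / (μ * Δ) ^ 4 := by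
    rw [abs_div, abs_mul, abs_mul, abs_of_pos (by norm_num : (0:ℝ) < 3), abs_pow (q' s)]
    exact div_le_div₀ (by positivity) (mul_le_mul_of_nonneg_left
      (mul_le_mul (bw s hs) (pow_le_pow_left₀ (abs_nonneg _) hs2 2) (by positivity) hW)
      (by norm_num)) (by positivity) (hpow 4)
  calc |F₂' s| ≤ W / (μ * Δ) ^ 2 + 3 * (W * (B * Δ)) / (μ * Δ) ^ 3 + (W * (B * Δ)) / (μ * Δ) ^ 3
        + 3 * (W * (B * Δ) ^ 2) / (μ * Δ) ^ 4 :=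
        (abs_add_le _ _).trans (add_le_add ((abs_sub _ _).trans (add_le_add
          ((abs_sub _ _).trans (add_le_add t1 t2)) t3)) t4)
    _ = _ := by field_simp; ring

/-- A smooth bump function equal to `1` on `[1, 2]` and supported in `[1/2, 5/2]`. -/
noncomputable def bump : ContDiffBump (3 / 2 : ℝ) := ⟨1 / 2, 1, by norm_num, by norm_num⟩

lemma bump_eq_one {s : ℝ} (h1 : 1 ≤ s) (h2 : s ≤ 2) : bump s = 1 := by
  apply bump.one_of_mem_closedBall
  rw [Metric.mem_closedBall, Real.dist_eq, abs_le]
  constructor <;> simp only [bump] <;> linarith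

lemma bump_eq_zero {s : ℝ} (h : s ≤ 1 / 2 ∨ 5 / 2 ≤ s) : bump s = 0 := by
  apply bump.zero_of_le_dist
  rw [Real.dist_eq, le_abs]
  simp only [bump]
  rcases h with h | h
  · right; linarith
  · left; linarith

lemma bump_eventuallyEq_zero {s : ℝ} (h : s < 1 / 2 ∨ 5 / 2 < s) : bump =ᶠ[nhds s] fun _ => 0 := by
  rcases h with h | h
  · filter_upwards [Iio_mem_nhds h] with t ht using bump_eq_zero (Or.inl ht.le)
  · filter_upwards [Ioi_mem_nhds h] with t ht using bump_eq_zero (Or.inr ht.le)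

lemma contDiff_bump {n : ℕ∞} : ContDiff ℝ n bump := bump.contDiff

lemma hasDerivAt_bump (s : ℝ) : HasDerivAt bump (deriv bump s) s :=
  ((contDiff_bump (n := 1)).differentiable (by norm_num) s).hasDerivAt

lemma contDiff_deriv_bump {n : ℕ∞} : ContDiff ℝ n (deriv bump) := by
  have h : ContDiff ℝ (n + 1 : ℕ∞) bump := contDiff_bump
  exact (contDiff_succ_iff_deriv (n := n).1 (by exact_mod_cast h)).2.2

lemma hasDerivAt_deriv_bump (s : ℝ) : HasDerivAt (deriv bump) (deriv (deriv bump) s) s :=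
  ((contDiff_deriv_bump (n := 1)).differentiable (by norm_num) s).hasDerivAt

lemma continuous_deriv_deriv_bump : Continuous (deriv (deriv bump)) :=
  (contDiff_deriv_bump (n := 1)).continuous_deriv (by norm_num)

lemma deriv_bump_eq_zero {s : ℝ} (h : s ≤ 1 / 2 ∨ 5 / 2 < s) : deriv bump s = 0 := by
  have key : ∀ t, (t < 1 / 2 ∨ 5 / 2 < t) → deriv bump t = 0 := fun t ht => by
    rw [(bump_eventuallyEq_zero ht).deriv_eq]; simp
  rcases h with h | h
  · rcases h.lt_or_eq with h | h
    · exact key s (Or.inl h)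
    · subst h
      have hc : Continuous (deriv bump) := (contDiff_deriv_bump (n := 0)).continuous
      have : Set.EqOn (deriv bump) (fun _ => 0) (closure (Set.Iio (1 / 2 : ℝ))) :=
        Set.EqOn.closure (fun t ht => key t (Or.inl ht)) hc continuous_const
      exact this (by rw [closure_Iio]; exact Set.mem_Iic.2 le_rfl)
  · exact key s (Or.inr h)

lemma exists_bump_bound : ∃ W : ℝ, 1 ≤ W ∧ ∀ s, |bump s| ≤ W ∧ |deriv bump s| ≤ W ∧
    |deriv (deriv bump) s| ≤ W := by
  have c0 : Continuous bump := (contDiff_bump (n := 0)).continuous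
  have c1 : Continuous (deriv bump) := (contDiff_deriv_bump (n := 0)).continuous
  have k0 : HasCompactSupport (bump : ℝ → ℝ) := bump.hasCompactSupport
  obtain ⟨A, hA⟩ := k0.exists_bound_of_continuous c0
  obtain ⟨B, hB⟩ := k0.deriv.exists_bound_of_continuous c1
  obtain ⟨C, hC⟩ := k0.deriv.deriv.exists_bound_of_continuous continuous_deriv_deriv_bump
  refine ⟨max 1 (max A (max B C)), le_max_left _ _, fun s => ⟨?_, ?_, ?_⟩⟩
  · exact (hA s).trans ((le_max_left _ _).trans (le_max_right _ _))
  · exact (hB s).trans ((le_max_left _ _).trans ((le_max_right _ _).trans (le_max_right _ _)))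
  · exact (hC s).trans ((le_max_right _ _).trans ((le_max_right _ _).trans (le_max_right _ _)))

/-- The oscillatory integral dual to the smoothed exponential sum. -/
noncomputable def oscInt (c l r : ℝ) : ℂ :=
  ∫ s in (1 / 2 : ℝ)..4, ((bump s : ℝ) : ℂ) * ex (l * s ^ c - r * s)

lemma norm_oscInt_le (c l r : ℝ) : ‖oscInt c l r‖ ≤ 4 := by
  refine (norm_integral_ex_le (B := 1) (by norm_num) fun s _ => ?_).trans (by norm_num)
  rw [abs_of_nonneg bump.nonneg]
  exact bump.le_one

lemma exists_norm_oscInt_le (c : ℝ) {μ : ℝ} (hμ : 0 < μ) :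
    ∃ C : ℝ, 0 ≤ C ∧ ∀ l r : ℝ, 0 ≤ l → 0 < l + |r| →
      (∀ s ∈ Set.Icc (1 / 2 : ℝ) 4, μ * (l + |r|) ≤ |c * l * s ^ (c - 1) - r|) →
      ‖oscInt c l r‖ ≤ C / (l + |r|) ^ 2 := by
  obtain ⟨W, hW1, hW⟩ := exists_bump_bound
  have hW0 : 0 ≤ W := by linarith
  have hcont : ∀ p : ℝ, ContinuousOn (fun s : ℝ => s ^ p) (Set.Icc (1 / 2 : ℝ) 4) := fun p s hs =>
    (Real.continuousAt_rpow_const s p (Or.inl (by linarith [hs.1]))).continuousWithinAt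
  obtain ⟨B₁, hB₁⟩ := isCompact_Icc.exists_bound_of_continuousOn (hcont (c - 2))
  obtain ⟨B₂, hB₂⟩ := isCompact_Icc.exists_bound_of_continuousOn (hcont (c - 3))
  set B : ℝ := max (|c * (c - 1)| * B₁) (|c * (c - 1) * (c - 2)| * B₂) with hBdef
  have hB : 0 ≤ B := le_max_of_le_left (mul_nonneg (abs_nonneg _)
    ((norm_nonneg _).trans (hB₁ 1 ⟨by norm_num, by norm_num⟩)))
  refine ⟨W * (1 / μ ^ 2 + 4 * B / μ ^ 3 + 3 * B ^ 2 / μ ^ 4) * (4 - 1 / 2), by positivity,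
    fun l r hl hΔ hlow => ?_⟩
  have hpow : ∀ p : ℝ, ∀ s ∈ Set.Icc (1 / 2 : ℝ) 4,
      HasDerivAt (fun s : ℝ => s ^ p) (p * s ^ (p - 1)) s := fun p s hs =>
    Real.hasDerivAt_rpow_const (Or.inl (by linarith [hs.1]))
  have hlΔ : l ≤ l + |r| := by linarith [abs_nonneg r]
  refine norm_integral_nonstationary_le (w := bump) (w' := deriv bump) (w'' := deriv (deriv bump))
    (q := fun s => c * l * s ^ (c - 1) - r) (q' := fun s => c * (c - 1) * l * s ^ (c - 2))
    (q'' := fun s => c * (c - 1) * (c - 2) * l * s ^ (c - 3))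
    (by norm_num) hΔ hμ (fun s _ => hasDerivAt_bump s) (fun s _ => hasDerivAt_deriv_bump s)
    continuous_deriv_deriv_bump.continuousOn ?_ ?_ ?_ (continuousOn_const.mul (hcont _))
    (bump_eq_zero (by norm_num)) (bump_eq_zero (by norm_num))
    (deriv_bump_eq_zero (by norm_num)) (deriv_bump_eq_zero (by norm_num))
    (fun s _ => (hW s).1) (fun s _ => (hW s).2.1) (fun s _ => (hW s).2.2) hlow ?_ ?_
  · intro s hs
    refine (((hpow c s hs).const_mul l).sub ((hasDerivAt_id s).const_mul r)).congr_deriv ?_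
    ring
  · intro s hs
    refine (((hpow (c - 1) s hs).const_mul (c * l)).sub_const r).congr_deriv ?_
    rw [show c - 1 - 1 = c - 2 by ring]
    ring
  · intro s hs
    refine ((hpow (c - 2) s hs).const_mul (c * (c - 1) * l)).congr_deriv ?_
    rw [show c - 2 - 1 = c - 3 by ring]
    ring
  · intro s hs
    have h := hB₁ s hs
    rw [Real.norm_eq_abs] at h
    rw [show c * (c - 1) * l * s ^ (c - 2) = c * (c - 1) * s ^ (c - 2) * l by ring, abs_mul,
      abs_mul _ (s ^ _), abs_of_nonneg hl]
    refine mul_le_mul ?_ hlΔ hl hB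
    exact (mul_le_mul_of_nonneg_left h (abs_nonneg _)).trans (le_max_left _ _)
  · intro s hs
    have h := hB₂ s hs
    rw [Real.norm_eq_abs] at h
    rw [show c * (c - 1) * (c - 2) * l * s ^ (c - 3) = c * (c - 1) * (c - 2) * s ^ (c - 3) * l by
      ring, abs_mul, abs_mul _ (s ^ _), abs_of_nonneg hl]
    refine mul_le_mul ?_ hlΔ hl hB
    exact (mul_le_mul_of_nonneg_left h (abs_nonneg _)).trans (le_max_right _ _)

lemma analyticAt_dslope_one {f : ℝ → ℝ} (hf : ∀ v, 0 < v → AnalyticAt ℝ f v) {v : ℝ} (hv : 0 < v) :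
    AnalyticAt ℝ (dslope f 1) v := by
  rcases eq_or_ne v 1 with rfl | h
  · obtain ⟨p, hp⟩ := hf 1 one_pos
    exact hp.has_fpower_series_dslope_fslope.analyticAt
  · refine AnalyticAt.congr ?_ (dslope_eventuallyEq_slope_of_ne f h).symm
    have h1 : AnalyticAt ℝ (fun b : ℝ => (b - 1)⁻¹ * (f b - f 1)) v :=
      ((analyticAt_id.sub analyticAt_const).inv (sub_ne_zero.2 h)).mul
        ((hf v hv).sub analyticAt_const)
    exact h1

lemma analyticAt_rpow (p : ℝ) {v : ℝ} (hv : 0 < v) : AnalyticAt ℝ (fun v : ℝ => v ^ p) v :=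
  (Real.contDiffAt_rpow_const_of_ne hv.ne').analyticAt

/-- The normalised phase, with its only stationary point at `1`. -/
noncomputable def phase (c v : ℝ) : ℝ := v ^ c - c * v + (c - 1)

lemma hasDerivAt_phase (c : ℝ) {v : ℝ} (hv : 0 < v) :
    HasDerivAt (phase c) ((v - 1) * (c * dslope (fun v : ℝ => v ^ (c - 1)) 1 v)) v := by
  have h : HasDerivAt (phase c) (c * v ^ (c - 1) - c * 1) v :=
    ((Real.hasDerivAt_rpow_const (Or.inl hv.ne')).sub
      ((hasDerivAt_id v).const_mul c)).add_const (c - 1)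
  refine h.congr_deriv ?_
  have := sub_smul_dslope (fun v : ℝ => v ^ (c - 1)) 1 v
  simp only [smul_eq_mul, Real.one_rpow] at this
  linear_combination -c * this

lemma analyticAt_phase (c : ℝ) {v : ℝ} (hv : 0 < v) : AnalyticAt ℝ (phase c) v :=
  ((analyticAt_rpow c hv).sub (analyticAt_const.mul analyticAt_id)).add analyticAt_const

lemma dslope_rpow_pos {p v : ℝ} (hp : 0 < p) (hv : 0 < v) :
    0 < dslope (fun v : ℝ => v ^ p) 1 v := by
  rcases lt_trichotomy v 1 with h | rfl | h
  · rw [dslope_of_ne _ h.ne, slope_def_field]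
    apply div_pos_of_neg_of_neg
    · simpa using Real.rpow_lt_one hv.le h hp
    · linarith
  · rw [dslope_same]
    have : HasDerivAt (fun v : ℝ => v ^ p) (p * 1 ^ (p - 1)) 1 :=
      Real.hasDerivAt_rpow_const (Or.inl one_ne_zero)
    rw [this.deriv]
    simpa using hp
  · rw [dslope_of_ne _ h.ne', slope_def_field]
    apply div_pos
    · simpa using Real.one_lt_rpow h hp
    · linarith

/-- The ratio of the phase to its derivative. -/
noncomputable def phaseRatio (c v : ℝ) : ℝ :=
  dslope (phase c) 1 v / (c * dslope (fun v : ℝ => v ^ (c - 1)) 1 v)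

lemma phaseRatio_mul {c v : ℝ} (hc : 1 < c) (hv : 0 < v) :
    phaseRatio c v * ((v - 1) * (c * dslope (fun v : ℝ => v ^ (c - 1)) 1 v)) = phase c v := by
  have h1 := dslope_rpow_pos (sub_pos.2 hc) hv
  have h2 := sub_smul_dslope (phase c) 1 v
  have h3 : phase c 1 = 0 := by simp [phase]
  rw [h3, sub_zero, smul_eq_mul] at h2
  rw [phaseRatio, ← h2]
  have : c ≠ 0 := by linarith
  field_simp

lemma analyticAt_phaseRatio {c v : ℝ} (hc : 1 < c) (hv : 0 < v) :
    AnalyticAt ℝ (phaseRatio c) v :=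
  (analyticAt_dslope_one (fun _ => analyticAt_phase c) hv).div
    (analyticAt_const.mul (analyticAt_dslope_one (fun _ => analyticAt_rpow (c - 1)) hv))
    (mul_pos (by linarith) (dslope_rpow_pos (sub_pos.2 hc) hv)).ne'

/-- A parametric integral with bounded derivative is Lipschitz. -/
lemma norm_integral_sub_le_of_deriv {a b x y B : ℝ} {k k' : ℝ → ℝ → ℂ} (hab : a ≤ b) (hx : 0 < x)
    (hy : 0 < y)
    (hk : ∀ x, 0 < x → ∀ t ∈ Set.Icc a b, HasDerivAt (fun x => k x t) (k' x t) x)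
    (ck : ∀ x, 0 < x → ContinuousOn (k x) (Set.Icc a b))
    (ck' : ContinuousOn (Function.uncurry k') (Set.Ioi 0 ×ˢ Set.Icc a b))
    (hB : ∀ z ∈ Set.uIcc x y, ‖∫ t in a..b, k' z t‖ ≤ B) :
    ‖(∫ t in a..b, k y t) - ∫ t in a..b, k x t‖ ≤ B * |y - x| := by
  have hu : Set.uIcc a b = Set.Icc a b := Set.uIcc_of_le hab
  have ck'x : ∀ z, 0 < z → ContinuousOn (k' z) (Set.Icc a b) := fun z hz =>
    ck'.comp (f := fun t => (z, t)) (by fun_prop) fun t ht => ⟨hz, ht⟩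
  have hd : ∀ z, 0 < z → HasDerivAt (fun z => ∫ t in a..b, k z t) (∫ t in a..b, k' z t) z := by
    intro z hz
    have hK : IsCompact (Set.Icc (z / 2) (2 * z) ×ˢ Set.Icc a b) := isCompact_Icc.prod isCompact_Icc
    obtain ⟨D, hD⟩ := hK.exists_bound_of_continuousOn (ck'.mono (Set.prod_mono
      (fun u hu => lt_of_lt_of_le (by positivity) hu.1) le_rfl))
    refine (intervalIntegral.hasDerivAt_integral_of_dominated_loc_of_deriv_le
      (s := Set.Icc (z / 2) (2 * z)) (bound := fun _ => D)
      (Icc_mem_nhds (by linarith) (by linarith)) ?_ ?_ ?_ ?_ ?_ ?_).2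
    · filter_upwards [Ioi_mem_nhds hz] with u hu'
      rw [Set.uIoc_of_le hab]
      exact ((ck u hu').mono Set.Ioc_subset_Icc_self).aestronglyMeasurable measurableSet_Ioc
    · exact (hu ▸ ck z hz : ContinuousOn (k z) (Set.uIcc a b)).intervalIntegrable
    · rw [Set.uIoc_of_le hab]
      exact ((ck'x z hz).mono Set.Ioc_subset_Icc_self).aestronglyMeasurable measurableSet_Ioc
    · refine ae_of_all _ fun t ht u hu' => ?_
      rw [Set.uIoc_of_le hab] at ht
      exact hD (u, t) ⟨hu', Set.Ioc_subset_Icc_self ht⟩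
    · exact intervalIntegrable_const
    · refine ae_of_all _ fun t ht u hu' => ?_
      rw [Set.uIoc_of_le hab] at ht
      exact hk u (lt_of_lt_of_le (by positivity) hu'.1) t (Set.Ioc_subset_Icc_self ht)
  have hpos : ∀ z ∈ Set.uIcc x y, 0 < z := fun z hz =>
    lt_of_lt_of_le (lt_min hx hy) hz.1
  have := (convex_uIcc x y).norm_image_sub_le_of_norm_hasDerivWithin_le
    (fun z hz => (hd z (hpos z hz)).hasDerivWithinAt) hB Set.left_mem_uIcc Set.right_mem_uIcc
  simpa using this

lemma intervalIntegral_bump_mul (h : ℝ → ℂ) {a b : ℝ} (ha : a ≤ 1 / 2) (hb : 4 ≤ b) :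
    ∫ s in a..b, ((bump s : ℝ) : ℂ) * h s = ∫ s, ((bump s : ℝ) : ℂ) * h s := by
  refine intervalIntegral.integral_eq_integral_of_support_subset fun s hs => ?_
  rw [Function.mem_support] at hs
  have h0 : bump s ≠ 0 := fun h => hs (by rw [h]; simp)
  by_contra hcon
  refine h0 (bump_eq_zero ?_)
  rw [Set.mem_Ioc, not_and_or, not_lt, not_le] at hcon
  rcases hcon with h | h
  · left; linarith
  · right; linarith

lemma oscInt_eq_integral {c l r a b : ℝ} (ha : a ≤ 1 / 2) (hb : 4 ≤ b) :
    oscInt c l r = ∫ s in a..b, ((bump s : ℝ) : ℂ) * ex (l * s ^ c - r * s) := by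
  rw [intervalIntegral_bump_mul _ ha hb, oscInt, intervalIntegral_bump_mul _ le_rfl le_rfl]

/-- The slowly varying factor of the oscillatory integral with stationary point `σ`. -/
noncomputable def amp (c l σ : ℝ) : ℂ :=
  ex ((c - 1) * (l * σ ^ c)) * oscInt c l (c * l * σ ^ (c - 1))

lemma amp_eq_integral {c l σ a b : ℝ} (ha : 0 < a) (hab : a ≤ b) (hσ : 0 < σ) (ha' : σ * a ≤ 1 / 2)
    (hb : 4 ≤ σ * b) :
    amp c l σ = ∫ v in a..b, (σ : ℂ) * ((bump (σ * v) : ℝ) : ℂ) * ex (l * σ ^ c * phase c v) := by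
  rw [amp, oscInt_eq_integral ha' hb, ← intervalIntegral.smul_integral_comp_mul_left,
    Complex.real_smul, mul_left_comm, ← intervalIntegral.integral_const_mul,
    ← intervalIntegral.integral_const_mul]
  refine intervalIntegral.integral_congr fun v hv => ?_
  rw [Set.uIcc_of_le hab] at hv
  have hv0 : 0 < v := ha.trans_le hv.1
  have e : l * σ ^ c * phase c v = (c - 1) * (l * σ ^ c) +
      (l * (σ * v) ^ c - c * l * σ ^ (c - 1) * (σ * v)) := by
    have h2 : σ ^ c = σ ^ (c - 1) * σ := by rw [← Real.rpow_add_one hσ.ne']; congr 1; ring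
    rw [Real.mul_rpow hσ.le hv0.le, phase]
    rw [h2]
    ring
  simp only [e, ex_add]
  ring

lemma exists_norm_integral_phase_le {c a b : ℝ} (hc : 1 < c) (ha : 0 < a) (hab : a ≤ b) :
    ∃ K : ℝ, 0 ≤ K ∧ ∀ (L g : ℝ) (G G' : ℝ → ℝ), 0 < L →
      (∀ s ∈ Set.Icc a b, HasDerivAt G (G' s) s) → ContinuousOn G' (Set.Icc a b) →
      (∀ s ∈ Set.Icc a b, |G s| ≤ g) → (∀ s ∈ Set.Icc a b, |G' s| ≤ g) →
      ‖∫ s in a..b, ((G s : ℝ) : ℂ) * ex (L * phase c s)‖ ≤ K * g / √L := by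
  have hpos : ∀ s ∈ Set.Icc a b, 0 < s := fun s hs => ha.trans_le hs.1
  set H : ℝ → ℝ := fun v => c * dslope (fun v : ℝ => v ^ (c - 1)) 1 v
  have aH : ∀ s ∈ Set.Icc a b, AnalyticAt ℝ H s := fun s hs =>
    analyticAt_const.mul (analyticAt_dslope_one (fun _ => analyticAt_rpow (c - 1)) (hpos s hs))
  have cH : ContinuousOn H (Set.Icc a b) := fun s hs => (aH s hs).continuousAt.continuousWithinAt
  have cH' : ContinuousOn (deriv H) (Set.Icc a b) := fun s hs =>
    (aH s hs).deriv.continuousAt.continuousWithinAt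
  obtain ⟨v₀, hv₀, hmin⟩ := isCompact_Icc.exists_isMinOn ⟨a, le_rfl, hab⟩ cH
  obtain ⟨h, hh⟩ := isCompact_Icc.exists_bound_of_continuousOn cH'
  have hμ : 0 < H v₀ := mul_pos (by linarith) (dslope_rpow_pos (sub_pos.2 hc) (hpos v₀ hv₀))
  have hh0 : 0 ≤ h := (norm_nonneg _).trans (hh a ⟨le_rfl, hab⟩)
  have hba : 0 ≤ b - a := sub_nonneg.2 hab
  refine ⟨2 + 2 * ((1 / H v₀ + h / H v₀ ^ 2) * (4 + (b - a))), by positivity,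
    fun L g G G' hL hG hG' bG bG' => ?_⟩
  refine (norm_integral_stationary_le (σ := 1) hab hL hμ
    (fun s hs => hasDerivAt_phase c (hpos s hs)) hG hG'
    (fun s hs => (aH s hs).differentiableAt.hasDerivAt) cH' bG bG' (fun s hs => hmin hs)
    hh).trans_eq ?_
  ring

lemma exists_norm_amp_le {c σ₁ σ₂ : ℝ} (hc : 1 < c) (hσ₁ : 0 < σ₁) (hσ : σ₁ ≤ σ₂) :
    ∃ C : ℝ, 0 ≤ C ∧ ∀ l : ℝ, 0 < l →
      (∀ σ ∈ Set.Icc σ₁ σ₂, ‖amp c l σ‖ ≤ C / √l) ∧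
      (∀ σ ∈ Set.Icc σ₁ σ₂, ∀ σ' ∈ Set.Icc σ₁ σ₂,
        ‖amp c l σ' - amp c l σ‖ ≤ C / √l * |σ' - σ|) := by
  have hσ₂ : 0 < σ₂ := hσ₁.trans_le hσ
  set a : ℝ := 1 / (2 * σ₂) with ha_def
  set b : ℝ := 4 / σ₁ with hb_def
  have ha : 0 < a := by positivity
  have hb : 0 < b := by positivity
  have hab : a ≤ b := by
    rw [ha_def, hb_def, div_le_div_iff₀ (by positivity) hσ₁]; linarith
  have hpos : ∀ s ∈ Set.Icc a b, 0 < s := fun s hs => ha.trans_le hs.1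
  have hσa : ∀ σ ∈ Set.Icc σ₁ σ₂, σ * a ≤ 1 / 2 := fun σ h => by
    rw [ha_def, mul_one_div, div_le_div_iff₀ (by positivity) (by norm_num)]; linarith [h.2]
  have hσb : ∀ σ ∈ Set.Icc σ₁ σ₂, 4 ≤ σ * b := fun σ h => by
    rw [hb_def, ← mul_div_assoc, le_div_iff₀ hσ₁]; linarith [h.1]
  obtain ⟨K, hK0, hK⟩ := exists_norm_integral_phase_le hc ha hab
  obtain ⟨W, hW1, hW⟩ := exists_bump_bound
  have hW0 : 0 ≤ W := by linarith
  set R : ℝ → ℝ := phaseRatio c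
  have aR : ∀ s ∈ Set.Icc a b, AnalyticAt ℝ R s := fun s hs => analyticAt_phaseRatio hc (hpos s hs)
  have cont : ∀ {f : ℝ → ℝ}, (∀ s ∈ Set.Icc a b, AnalyticAt ℝ f s) →
      ContinuousOn f (Set.Icc a b) := fun h s hs => (h s hs).continuousAt.continuousWithinAt
  obtain ⟨ρ₀, hρ₀⟩ := isCompact_Icc.exists_bound_of_continuousOn (cont aR)
  obtain ⟨ρ₁, hρ₁⟩ := isCompact_Icc.exists_bound_of_continuousOn (cont fun s hs => (aR s hs).deriv)
  obtain ⟨ρ₂, hρ₂⟩ :=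
    isCompact_Icc.exists_bound_of_continuousOn (cont fun s hs => (aR s hs).deriv.deriv)
  set ρ : ℝ := max ρ₀ (max ρ₁ ρ₂)
  have bR : ∀ s ∈ Set.Icc a b, |R s| ≤ ρ := fun s hs => (hρ₀ s hs).trans (le_max_left _ _)
  have bR' : ∀ s ∈ Set.Icc a b, |deriv R s| ≤ ρ := fun s hs =>
    (hρ₁ s hs).trans ((le_max_left _ _).trans (le_max_right _ _))
  have bR'' : ∀ s ∈ Set.Icc a b, |deriv (deriv R) s| ≤ ρ := fun s hs =>
    (hρ₂ s hs).trans ((le_max_right _ _).trans (le_max_right _ _))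
  have hρ : 0 ≤ ρ := (abs_nonneg _).trans (bR a ⟨le_rfl, hab⟩)
  set S : ℝ := 1 + σ₂ + σ₂ ^ 2
  have hS1 : 1 ≤ S := by simp only [S]; nlinarith
  have hS2 : σ₂ ≤ S := by simp only [S]; nlinarith
  have hS3 : σ₂ ^ 2 ≤ S := by simp only [S]; nlinarith
  have hS0 : 0 ≤ S := by linarith
  -- derivatives of the dilated bump
  have dB : ∀ σ s : ℝ, HasDerivAt (fun v => bump (σ * v)) (σ * deriv bump (σ * s)) s := fun σ s => by
    have := (hasDerivAt_bump (σ * s)).comp s ((hasDerivAt_id s).const_mul σ)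
    exact this.congr_deriv (by ring)
  have dB' : ∀ σ s : ℝ,
      HasDerivAt (fun v => deriv bump (σ * v)) (σ * deriv (deriv bump) (σ * s)) s := fun σ s => by
    have := (hasDerivAt_deriv_bump (σ * s)).comp s ((hasDerivAt_id s).const_mul σ)
    exact this.congr_deriv (by ring)
  have cB : Continuous (bump : ℝ → ℝ) := (contDiff_bump (n := 0)).continuous
  have cB' : Continuous (deriv bump) := (contDiff_deriv_bump (n := 0)).continuous
  have cB'' := continuous_deriv_deriv_bump
  have habs : ∀ σ ∈ Set.Icc σ₁ σ₂, |σ| ≤ S := fun σ h => by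
    rw [abs_of_pos (hσ₁.trans_le h.1)]; exact h.2.trans hS2
  have habs2 : ∀ σ ∈ Set.Icc σ₁ σ₂, |σ ^ 2| ≤ S := fun σ h => by
    rw [abs_of_nonneg (sq_nonneg _)]
    exact (pow_le_pow_left₀ (hσ₁.le.trans h.1) h.2 2).trans hS3
  -- the three oscillatory integrals
  have t1 : ∀ L σ, 0 < L → σ ∈ Set.Icc σ₁ σ₂ →
      ‖∫ v in a..b, ((bump (σ * v) : ℝ) : ℂ) * ex (L * phase c v)‖ ≤ K * (S * W) / √L := by
    intro L σ hL h
    refine hK L _ _ (fun s => σ * deriv bump (σ * s)) hL (fun s _ => dB σ s)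
      (by fun_prop) (fun s _ => (hW _).1.trans (by nlinarith)) fun s _ => ?_
    rw [abs_mul]
    exact mul_le_mul (habs σ h) (hW _).2.1 (abs_nonneg _) hS0
  have t2 : ∀ L σ, 0 < L → σ ∈ Set.Icc σ₁ σ₂ →
      ‖∫ v in a..b, ((v * deriv bump (σ * v) : ℝ) : ℂ) * ex (L * phase c v)‖ ≤
        K * (W + b * (S * W)) / √L := by
    intro L σ hL h
    have hvb : ∀ s ∈ Set.Icc a b, |s| ≤ b := fun s hs => by
      rw [abs_of_pos (hpos s hs)]; exact hs.2
    refine hK L _ _ (fun s => 1 * deriv bump (σ * s) + s * (σ * deriv (deriv bump) (σ * s))) hL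
      (fun s _ => (hasDerivAt_id s).mul (dB' σ s)) (by fun_prop) (fun s hs => ?_) fun s hs => ?_
    · rw [abs_mul]
      have := mul_le_mul (hvb s hs) (hW (σ * s)).2.1 (abs_nonneg _) hb.le
      have : b * W ≤ b * (S * W) := by gcongr; nlinarith
      linarith
    · refine (abs_add_le _ _).trans (add_le_add ?_ ?_)
      · rw [one_mul]; exact (hW _).2.1
      · rw [abs_mul, abs_mul]
        exact mul_le_mul (hvb s hs) (mul_le_mul (habs σ h) (hW _).2.2 (abs_nonneg _) hS0)
          (by positivity) hb.le
  have t3 : ∀ L σ, 0 < L → σ ∈ Set.Icc σ₁ σ₂ →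
      ‖∫ v in a..b, ((bump (σ * v) * (L * phase c v) : ℝ) : ℂ) * ex (L * phase c v)‖ ≤
        K * (4 * (S * W * ρ)) / √L := by
    intro L σ hL h
    set F : ℝ → ℝ := fun v => bump (σ * v) * R v
    set F' : ℝ → ℝ := fun v => σ * deriv bump (σ * v) * R v + bump (σ * v) * deriv R v
    set F'' : ℝ → ℝ := fun v => (σ * (σ * deriv (deriv bump) (σ * v)) * R v +
      σ * deriv bump (σ * v) * deriv R v) +
      (σ * deriv bump (σ * v) * deriv R v + bump (σ * v) * deriv (deriv R) v)
    have dF : ∀ s ∈ Set.Icc a b, HasDerivAt F (F' s) s := fun s hs =>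
      (dB σ s).mul (aR s hs).differentiableAt.hasDerivAt
    have dF' : ∀ s ∈ Set.Icc a b, HasDerivAt F' (F'' s) s := fun s hs =>
      (((dB' σ s).const_mul σ).mul (aR s hs).differentiableAt.hasDerivAt).add
        ((dB σ s).mul (aR s hs).deriv.differentiableAt.hasDerivAt)
    have cR := cont aR
    have cR' := cont fun s hs => (aR s hs).deriv
    have cR'' := cont fun s hs => (aR s hs).deriv.deriv
    have cF'' : ContinuousOn F'' (Set.Icc a b) := by
      refine ContinuousOn.add (ContinuousOn.add (ContinuousOn.mul ?_ cR) (ContinuousOn.mul ?_ cR'))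
        (ContinuousOn.add (ContinuousOn.mul ?_ cR') (ContinuousOn.mul ?_ cR'')) <;>
      exact Continuous.continuousOn (by fun_prop)
    have cF' : ContinuousOn F' (Set.Icc a b) := fun s hs => (dF' s hs).continuousAt.continuousWithinAt
    have hu : Set.uIcc a b = Set.Icc a b := Set.uIcc_of_le hab
    have e : ∫ v in a..b, ((bump (σ * v) * (L * phase c v) : ℝ) : ℂ) * ex (L * phase c v) =
        ∫ v in a..b, ((F v * (L * ((v - 1) * (c * dslope (fun v : ℝ => v ^ (c - 1)) 1 v))) : ℝ) : ℂ)
          * ex (L * phase c v) :=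
      intervalIntegral.integral_congr fun v hv => by
        have := phaseRatio_mul hc (hpos v (hu ▸ hv))
        simp only [F, R]
        rw [← this]
        congr 2
        ring
    rw [e]
    refine (norm_integral_by_parts_le (hu ▸ dF) (fun s hs => ((hasDerivAt_phase c
      (hpos s (hu ▸ hs))).const_mul L)) (hu ▸ cF') ?_ ?_ ?_).trans ?_
    · rw [hu]
      exact continuousOn_const.mul ((by fun_prop : ContinuousOn (fun v : ℝ => v - 1) _).mul
        (continuousOn_const.mul (cont fun s hs =>
          analyticAt_dslope_one (fun _ => analyticAt_rpow (c - 1)) (hpos s hs))))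
    · simp only [F]; rw [bump_eq_zero (Or.inl (hσa σ h)), zero_mul]
    · simp only [F]; rw [bump_eq_zero (Or.inr (by linarith [hσb σ h])), zero_mul]
    have p1 : ∀ s ∈ Set.Icc a b, |σ * deriv bump (σ * s) * R s| ≤ S * W * ρ := fun s hs => by
      rw [abs_mul, abs_mul]
      exact mul_le_mul (mul_le_mul (habs σ h) (hW _).2.1 (abs_nonneg _) hS0) (bR s hs)
        (abs_nonneg _) (by positivity)
    have p2 : ∀ s ∈ Set.Icc a b, |σ * deriv bump (σ * s) * deriv R s| ≤ S * W * ρ := fun s hs => by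
      rw [abs_mul, abs_mul]
      exact mul_le_mul (mul_le_mul (habs σ h) (hW _).2.1 (abs_nonneg _) hS0) (bR' s hs)
        (abs_nonneg _) (by positivity)
    have hWS : W ≤ S * W := by nlinarith
    have p3 : ∀ s ∈ Set.Icc a b, |bump (σ * s) * deriv R s| ≤ S * W * ρ := fun s hs => by
      rw [abs_mul]
      exact mul_le_mul ((hW _).1.trans hWS) (bR' s hs) (abs_nonneg _) (by positivity)
    have p4 : ∀ s ∈ Set.Icc a b, |bump (σ * s) * deriv (deriv R) s| ≤ S * W * ρ := fun s hs => by
      rw [abs_mul]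
      exact mul_le_mul ((hW _).1.trans hWS) (bR'' s hs) (abs_nonneg _) (by positivity)
    have p5 : ∀ s ∈ Set.Icc a b, |σ * (σ * deriv (deriv bump) (σ * s)) * R s| ≤ S * W * ρ :=
      fun s hs => by
        rw [← mul_assoc, ← sq, abs_mul, abs_mul]
        exact mul_le_mul (mul_le_mul (habs2 σ h) (hW _).2.2 (abs_nonneg _) hS0) (bR s hs)
          (abs_nonneg _) (by positivity)
    have hSWρ : 0 ≤ S * W * ρ := by positivity
    refine hK L _ _ F'' hL dF' cF'' (fun s hs => ?_) fun s hs => ?_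
    · refine (abs_add_le _ _).trans ?_
      linarith [p1 s hs, p3 s hs]
    · refine (abs_add_le _ _).trans ((add_le_add (abs_add_le _ _) (abs_add_le _ _)).trans ?_)
      linarith [p5 s hs, p2 s hs, p4 s hs]
  set C₁ : ℝ := K * (S * W)
  set C₂ : ℝ := K * (W + b * (S * W))
  set C₃ : ℝ := K * (4 * (S * W * ρ))
  set Q : ℝ := √(σ₁ ^ c)
  have hσc : 0 < σ₁ ^ c := Real.rpow_pos_of_pos hσ₁ c
  have hQ : 0 < Q := Real.sqrt_pos.2 hσc
  have hC₁ : 0 ≤ C₁ := by positivity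
  have hC₂ : 0 ≤ C₂ := by positivity
  have hC₃ : 0 ≤ C₃ := by positivity
  have hπ := Real.pi_pos
  have root : ∀ l σ, 0 < l → σ ∈ Set.Icc σ₁ σ₂ → ∀ D, 0 ≤ D → D / √(l * σ ^ c) ≤ D / Q / √l := by
    intro l σ hl h D hD
    rw [div_div, mul_comm Q, ← Real.sqrt_mul hl.le]
    refine div_le_div_of_nonneg_left hD (Real.sqrt_pos.2 (by positivity)) (Real.sqrt_le_sqrt ?_)
    gcongr
    exact h.1
  refine ⟨(S * C₁ + (C₁ + S * C₂ + 2 * Real.pi * c * C₃)) / Q, by positivity, fun l hl => ⟨?_, ?_⟩⟩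
  · intro σ h
    have hσ0 : 0 < σ := hσ₁.trans_le h.1
    rw [amp_eq_integral ha hab hσ0 (hσa σ h) (hσb σ h)]
    have := t1 (l * σ ^ c) σ (by positivity) h
    have e : ∫ v in a..b, (σ : ℂ) * ((bump (σ * v) : ℝ) : ℂ) * ex (l * σ ^ c * phase c v) =
        σ * ∫ v in a..b, ((bump (σ * v) : ℝ) : ℂ) * ex (l * σ ^ c * phase c v) := by
      rw [← intervalIntegral.integral_const_mul]; simp only [mul_assoc]
    rw [e, norm_mul, Complex.norm_real]
    calc _ ≤ S * (C₁ / √(l * σ ^ c)) := mul_le_mul (habs σ h) this (norm_nonneg _) hS0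
      _ = S * C₁ / √(l * σ ^ c) := by ring
      _ ≤ S * C₁ / Q / √l := root l σ hl h _ (by positivity)
      _ ≤ _ := by
        gcongr
        exact le_add_of_nonneg_right (by positivity)
  · intro σ h σ' h'
    have hσ0 : 0 < σ := hσ₁.trans_le h.1
    have hσ0' : 0 < σ' := hσ₁.trans_le h'.1
    rw [amp_eq_integral ha hab hσ0 (hσa σ h) (hσb σ h),
      amp_eq_integral ha hab hσ0' (hσa σ' h') (hσb σ' h')]
    set k' : ℝ → ℝ → ℂ := fun σ v =>
      (((bump (σ * v) : ℝ) : ℂ) * ex (l * σ ^ c * phase c v) +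
        σ * (((v * deriv bump (σ * v) : ℝ) : ℂ) * ex (l * σ ^ c * phase c v))) +
      2 * Real.pi * Complex.I * c *
        (((bump (σ * v) * (l * σ ^ c * phase c v) : ℝ) : ℂ) * ex (l * σ ^ c * phase c v)) with hk'
    have cph : ContinuousOn (phase c) (Set.Icc a b) := cont fun s hs => analyticAt_phase c (hpos s hs)
    refine norm_integral_sub_le_of_deriv (k := fun σ v => (σ : ℂ) * ((bump (σ * v) : ℝ) : ℂ) *
      ex (l * σ ^ c * phase c v)) (k' := k') hab hσ0 hσ0' ?_ ?_ ?_ ?_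
    · intro x hx t ht
      have d1 : HasDerivAt (fun x : ℝ => bump (x * t)) (t * deriv bump (x * t)) x := by
        have := (hasDerivAt_bump (x * t)).comp x ((hasDerivAt_id x).mul_const t)
        exact this.congr_deriv (by ring)
      have d2 : HasDerivAt (fun x : ℝ => l * x ^ c * phase c t)
          (l * (c * x ^ (c - 1)) * phase c t) x :=
        ((Real.hasDerivAt_rpow_const (Or.inl hx.ne')).const_mul l).mul_const _
      have d3 := (hasDerivAt_ex (l * x ^ c * phase c t)).scomp x d2
      have d4 := ((hasDerivAt_id x).ofReal_comp.mul d1.ofReal_comp).mul d3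
      refine d4.congr_deriv ?_
      have hxc : x ^ c = x ^ (c - 1) * x := by rw [← Real.rpow_add_one hx.ne']; congr 1; ring
      simp only [hk', Complex.real_smul, Function.comp, id, Pi.mul_apply]
      push_cast [hxc]
      ring
    · intro x hx
      refine ContinuousOn.mul (Continuous.continuousOn (by fun_prop)) ?_
      exact continuous_ex.comp_continuousOn (continuousOn_const.mul cph)
    · have crp : ContinuousOn (fun p : ℝ × ℝ => p.1 ^ c) (Set.Ioi 0 ×ˢ Set.Icc a b) :=
        continuousOn_fst.rpow_const fun p hp => Or.inl (ne_of_gt hp.1)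
      have cphp : ContinuousOn (fun p : ℝ × ℝ => l * p.1 ^ c * phase c p.2)
          (Set.Ioi 0 ×ˢ Set.Icc a b) :=
        (continuousOn_const.mul crp).mul (cph.comp continuousOn_snd fun p hp => hp.2)
      have cex := continuous_ex.comp_continuousOn cphp
      have cb : ContinuousOn (fun p : ℝ × ℝ => bump (p.1 * p.2)) (Set.Ioi 0 ×ˢ Set.Icc a b) :=
        Continuous.continuousOn (by fun_prop)
      have cb' : ContinuousOn (fun p : ℝ × ℝ => ((p.2 * deriv bump (p.1 * p.2) : ℝ) : ℂ))
          (Set.Ioi 0 ×ˢ Set.Icc a b) := Continuous.continuousOn (by fun_prop)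
      have cs : ContinuousOn (fun p : ℝ × ℝ => ((p.1 : ℝ) : ℂ)) (Set.Ioi 0 ×ˢ Set.Icc a b) :=
        Continuous.continuousOn (by fun_prop)
      exact (((Complex.continuous_ofReal.comp_continuousOn cb).mul cex).add
        (cs.mul (cb'.mul cex))).add (continuousOn_const.mul
          ((Complex.continuous_ofReal.comp_continuousOn (cb.mul cphp)).mul cex))
    · intro z hz
      have hz' : z ∈ Set.Icc σ₁ σ₂ := Set.uIcc_subset_Icc h h' hz
      have hz0 : 0 < z := hσ₁.trans_le hz'.1
      have hL : 0 < l * z ^ c := by positivity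
      have cexz : ContinuousOn (fun v => ex (l * z ^ c * phase c v)) (Set.uIcc a b) := by
        rw [Set.uIcc_of_le hab]
        exact continuous_ex.comp_continuousOn (continuousOn_const.mul cph)
      have cphz : ContinuousOn (phase c) (Set.uIcc a b) := by rwa [Set.uIcc_of_le hab]
      have i1 : IntervalIntegrable (fun v => ((bump (z * v) : ℝ) : ℂ) * ex (l * z ^ c * phase c v))
          volume a b := (ContinuousOn.mul (Continuous.continuousOn (by fun_prop))
            cexz).intervalIntegrable
      have i2 : IntervalIntegrable (fun v => (z : ℂ) * (((v * deriv bump (z * v) : ℝ) : ℂ) *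
          ex (l * z ^ c * phase c v))) volume a b :=
        (continuousOn_const.mul (ContinuousOn.mul (Continuous.continuousOn (by fun_prop))
            cexz)).intervalIntegrable
      have i3 : IntervalIntegrable (fun v => 2 * Real.pi * Complex.I * c *
          (((bump (z * v) * (l * z ^ c * phase c v) : ℝ) : ℂ) * ex (l * z ^ c * phase c v)))
          volume a b :=
        (continuousOn_const.mul ((Complex.continuous_ofReal.comp_continuousOn
          (ContinuousOn.mul (Continuous.continuousOn (by fun_prop))
            (continuousOn_const.mul cphz))).mul cexz)).intervalIntegrable
      simp only [hk']
      rw [intervalIntegral.integral_add (i1.add i2) i3, intervalIntegral.integral_add i1 i2,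
        intervalIntegral.integral_const_mul, intervalIntegral.integral_const_mul]
      have n2 : ‖(z : ℂ)‖ ≤ S := by rw [Complex.norm_real]; exact habs z hz'
      have n3 : ‖2 * Real.pi * Complex.I * (c : ℂ)‖ = 2 * Real.pi * c := by
        rw [norm_two_pi_I_mul, Complex.norm_real, Real.norm_eq_abs, abs_of_pos (by linarith)]
      calc _ ≤ C₁ / √(l * z ^ c) + S * (C₂ / √(l * z ^ c)) +
            2 * Real.pi * c * (C₃ / √(l * z ^ c)) := by
            refine (norm_add_le _ _).trans (add_le_add ((norm_add_le _ _).trans (add_le_add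
              (t1 _ z hL hz') ?_)) ?_)
            · rw [norm_mul]; exact mul_le_mul n2 (t2 _ z hL hz') (norm_nonneg _) hS0
            · rw [norm_mul, n3]
              exact mul_le_mul_of_nonneg_left (t3 _ z hL hz') (by positivity)
        _ = (C₁ + S * C₂ + 2 * Real.pi * c * C₃) / √(l * z ^ c) := by ring
        _ ≤ (C₁ + S * C₂ + 2 * Real.pi * c * C₃) / Q / √l := root l z hl hz' _ (by positivity)
        _ ≤ _ := by
          have : 0 ≤ S * C₁ := by positivity
          exact div_le_div_of_nonneg_right (div_le_div_of_nonneg_right (by linarith) hQ.le)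
            (Real.sqrt_nonneg _)

/-- The smoothed exponential sum over `n ≍ X` with normalised frequencies `(n / X) ^ c`. -/
noncomputable def smoothSum (c X l : ℝ) : ℂ :=
  expSum (range (⌊4 * X⌋₊ + 1)) (fun n => bump (n / X)) (fun n => ((n : ℝ) / X) ^ c) l

section Poisson

variable (c X l : ℝ)

/-- The summand of `smoothSum` as a function on the real line. -/
noncomputable def profile (t : ℝ) : ℂ := ((bump (t / X) : ℝ) : ℂ) * ex (l * (t / X) ^ c)

variable {X}

lemma profile_eq_zero (hX : 0 < X) {t : ℝ} (h : t ≤ X / 2 ∨ 4 * X ≤ t) : profile c X l t = 0 := by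
  have : bump (t / X) = 0 := by
    refine bump_eq_zero ?_
    rw [div_le_iff₀ hX, le_div_iff₀ hX]
    rcases h with h | h
    · left; linarith
    · right; linarith
  rw [profile, this]
  simp

lemma contDiff_profile (hX : 0 < X) {n : ℕ∞} : ContDiff ℝ n (profile c X l) := by
  rw [contDiff_iff_contDiffAt]
  intro t
  rcases lt_or_ge t (X / 2) with h | h
  · refine (contDiffAt_const (c := (0 : ℂ))).congr_of_eventuallyEq ?_
    filter_upwards [Iio_mem_nhds h] with u hu
    exact profile_eq_zero c l hX (Or.inl (le_of_lt hu))
  · have ht : 0 < t / X := by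
      apply div_pos _ hX
      linarith
    have h1 : ContDiffAt ℝ n (fun t : ℝ => t / X) t := contDiffAt_id.div_const X
    have h2 : ContDiffAt ℝ n (fun t : ℝ => l * (t / X) ^ c) t :=
      contDiffAt_const.mul (h1.rpow_const_of_ne ht.ne')
    exact (Complex.ofRealCLM.contDiff.contDiffAt.comp t
      (contDiff_bump.contDiffAt.comp t h1)).mul (contDiff_ex.contDiffAt.comp t h2)

lemma hasCompactSupport_profile (hX : 0 < X) : HasCompactSupport (profile c X l) := by
  refine HasCompactSupport.intro (isCompact_Icc (a := X / 2) (b := 4 * X)) fun t ht => ?_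
  refine profile_eq_zero c l hX ?_
  rw [Set.mem_Icc, not_and_or, not_le, not_le] at ht
  exact ht.imp le_of_lt le_of_lt

open FourierTransform in
lemma fourier_profile (hX : 0 < X) (m : ℝ) :
    𝓕 (profile c X l) m = X * oscInt c l (m * X) := by
  rw [Real.fourier_eq', oscInt, intervalIntegral_bump_mul _ le_rfl le_rfl]
  have h := Measure.integral_comp_div
    (fun s : ℝ => ((bump s : ℝ) : ℂ) * ex (l * s ^ c - m * X * s)) X
  rw [abs_of_pos hX, Complex.real_smul] at h
  rw [← h]
  refine integral_congr_ae (ae_of_all _ fun t => ?_)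
  have e : l * (t / X) ^ c - m * X * (t / X) = -(m * t) + l * (t / X) ^ c := by
    field_simp
    ring
  simp only [profile, smul_eq_mul, e, ex_add]
  have e2 : Complex.exp (((-2 * Real.pi * inner ℝ t m : ℝ) : ℂ) * Complex.I) = ex (-(m * t)) := by
    rw [ex_eq]; congr 3
    simp
  rw [e2]
  ring

lemma smoothSum_eq_tsum (hX : 0 < X) :
    smoothSum c X l = ∑' m : ℤ, (X : ℂ) * oscInt c l (m * X) := by
  have h := SchwartzMap.tsum_eq_tsum_fourier
    ((hasCompactSupport_profile c l hX).toSchwartzMap (contDiff_profile c l hX)) 0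
  have h2 : ∑' m : ℤ, (X : ℂ) * oscInt c l (m * X) = ∑' n : ℤ, profile c X l n := by
    convert h.symm using 3 with m m
    · rw [← fourier_profile c l hX]
      simp [SchwartzMap.fourier_coe]
      rfl
    · simp
  rw [h2, tsum_eq_sum (s := (range (⌊4 * X⌋₊ + 1)).map Nat.castEmbedding)]
  · rw [sum_map, smoothSum, expSum]
    refine sum_congr rfl fun n _ => ?_
    simp [profile, mul_comm l]
  · intro n hn
    apply profile_eq_zero c l hX
    by_contra hcon
    push Not at hcon
    apply hn
    have hn0 : (0 : ℝ) < n := lt_trans (by positivity) hcon.1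
    have hn1 : 0 < n := by exact_mod_cast hn0
    lift n to ℕ using hn1.le
    rw [mem_map]
    refine ⟨n, mem_range.2 (Nat.lt_succ_of_le (Nat.le_floor ?_)), rfl⟩
    have := hcon.2.le
    exact_mod_cast this

end Poisson

/-- The dual sum can be truncated to the frequencies with a stationary point. -/
lemma exists_norm_smoothSum_sub_le {c : ℝ} (hc : 1 < c) :
    ∃ C β₀ β₁ : ℝ, 0 ≤ C ∧ 0 < β₀ ∧ 0 < β₁ ∧ ∀ X l : ℝ, 0 < X → 0 ≤ l → ∀ T : Finset ℤ, 0 ∉ T →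
      (∀ m : ℤ, m ∉ T → m ≠ 0 → m * X ≤ β₀ * l ∨ β₁ * l ≤ m * X) →
      ‖smoothSum c X l - ∑ m ∈ T, (X : ℂ) * oscInt c l (m * X)‖ ≤
        C * (X / (1 + l) ^ 2 + 1 / X) := by
  set b₁ : ℝ := c * (1 / 2) ^ (c - 1) with hb₁
  set b₂ : ℝ := c * 4 ^ (c - 1) with hb₂
  have hb₁0 : 0 < b₁ := by positivity
  have hb₂0 : 0 < b₂ := by positivity
  set μ : ℝ := min (b₁ / (2 + b₁)) (b₂ / (1 + 2 * b₂)) with hμ_def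
  have hμ : 0 < μ := lt_min (by positivity) (by positivity)
  have hμ₁ : μ * (2 + b₁) ≤ b₁ := by
    rw [← le_div_iff₀ (by positivity)]; exact min_le_left _ _
  have hμ₂ : μ * (1 + 2 * b₂) ≤ b₂ := by
    rw [← le_div_iff₀ (by positivity)]; exact min_le_right _ _
  have hμ1 : μ ≤ 1 := by nlinarith
  obtain ⟨C, hC0, hC⟩ := exists_norm_oscInt_le c hμ
  have tail : ∀ l r : ℝ, 0 ≤ l → 0 < l + |r| → (r ≤ b₁ / 2 * l ∨ 2 * b₂ * l ≤ r) →
      ‖oscInt c l r‖ ≤ C / (l + |r|) ^ 2 := by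
    intro l r hl hΔ h
    refine hC l r hl hΔ fun s hs => ?_
    have hs0 : 0 < s := by linarith [hs.1]
    have l1 : b₁ ≤ c * s ^ (c - 1) := by
      rw [hb₁]
      exact mul_le_mul_of_nonneg_left (Real.rpow_le_rpow (by norm_num) hs.1 (by linarith))
        (by linarith)
    have l2 : c * s ^ (c - 1) ≤ b₂ := by
      rw [hb₂]
      exact mul_le_mul_of_nonneg_left (Real.rpow_le_rpow hs0.le hs.2 (by linarith)) (by linarith)
    have l1' : b₁ * l ≤ c * l * s ^ (c - 1) := by nlinarith
    have l2' : c * l * s ^ (c - 1) ≤ b₂ * l := by nlinarith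
    rcases h with h | h
    · refine le_trans ?_ (le_abs_self _)
      rcases le_total 0 r with hr | hr
      · rw [abs_of_nonneg hr]; nlinarith
      · rw [abs_of_nonpos hr]
        have hμb : μ ≤ b₁ := by nlinarith
        nlinarith [mul_le_mul_of_nonneg_right hμb hl, mul_nonneg (sub_nonneg.2 hμ1) (neg_nonneg.2 hr)]
    · refine le_trans ?_ (neg_le_abs _)
      have hr : 0 ≤ r := le_trans (by positivity) h
      rw [abs_of_nonneg hr]; nlinarith
  have sum2 : Summable fun m : ℤ => 1 / (m : ℝ) ^ 2 := Real.summable_one_div_int_pow.2 one_lt_two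
  set Z : ℝ := ∑' m : ℤ, 1 / (m : ℝ) ^ 2 with hZ
  have hZ0 : 0 ≤ Z := tsum_nonneg fun m => by positivity
  refine ⟨16 + 4 * C + C * Z, b₁ / 2, 2 * b₂, by positivity, by positivity, by positivity,
    fun X l hX hl T hT0 hT => ?_⟩
  set g : ℤ → ℂ := fun m => (X : ℂ) * oscInt c l (m * X) with hg
  set k : ℤ → ℂ := fun m => if m ∈ T then g m else 0 with hk
  have hksum : HasSum k (∑ m ∈ T, g m) := by
    have : HasSum k (∑ m ∈ T, k m) :=
      hasSum_sum_of_ne_finset_zero fun m hm => by simp [hk, hm]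
    rwa [sum_congr rfl fun m hm => (by simp [hk, hm] : k m = g m)] at this
  set D : ℝ := X * ((16 + 4 * C) / (1 + l) ^ 2) with hD
  have hzero : ‖oscInt c l 0‖ ≤ (16 + 4 * C) / (1 + l) ^ 2 := by
    rw [le_div_iff₀ (by positivity)]
    rcases le_total l 1 with h1 | h1
    · have := norm_oscInt_le c l 0
      have h4 : (1 + l) ^ 2 ≤ 4 := by nlinarith
      calc _ ≤ 4 * 4 := mul_le_mul this h4 (by positivity) (by norm_num)
        _ ≤ _ := by linarith
    · have := tail l 0 hl (by simp; linarith) (Or.inl (by positivity))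
      rw [abs_zero, add_zero, le_div_iff₀ (by positivity)] at this
      have h4 : (1 + l) ^ 2 ≤ 4 * l ^ 2 := by nlinarith
      nlinarith [norm_nonneg (oscInt c l 0)]
  have hbd : ∀ m : ℤ, ‖(g - k) m‖ ≤ C / X * (1 / (m : ℝ) ^ 2) + if m = 0 then D else 0 := by
    intro m
    have hD0 : 0 ≤ D := by positivity
    rcases eq_or_ne m 0 with rfl | hm
    · have : (g - k) 0 = X * oscInt c l 0 := by simp [hk, hg, hT0]
      rw [this, norm_mul, Complex.norm_real, Real.norm_eq_abs, abs_of_pos hX]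
      simp only [Int.cast_zero]
      simpa [hD] using mul_le_mul_of_nonneg_left hzero hX.le
    · rw [if_neg hm, add_zero]
      by_cases hmT : m ∈ T
      · have : (g - k) m = 0 := by simp [hk, hmT]
        rw [this, norm_zero]; positivity
      · have : (g - k) m = X * oscInt c l (m * X) := by simp [hk, hg, hmT]
        rw [this, norm_mul, Complex.norm_real, Real.norm_eq_abs, abs_of_pos hX]
        have hm' : 0 < |(m : ℝ)| := abs_pos.2 (by exact_mod_cast hm)
        have habs : |(m : ℝ) * X| = |(m : ℝ)| * X := by rw [abs_mul, abs_of_pos hX]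
        have h1 := tail l (m * X) hl (by rw [habs]; positivity) (hT m hmT hm)
        have h2 : C / (l + |(m : ℝ) * X|) ^ 2 ≤ C / (|(m : ℝ)| * X) ^ 2 := by
          rw [habs]
          gcongr
          linarith
        calc _ ≤ X * (C / (|(m : ℝ)| * X) ^ 2) := by gcongr; exact h1.trans h2
          _ = _ := by rw [mul_pow, sq_abs]; field_simp
  have hfin : HasSum (fun m : ℤ => if m = 0 then D else 0) D := hasSum_ite_eq 0 D
  have hB : HasSum (fun m : ℤ => C / X * (1 / (m : ℝ) ^ 2) + if m = 0 then D else 0)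
      (C / X * Z + D) := (sum2.hasSum.mul_left _).add hfin
  have hr : Summable (g - k) := Summable.of_norm_bounded hB.summable hbd
  have hgs : HasSum g ((∑' m, (g - k) m) + ∑ m ∈ T, g m) := by
    have := hr.hasSum.add hksum
    simpa using this
  rw [smoothSum_eq_tsum c l hX, hgs.tsum_eq, add_sub_cancel_right]
  refine (tsum_of_norm_bounded hB hbd).trans ?_
  rw [hD]
  have e1 : C / X * Z = C * Z * (1 / X) := by ring
  have e2 : X * ((16 + 4 * C) / (1 + l) ^ 2) = (16 + 4 * C) * (X / (1 + l) ^ 2) := by ring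
  rw [e1, e2]
  have p1 : 0 ≤ X / (1 + l) ^ 2 := by positivity
  have p2 : 0 ≤ 1 / X := by positivity
  have p3 : 0 ≤ C * Z := by positivity
  nlinarith

lemma sum_Ioc_mul_add_eq (a e : ℕ → ℂ) {p q : ℕ} (hpq : p ≤ q) :
    ∑ m ∈ Ioc p q, a m * e m + ∑ n ∈ Ioc p q, (a (n + 1) - a n) * ∑ m ∈ Ioc p n, e m =
      a (q + 1) * ∑ m ∈ Ioc p q, e m := by
  induction q, hpq using Nat.le_induction with
  | base => simp
  | succ q hq ih =>
    have h : ∀ f : ℕ → ℂ, ∑ m ∈ Ioc p (q + 1), f m = ∑ m ∈ Ioc p q, f m + f (q + 1) := fun f =>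
      sum_Ioc_succ_top hq f
    rw [h, h, h e]
    linear_combination ih

/-- Abel summation against a slowly varying amplitude. -/
lemma norm_sum_Ioc_mul_le {a e : ℕ → ℂ} {p q : ℕ} {A B : ℝ} (hpq : p ≤ q)
    (hA : ‖a (q + 1)‖ ≤ A) (hB : ∀ n ∈ Ioc p q, ‖a (n + 1) - a n‖ ≤ B) :
    ‖∑ m ∈ Ioc p q, a m * e m‖ ≤
      A * ‖∑ m ∈ Ioc p q, e m‖ + B * ∑ n ∈ Ioc p q, ‖∑ m ∈ Ioc p n, e m‖ := by
  rw [eq_sub_of_add_eq (sum_Ioc_mul_add_eq a e hpq)]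
  refine (norm_sub_le _ _).trans (add_le_add ?_ ?_)
  · rw [norm_mul]
    gcongr
  · rw [mul_sum]
    refine (norm_sum_le _ _).trans (sum_le_sum fun n hn => ?_)
    rw [norm_mul]
    exact mul_le_mul_of_nonneg_right (hB n hn) (norm_nonneg _)

/-- The dual frequency in the stationary phase expansion. -/
noncomputable def dualFreq (c X l : ℝ) : ℝ := (c - 1) * l * (X / (c * l)) ^ (c / (c - 1))

lemma oscInt_eq_amp_mul {c X l : ℝ} (hc : 1 < c) (hX : 0 < X) (hl : 0 < l) {m : ℕ} (hm : 0 < m) :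
    oscInt c l (m * X) = amp c l ((m * X / (c * l)) ^ (1 / (c - 1))) *
      ex ((m : ℝ) ^ (c / (c - 1)) * -dualFreq c X l) := by
  have hc1 : c - 1 ≠ 0 := by linarith
  have hc0 : 0 < c := by linarith
  have hm0 : (0 : ℝ) < m := by exact_mod_cast hm
  have hu : 0 < m * X / (c * l) := by positivity
  have e1 : c * l * ((m * X / (c * l)) ^ (1 / (c - 1))) ^ (c - 1) = m * X := by
    rw [← Real.rpow_mul hu.le, one_div_mul_cancel hc1, Real.rpow_one]
    field_simp
  have e2 : ((m * X / (c * l)) ^ (1 / (c - 1))) ^ c =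
      (m : ℝ) ^ (c / (c - 1)) * (X / (c * l)) ^ (c / (c - 1)) := by
    rw [← Real.rpow_mul hu.le, ← Real.mul_rpow hm0.le (by positivity), mul_div_assoc]
    congr 1
    field_simp
  rw [amp, e1, e2, mul_right_comm, ← ex_add, dualFreq]
  have : (c - 1) * (l * ((m : ℝ) ^ (c / (c - 1)) * (X / (c * l)) ^ (c / (c - 1)))) +
      (m : ℝ) ^ (c / (c - 1)) * -((c - 1) * l * (X / (c * l)) ^ (c / (c - 1))) = 0 := by ring
  rw [this, ex_zero, one_mul]

/-- The partial sums of the dual exponential sum. -/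
noncomputable def dualSum (c : ℝ) (p q : ℕ) (z : ℝ) : ℂ :=
  expSum (Ioc p q) (fun _ => 1) (fun m => (m : ℝ) ^ (c / (c - 1))) z

lemma exists_rpow_sub_le (κ : ℝ) {u₁ u₂ : ℝ} (hu₁ : 0 < u₁) :
    ∃ C : ℝ, 0 ≤ C ∧ ∀ u ∈ Set.Icc u₁ u₂, ∀ v ∈ Set.Icc u₁ u₂, |v ^ κ - u ^ κ| ≤ C * |v - u| := by
  have hcont : ContinuousOn (fun u : ℝ => κ * u ^ (κ - 1)) (Set.Icc u₁ u₂) :=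
    continuousOn_const.mul fun s hs =>
      (Real.continuousAt_rpow_const s _ (Or.inl (hu₁.trans_le hs.1).ne')).continuousWithinAt
  obtain ⟨C, hC⟩ := isCompact_Icc.exists_bound_of_continuousOn hcont
  refine ⟨max C 0, le_max_right _ _, fun u hu v hv => ?_⟩
  exact (convex_Icc u₁ u₂).norm_image_sub_le_of_norm_hasDerivWithin_le
    (fun s hs => (Real.hasDerivAt_rpow_const
      (Or.inl (hu₁.trans_le hs.1).ne')).hasDerivWithinAt)
    (fun s hs => (hC s hs).trans (le_max_left _ _)) hu hv

/-- A dyadic block of the dual sum, after partial summation. -/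
lemma exists_norm_sum_oscInt_le {c u₁ u₂ : ℝ} (hc : 1 < c) (hu₁ : 0 < u₁) (hu : u₁ ≤ u₂) :
    ∃ C : ℝ, 0 ≤ C ∧ ∀ X l N : ℝ, 0 < X → 0 < l → 0 < N → u₁ * l ≤ N * X → (2 * N + 1) * X ≤ u₂ * l →
      ‖∑ m ∈ Ioc ⌊N⌋₊ ⌊2 * N⌋₊, (X : ℂ) * oscInt c l (m * X)‖ ^ 4 ≤
        C * (X ^ 4 / l ^ 2) * (‖dualSum c ⌊N⌋₊ ⌊2 * N⌋₊ (dualFreq c X l)‖ ^ 4 +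
          X / l * ∑ n ∈ Ioc ⌊N⌋₊ ⌊2 * N⌋₊, ‖dualSum c ⌊N⌋₊ n (dualFreq c X l)‖ ^ 4) := by
  have hc0 : 0 < c := by linarith
  have hκ : 0 ≤ 1 / (c - 1) := by rw [one_div]; exact inv_nonneg.2 (by linarith)
  set κ : ℝ := 1 / (c - 1)
  have hu₂ : 0 < u₂ := hu₁.trans_le hu
  have hv₁ : 0 < u₁ / c := by positivity
  obtain ⟨A, hA0, hA⟩ := exists_norm_amp_le (σ₁ := (u₁ / c) ^ κ) (σ₂ := (u₂ / c) ^ κ) hc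
    (by positivity) (Real.rpow_le_rpow hv₁.le (by gcongr) hκ)
  obtain ⟨B, hB0, hB⟩ := exists_rpow_sub_le κ (u₂ := u₂ / c) hv₁
  set D : ℝ := A + A * (B / c) with hD
  have hD0 : 0 ≤ D := by positivity
  refine ⟨D ^ 4 * (8 * (1 + u₂ ^ 3)), by positivity, fun X l N hX hl hN h1 h2 => ?_⟩
  set p := ⌊N⌋₊
  set q := ⌊2 * N⌋₊
  set z := dualFreq c X l
  have hpq : p ≤ q := Nat.floor_mono (by linarith)
  set s : ℕ → ℝ := fun m => m * X / (c * l) with hs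
  have hsI : ∀ m ∈ Ioc p (q + 1), s m ∈ Set.Icc (u₁ / c) (u₂ / c) := by
    intro m hm
    rw [mem_Ioc] at hm
    have hm1 : N ≤ m := (Nat.lt_of_floor_lt hm.1).le
    have hm2 : (m : ℝ) ≤ 2 * N + 1 := by
      have : (m : ℝ) ≤ (q + 1 : ℕ) := by exact_mod_cast hm.2
      push_cast at this
      linarith [Nat.floor_le (by positivity : 0 ≤ 2 * N)]
    constructor
    · rw [hs, div_le_div_iff₀ hc0 (by positivity)]
      nlinarith [mul_le_mul_of_nonneg_right hm1 hX.le]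
    · rw [hs, div_le_div_iff₀ (by positivity) hc0]
      nlinarith [mul_le_mul_of_nonneg_right hm2 hX.le]
  have hσI : ∀ m ∈ Ioc p (q + 1), s m ^ κ ∈ Set.Icc ((u₁ / c) ^ κ) ((u₂ / c) ^ κ) := fun m hm =>
    ⟨Real.rpow_le_rpow hv₁.le (hsI m hm).1 hκ,
      Real.rpow_le_rpow (hv₁.le.trans (hsI m hm).1) (hsI m hm).2 hκ⟩
  set a : ℕ → ℂ := fun m => amp c l (s m ^ κ)
  set e : ℕ → ℂ := fun m => ex ((m : ℝ) ^ (c / (c - 1)) * -z)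
  have hEn : ∀ n, ‖∑ m ∈ Ioc p n, e m‖ = ‖dualSum c p n z‖ := fun n => by
    rw [dualSum, ← expSum_neg, expSum]
    simp [e]
  have hsub : ∀ n, n ∈ Ioc p q → n ∈ Ioc p (q + 1) ∧ n + 1 ∈ Ioc p (q + 1) := fun n hn => by
    rw [mem_Ioc] at hn
    constructor <;> rw [mem_Ioc] <;> omega
  have key := norm_sum_Ioc_mul_le (a := a) (e := e) (A := A / √l) (B := A / √l * (B / c * (X / l)))
    hpq ((hA l hl).1 _ (hσI _ (mem_Ioc.2 ⟨by omega, le_rfl⟩))) (fun n hn => by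
      obtain ⟨hn1, hn2⟩ := hsub n hn
      refine ((hA l hl).2 _ (hσI n hn1) _ (hσI (n + 1) hn2)).trans ?_
      gcongr
      refine (hB _ (hsI n hn1) _ (hsI (n + 1) hn2)).trans_eq ?_
      have : s (n + 1) - s n = X / (c * l) := by
        simp only [hs]; push_cast; ring
      rw [this, abs_of_pos (by positivity)]
      field_simp)
  simp only [hEn] at key
  have hsum : ∑ m ∈ Ioc p q, (X : ℂ) * oscInt c l (m * X) = X * ∑ m ∈ Ioc p q, a m * e m := by
    rw [mul_sum]
    refine sum_congr rfl fun m hm => ?_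
    rw [oscInt_eq_amp_mul hc hX hl (by rw [mem_Ioc] at hm; omega)]
  set S₁ : ℝ := ‖dualSum c p q z‖
  set S₂ : ℝ := ∑ n ∈ Ioc p q, ‖dualSum c p n z‖
  set S₄ : ℝ := ∑ n ∈ Ioc p q, ‖dualSum c p n z‖ ^ 4
  have hS₁ : 0 ≤ S₁ := norm_nonneg _
  have hS₂ : 0 ≤ S₂ := sum_nonneg fun _ _ => norm_nonneg _
  have hS₄ : 0 ≤ S₄ := sum_nonneg fun _ _ => by positivity
  have hsl : 0 < √l := Real.sqrt_pos.2 hl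
  have hb : ‖∑ m ∈ Ioc p q, (X : ℂ) * oscInt c l (m * X)‖ ≤ D * (X / √l) * (S₁ + X / l * S₂) := by
    rw [hsum, norm_mul, Complex.norm_real, Real.norm_eq_abs, abs_of_pos hX]
    calc _ ≤ X * (A / √l * S₁ + A / √l * (B / c * (X / l)) * S₂) := by gcongr
      _ = X / √l * (A * S₁ + A * (B / c) * (X / l * S₂)) := by ring
      _ ≤ X / √l * (D * S₁ + D * (X / l * S₂)) := by
        have : 0 ≤ A * (B / c) := by positivity
        gcongr <;> linarith
      _ = _ := by ring
  have hpm : S₂ ^ 4 ≤ ((2 * N + 1) : ℝ) ^ 3 * S₄ := by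
    rcases (Ioc p q).eq_empty_or_nonempty with h0 | h0
    · simp only [S₂, S₄, h0]; simp
    · have := pow_sum_div_card_le_sum_pow (s := Ioc p q) (n := 3)
        (f := fun n => ‖dualSum c p n z‖) (fun _ _ => norm_nonneg _)
      rw [div_le_iff₀ (pow_pos (by exact_mod_cast h0.card_pos) 3)] at this
      refine this.trans ?_
      rw [mul_comm]
      gcongr
      rw [Nat.card_Ioc]
      have h3 : ((q - p : ℕ) : ℝ) ≤ q := by exact_mod_cast Nat.sub_le _ _
      linarith [Nat.floor_le (by positivity : 0 ≤ 2 * N)]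
  have hN3 : (X / l) ^ 4 * (2 * N + 1) ^ 3 ≤ u₂ ^ 3 * (X / l) := by
    have : X / l * (2 * N + 1) ≤ u₂ := by
      rw [div_mul_eq_mul_div, div_le_iff₀ hl]; linarith
    calc (X / l) ^ 4 * (2 * N + 1) ^ 3 = (X / l * (2 * N + 1)) ^ 3 * (X / l) := by ring
      _ ≤ _ := by gcongr
  calc _ ≤ (D * (X / √l) * (S₁ + X / l * S₂)) ^ 4 := by gcongr
    _ = D ^ 4 * (X ^ 4 / l ^ 2) * (S₁ + X / l * S₂) ^ 4 := by
      have : (√l) ^ 4 = l ^ 2 := by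
        rw [show (4 : ℕ) = 2 * 2 by rfl, pow_mul, Real.sq_sqrt hl.le]
      rw [mul_pow, mul_pow, div_pow, this]
    _ ≤ D ^ 4 * (X ^ 4 / l ^ 2) * (8 * (S₁ ^ 4 + (X / l * S₂) ^ 4)) := by
      gcongr
      have := add_pow_le hS₁ (by positivity : 0 ≤ X / l * S₂) 4
      norm_num at this ⊢
      exact this
    _ ≤ D ^ 4 * (X ^ 4 / l ^ 2) * (8 * ((1 + u₂ ^ 3) * (S₁ ^ 4 + X / l * S₄))) := by
      gcongr
      have h3 : (X / l * S₂) ^ 4 ≤ u₂ ^ 3 * (X / l) * S₄ := by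
        rw [mul_pow]
        calc _ ≤ (X / l) ^ 4 * ((2 * N + 1) ^ 3 * S₄) := by gcongr
          _ = (X / l) ^ 4 * (2 * N + 1) ^ 3 * S₄ := by ring
          _ ≤ _ := by gcongr
      have h4 : 0 ≤ u₂ ^ 3 * S₁ ^ 4 := by positivity
      have h5 : 0 ≤ X / l * S₄ := by positivity
      linarith
    _ = _ := by ring

/-- The Gaussian-smoothed number of quadruples in `(N, 2N]` for which the gap of the `d`-th powers
is `≲ 1 / T`. -/
noncomputable def smoothCount (d N T : ℝ) : ℝ :=
  ∑ q ∈ quads (Ioc ⌊N⌋₊ ⌊2 * N⌋₊),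
    Real.exp (-Real.pi * T ^ 2 * gap (fun n : ℕ => (n : ℝ) ^ d) q ^ 2)

lemma smoothCount_anti (d N : ℝ) {S T : ℝ} (hS : 0 ≤ S) (hST : S ≤ T) :
    smoothCount d N T ≤ smoothCount d N S := by
  refine sum_le_sum fun q _ => Real.exp_le_exp.2 ?_
  have : S ^ 2 ≤ T ^ 2 := by gcongr
  have := mul_le_mul_of_nonneg_right this (sq_nonneg (gap (fun n : ℕ => (n : ℝ) ^ d) q))
  nlinarith [Real.pi_pos]

lemma card_Ioc_floor_le {N : ℝ} (hN : 0 ≤ N) : ((Ioc ⌊N⌋₊ ⌊2 * N⌋₊).card : ℝ) ≤ 2 * N := by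
  rw [Nat.card_Ioc]
  have h3 : ((⌊2 * N⌋₊ - ⌊N⌋₊ : ℕ) : ℝ) ≤ ⌊2 * N⌋₊ := by exact_mod_cast Nat.sub_le _ _
  linarith [Nat.floor_le (by positivity : 0 ≤ 2 * N)]

lemma smoothCount_le (d T : ℝ) {N : ℝ} (hN : 0 ≤ N) : smoothCount d N T ≤ 16 * N ^ 4 := by
  calc smoothCount d N T ≤ ∑ _q ∈ quads (Ioc ⌊N⌋₊ ⌊2 * N⌋₊), (1 : ℝ) := by
        refine sum_le_sum fun q _ => Real.exp_le_one_iff.2 ?_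
        have : 0 ≤ Real.pi * T ^ 2 * gap (fun n : ℕ => (n : ℝ) ^ d) q ^ 2 := by positivity
        linarith
    _ = ((Ioc ⌊N⌋₊ ⌊2 * N⌋₊).card : ℝ) ^ 4 := by
        rw [sum_const, nsmul_one, card_product, card_product]
        push_cast
        ring
    _ ≤ (2 * N) ^ 4 := by
        gcongr
        exact card_Ioc_floor_le hN
    _ = _ := by ring

lemma smoothCount_nonneg (d N T : ℝ) : 0 ≤ smoothCount d N T :=
  sum_nonneg fun _ _ => (Real.exp_pos _).le

/-- A Gaussian majorant turns a fourth moment over a bounded interval into a smoothed count. -/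
lemma setIntegral_expSum_le {T : ℝ} (hT : 0 < T) (J : Finset ℕ) (a f : ℕ → ℝ) {s : Set ℝ}
    (hs : MeasurableSet s) (hsT : ∀ x ∈ s, |x| ≤ T) :
    ∫ x in s, ‖expSum J a f x‖ ^ 4 ≤
      Real.exp Real.pi * (T * ∑ q ∈ quads J, a q.1.1 * a q.1.2 * (a q.2.1 * a q.2.2) *
        Real.exp (-Real.pi * T ^ 2 * gap f q ^ 2)) := by
  rw [← integral_gaussian_expSum hT, ← integral_const_mul]
  have hint := (integrable_gaussian_expSum hT J a f).const_mul (Real.exp Real.pi)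
  refine le_trans ?_ (setIntegral_le_integral (s := s) hint
    (Filter.Eventually.of_forall fun x => by positivity))
  refine integral_mono_of_nonneg (Filter.Eventually.of_forall fun x => by positivity)
    hint.integrableOn ?_
  refine (ae_restrict_mem hs).mono fun x hx => ?_
  have h1 : (1 : ℝ) ≤ Real.exp Real.pi * Real.exp (-(Real.pi / T ^ 2) * x ^ 2) := by
    rw [← Real.exp_add, Real.one_le_exp_iff]
    have : x ^ 2 ≤ T ^ 2 := sq_le_sq' (by linarith [abs_le.1 (hsT x hx)]) (abs_le.1 (hsT x hx)).2
    have h2 : Real.pi / T ^ 2 * x ^ 2 ≤ Real.pi := by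
      rw [div_mul_eq_mul_div, div_le_iff₀ (by positivity)]
      gcongr
    linarith
  have := mul_le_mul_of_nonneg_right h1 (by positivity : 0 ≤ ‖expSum J a f x‖ ^ 4)
  simpa [mul_assoc] using this

lemma dualFreq_pos {c X l : ℝ} (hc : 1 < c) (hX : 0 < X) (hl : 0 < l) : 0 < dualFreq c X l := by
  have : 0 < c - 1 := by linarith
  have : 0 < c := by linarith
  unfold dualFreq
  positivity

lemma dualFreq_eq {c X l : ℝ} (hc : 1 < c) (hX : 0 < X) (hl : 0 < l) :
    dualFreq c X l = (c - 1) * (X / c) ^ (c / (c - 1)) * l ^ (-(1 / (c - 1))) := by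
  have hc1 : c - 1 ≠ 0 := by linarith
  have hc0 : 0 < c := by linarith
  rw [dualFreq, show X / (c * l) = X / c / l by rw [div_div], Real.div_rpow (by positivity) hl.le,
    show -(1 / (c - 1)) = 1 - c / (c - 1) by field_simp; ring, Real.rpow_sub hl, Real.rpow_one]
  ring

lemma hasDerivAt_dualFreq {c X l : ℝ} (hc : 1 < c) (hX : 0 < X) (hl : 0 < l) :
    HasDerivAt (dualFreq c X) (-(1 / (c - 1)) * (dualFreq c X l / l)) l := by
  have h := (Real.hasDerivAt_rpow_const (x := l) (p := -(1 / (c - 1))) (Or.inl hl.ne')).const_mul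
    ((c - 1) * (X / c) ^ (c / (c - 1)))
  refine (h.congr_of_eventuallyEq ?_).congr_deriv ?_
  · filter_upwards [lt_mem_nhds hl] with x hx using dualFreq_eq hc hX hx
  · rw [dualFreq_eq hc hX hl, Real.rpow_sub_one hl.ne']
    ring

lemma dualFreq_anti {c X l l' : ℝ} (hc : 1 < c) (hX : 0 < X) (hl : 0 < l) (hll : l ≤ l') :
    dualFreq c X l' ≤ dualFreq c X l := by
  have : 0 < c - 1 := by linarith
  have : 0 < c := by linarith
  rw [dualFreq_eq hc hX hl, dualFreq_eq hc hX (hl.trans_le hll)]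
  refine mul_le_mul_of_nonneg_left ?_ (by positivity)
  exact Real.rpow_le_rpow_of_nonpos hl hll (by rw [neg_nonpos]; positivity)

lemma dualFreq_two_mul {c X l : ℝ} (hc : 1 < c) (hX : 0 < X) (hl : 0 < l) :
    dualFreq c X (2 * l) = 2 ^ (-(1 / (c - 1))) * dualFreq c X l := by
  rw [dualFreq_eq hc hX hl, dualFreq_eq hc hX (by positivity : 0 < 2 * l),
    Real.mul_rpow (by norm_num) hl.le]
  ring

lemma continuousOn_comp_dualFreq {c X L : ℝ} (hc : 1 < c) (hX : 0 < X) (hL : 0 < L) {h : ℝ → ℝ}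
    (hh : Continuous h) : ContinuousOn (fun l => h (dualFreq c X l)) (Set.Icc L (2 * L)) :=
  hh.comp_continuousOn fun _ hl =>
    (hasDerivAt_dualFreq hc hX (hL.trans_le hl.1)).continuousAt.continuousWithinAt

/-- Change of variables to the dual frequency on a dyadic interval. -/
lemma exists_integral_comp_dualFreq_le {c : ℝ} (hc : 1 < c) :
    ∃ C : ℝ, 0 < C ∧ ∀ X L : ℝ, 0 < X → 0 < L → ∀ h : ℝ → ℝ, Continuous h → (∀ z, 0 ≤ h z) →
      ∫ l in Set.Icc L (2 * L), h (dualFreq c X l) ≤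
        C * (L / dualFreq c X L) * ∫ z in Set.Icc 0 (dualFreq c X L), h z := by
  have hc1 : 0 < c - 1 := by linarith
  set e : ℝ := 1 / (c - 1) with he
  have he0 : 0 < e := by positivity
  refine ⟨2 * 2 ^ e / e, by positivity, fun X L hX hL h hh h0 => ?_⟩
  set Z := dualFreq c X L with hZ
  have hZ0 : 0 < Z := dualFreq_pos hc hX hL
  have hL2 : L ≤ 2 * L := by linarith
  set g : ℝ → ℝ := fun l => -e * (dualFreq c X l / l) with hg
  have hpos : ∀ l ∈ Set.Icc L (2 * L), 0 < l := fun l hl => hL.trans_le hl.1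
  have hdcont : ContinuousOn (dualFreq c X) (Set.Icc L (2 * L)) := fun l hl =>
    (hasDerivAt_dualFreq hc hX (hpos l hl)).continuousAt.continuousWithinAt
  have hgcont : ContinuousOn g (Set.Icc L (2 * L)) :=
    continuousOn_const.mul (hdcont.div continuousOn_id fun l hl => (hpos l hl).ne')
  have hcv : ∫ l in L..(2 * L), h (dualFreq c X l) * g l =
      ∫ z in Z..(dualFreq c X (2 * L)), h z := by
    refine intervalIntegral.integral_comp_mul_deriv ?_ ?_ hh
    · intro l hl
      rw [Set.uIcc_of_le hL2] at hl
      exact hasDerivAt_dualFreq hc hX (hpos l hl)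
    · rwa [Set.uIcc_of_le hL2]
  have hZ2 : dualFreq c X (2 * L) = 2 ^ (-e) * Z := dualFreq_two_mul hc hX hL
  have hZ2Z : dualFreq c X (2 * L) ≤ Z := dualFreq_anti hc hX hL hL2
  have hZ20 : 0 < dualFreq c X (2 * L) := dualFreq_pos hc hX (by positivity)
  have hlow : ∀ l ∈ Set.Icc L (2 * L), 1 ≤ 2 * 2 ^ e / e * (L / Z) * -g l := by
    intro l hl
    have hl0 := hpos l hl
    have h1 : dualFreq c X (2 * L) ≤ dualFreq c X l := dualFreq_anti hc hX hl0 hl.2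
    rw [hZ2] at h1
    have h2 : 2 ^ (-e) * Z / (2 * L) ≤ dualFreq c X l / l := by
      exact div_le_div₀ (dualFreq_pos hc hX hl0).le h1 hl0 hl.2
    calc (1 : ℝ) = 2 * 2 ^ e / e * (L / Z) * (e * (2 ^ (-e) * Z / (2 * L))) := by
          rw [Real.rpow_neg (by norm_num)]
          field_simp
      _ ≤ 2 * 2 ^ e / e * (L / Z) * (e * (dualFreq c X l / l)) := by gcongr
      _ = _ := by rw [hg]; ring
  have hint1 : IntegrableOn (fun l => h (dualFreq c X l)) (Set.Icc L (2 * L)) :=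
    (continuousOn_comp_dualFreq hc hX hL hh).integrableOn_Icc
  have hint2 : IntegrableOn (fun l => h (dualFreq c X l) * g l) (Set.Icc L (2 * L)) :=
    ((continuousOn_comp_dualFreq hc hX hL hh).mul hgcont).integrableOn_Icc
  calc _ ≤ ∫ l in Set.Icc L (2 * L), -(2 * 2 ^ e / e * (L / Z)) * (h (dualFreq c X l) * g l) := by
        refine setIntegral_mono_on hint1 (hint2.const_mul _) measurableSet_Icc fun l hl => ?_
        have := mul_le_mul_of_nonneg_left (hlow l hl) (h0 (dualFreq c X l))
        linarith
    _ = 2 * 2 ^ e / e * (L / Z) * ∫ z in (dualFreq c X (2 * L))..Z, h z := by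
        rw [integral_const_mul, integral_Icc_eq_integral_Ioc,
          ← intervalIntegral.integral_of_le hL2, hcv, intervalIntegral.integral_symm]
        ring
    _ ≤ _ := by
        rw [intervalIntegral.integral_of_le hZ2Z]
        refine mul_le_mul_of_nonneg_left ?_ (by positivity)
        refine setIntegral_mono_set (hh.continuousOn.integrableOn_Icc)
          (Filter.Eventually.of_forall fun z => h0 z) (LE.le.eventuallyLE ?_)
        exact fun z hz => ⟨hZ20.le.trans hz.1.le, hz.2⟩

lemma exists_integral_dualSum_le {c : ℝ} (hc : 1 < c) :
    ∃ C : ℝ, 0 < C ∧ ∀ X L N : ℝ, 0 < X → 0 < L → ∀ n ≤ ⌊2 * N⌋₊,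
      ∫ l in Set.Icc L (2 * L), ‖dualSum c ⌊N⌋₊ n (dualFreq c X l)‖ ^ 4 ≤
        C * L * smoothCount (c / (c - 1)) N (dualFreq c X L) := by
  obtain ⟨C, hC, h⟩ := exists_integral_comp_dualFreq_le hc
  refine ⟨C * Real.exp Real.pi, by positivity, fun X L N hX hL n hn => ?_⟩
  have hZ : 0 < dualFreq c X L := dualFreq_pos hc hX hL
  refine (h X L hX hL (fun z => ‖dualSum c ⌊N⌋₊ n z‖ ^ 4)
    ((continuous_expSum _ _ _).norm.pow 4) (fun z => by positivity)).trans ?_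
  have h1 := setIntegral_expSum_le hZ (Ioc ⌊N⌋₊ n) (fun _ => 1)
    (fun m => (m : ℝ) ^ (c / (c - 1))) (measurableSet_Icc (a := 0) (b := dualFreq c X L))
    fun x hx => by rw [abs_of_nonneg hx.1]; exact hx.2
  calc _ ≤ C * (L / dualFreq c X L) * (Real.exp Real.pi * (dualFreq c X L *
        smoothCount (c / (c - 1)) N (dualFreq c X L))) := by
        gcongr
        refine h1.trans ?_
        gcongr
        simp only [mul_one, one_mul]
        refine sum_le_sum_of_subset_of_nonneg ?_ fun _ _ _ => (Real.exp_pos _).le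
        have : Ioc ⌊N⌋₊ n ⊆ Ioc ⌊N⌋₊ ⌊2 * N⌋₊ := Ioc_subset_Ioc_right hn
        exact product_subset_product (product_subset_product this this)
          (product_subset_product this this)
    _ = _ := by field_simp

lemma sum_Ioc_floor_two_pow {M : Type*} [AddCommMonoid M] (g : ℕ → M) {N : ℝ} (hN : 0 ≤ N)
    (k : ℕ) : ∑ m ∈ Ioc ⌊N⌋₊ ⌊2 ^ k * N⌋₊, g m =
      ∑ i ∈ range k, ∑ m ∈ Ioc ⌊2 ^ i * N⌋₊ ⌊2 * (2 ^ i * N)⌋₊, g m := by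
  induction k with
  | zero => simp
  | succ k ih =>
    rw [sum_range_succ, ← ih, show (2 : ℝ) ^ (k + 1) * N = 2 * (2 ^ k * N) by ring,
      sum_Ioc_consecutive]
    · refine Nat.floor_mono (le_mul_of_one_le_left hN (one_le_pow₀ (by norm_num)))
    · refine Nat.floor_mono (le_mul_of_one_le_left (by positivity) (by norm_num))

/-- Pointwise form of the B-process on a dyadic interval: `smoothSum` is controlled by boundedly
many dual sums. -/
lemma exists_smoothSum_pow_four_le {c c₀ : ℝ} (hc : 1 < c) (hc₀ : 0 < c₀) :
    ∃ (C β : ℝ) (k : ℕ), 0 ≤ C ∧ 0 < β ∧ ∀ X L : ℝ, 1 ≤ X → c₀ * X ≤ L → ∀ l ∈ Set.Icc L (2 * L),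
      ‖smoothSum c X l‖ ^ 4 ≤ C * (1 + X ^ 4 / L ^ 2 * ∑ i ∈ range k,
        (‖dualSum c ⌊2 ^ i * (β * L / X)⌋₊ ⌊2 * (2 ^ i * (β * L / X))⌋₊ (dualFreq c X l)‖ ^ 4 +
          X / L * ∑ n ∈ Ioc ⌊2 ^ i * (β * L / X)⌋₊ ⌊2 * (2 ^ i * (β * L / X))⌋₊,
            ‖dualSum c ⌊2 ^ i * (β * L / X)⌋₊ n (dualFreq c X l)‖ ^ 4)) := by
  obtain ⟨C₁, β₀, β₁, hC₁, hβ₀, hβ₁, h₁⟩ := exists_norm_smoothSum_sub_le hc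
  obtain ⟨k, hk⟩ := pow_unbounded_of_one_lt (2 * β₁ / β₀) (by norm_num : (1 : ℝ) < 2)
  have hk : 2 * β₁ ≤ 2 ^ k * β₀ := ((div_lt_iff₀ hβ₀).1 hk).le
  obtain ⟨C₂, hC₂, h₂⟩ := exists_norm_sum_oscInt_le (u₁ := β₀ / 2) (u₂ := 2 ^ k * β₀ + 1 / c₀ + β₀)
    hc (by positivity) (by
      have : 0 < 2 ^ k * β₀ + 1 / c₀ := by positivity
      linarith)
  refine ⟨8 * ((C₁ * (1 / c₀ ^ 2 + 1)) ^ 4 + k ^ 3 * C₂), β₀, k, by positivity, hβ₀, ?_⟩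
  intro X L hX hL l hl
  have hX0 : 0 < X := by linarith
  have hL0 : 0 < L := lt_of_lt_of_le (by positivity) hL
  have hl0 : 0 < l := hL0.trans_le hl.1
  set N : ℝ := β₀ * L / X with hN
  have hN0 : 0 < N := by positivity
  have hNX : N * X = β₀ * L := by rw [hN]; field_simp
  set z := dualFreq c X l
  set F : ℕ → ℝ := fun i => ‖dualSum c ⌊2 ^ i * N⌋₊ ⌊2 * (2 ^ i * N)⌋₊ z‖ ^ 4 +
          X / L * ∑ n ∈ Ioc ⌊2 ^ i * N⌋₊ ⌊2 * (2 ^ i * N)⌋₊, ‖dualSum c ⌊2 ^ i * N⌋₊ n z‖ ^ 4 with hF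
  have hF0 : ∀ i, 0 ≤ F i := fun i => by positivity
  set B : ℕ → ℂ := fun i => ∑ m ∈ Ioc ⌊2 ^ i * N⌋₊ ⌊2 * (2 ^ i * N)⌋₊, (X : ℂ) * oscInt c l (m * X)
    with hB
  have hblock : ∀ i ∈ range k, ‖B i‖ ^ 4 ≤ C₂ * (X ^ 4 / L ^ 2) * F i := by
    intro i hi
    have h2i : (1 : ℝ) ≤ 2 ^ i := one_le_pow₀ (by norm_num)
    have h2k : (2 : ℝ) * 2 ^ i ≤ 2 ^ k := by
      rw [← pow_succ']
      exact pow_le_pow_right₀ (by norm_num) (mem_range.1 hi)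
    refine (h₂ X l (2 ^ i * N) hX0 hl0 (by positivity) ?_ ?_).trans ?_
    · calc β₀ / 2 * l ≤ β₀ / 2 * (2 * L) := by gcongr; exact hl.2
        _ = 1 * (N * X) := by rw [hNX]; ring
        _ ≤ 2 ^ i * (N * X) := by gcongr
        _ = _ := by ring
    · have hXL : X ≤ 1 / c₀ * L := by
        rw [one_div, inv_mul_eq_div, le_div_iff₀ hc₀]; linarith
      calc (2 * (2 ^ i * N) + 1) * X = 2 * 2 ^ i * (N * X) + X := by ring
        _ ≤ 2 ^ k * (N * X) + 1 / c₀ * L := by gcongr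
        _ ≤ (2 ^ k * β₀ + 1 / c₀ + β₀) * L := by
          rw [hNX]; have : 0 < β₀ * L := by positivity
          linarith
        _ ≤ _ := by gcongr; exact hl.1
    · have : L ≤ l := hl.1
      simp only [hF]
      gcongr
  set T : Finset ℤ := (Ioc ⌊N⌋₊ ⌊2 ^ k * N⌋₊).map Nat.castEmbedding with hT
  have hT0 : (0 : ℤ) ∉ T := by
    simp only [hT, mem_map, mem_Ioc, Nat.castEmbedding_apply, not_exists, not_and]
    intro m hm h0
    omega
  have hsumT : ∑ m ∈ T, (X : ℂ) * oscInt c l (m * X) = ∑ i ∈ range k, B i := by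
    rw [hT, sum_map, hB]
    simp only [Nat.castEmbedding_apply, Int.cast_natCast]
    exact sum_Ioc_floor_two_pow (fun m : ℕ => (X : ℂ) * oscInt c l (m * X)) hN0.le k
  have herr := h₁ X l hX0 hl0.le T hT0 (by
    intro m hm hm0
    rcases le_or_gt m 0 with hneg | hpos
    · left
      have : (m : ℝ) ≤ 0 := by exact_mod_cast hneg
      nlinarith [mul_pos hβ₀ hl0]
    · lift m to ℕ using hpos.le
      rw [Int.cast_natCast]
      rcases le_or_gt m ⌊N⌋₊ with h | h
      · left
        have : (m : ℝ) ≤ N := (Nat.le_floor_iff hN0.le).1 h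
        calc (m : ℝ) * X ≤ N * X := by gcongr
          _ = β₀ * L := hNX
          _ ≤ _ := by gcongr; exact hl.1
      · right
        have h' : ⌊2 ^ k * N⌋₊ < m := by
          by_contra! hcon
          exact hm (mem_map.2 ⟨m, mem_Ioc.2 ⟨h, hcon⟩, rfl⟩)
        have h'' : 2 ^ k * N < m := (Nat.floor_lt (by positivity)).1 h'
        calc β₁ * l ≤ β₁ * (2 * L) := by gcongr; exact hl.2
          _ = 2 * β₁ * L := by ring
          _ ≤ 2 ^ k * β₀ * L := by gcongr
          _ = 2 ^ k * N * X := by rw [mul_assoc, mul_assoc, hNX]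
          _ ≤ _ := by gcongr)
  rw [hsumT] at herr
  have herr2 : X / (1 + l) ^ 2 + 1 / X ≤ 1 / c₀ ^ 2 + 1 := by
    have h3 : c₀ * X ≤ 1 + l := by linarith [hl.1]
    have h4 : X / (1 + l) ^ 2 ≤ 1 / c₀ ^ 2 := by
      rw [div_le_div_iff₀ (by positivity) (by positivity)]
      calc X * c₀ ^ 2 ≤ X * X * c₀ ^ 2 := by
            gcongr; nlinarith
        _ = (c₀ * X) ^ 2 := by ring
        _ ≤ (1 + l) ^ 2 := by gcongr
        _ = _ := by ring
    have h5 : 1 / X ≤ 1 := by rw [div_le_one hX0]; exact hX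
    linarith
  have hV : ‖smoothSum c X l‖ ≤ C₁ * (1 / c₀ ^ 2 + 1) + ∑ i ∈ range k, ‖B i‖ := by
    calc ‖smoothSum c X l‖ ≤ ‖smoothSum c X l - ∑ i ∈ range k, B i‖ + ‖∑ i ∈ range k, B i‖ := by
          simpa using norm_add_le (smoothSum c X l - ∑ i ∈ range k, B i) (∑ i ∈ range k, B i)
      _ ≤ C₁ * (1 / c₀ ^ 2 + 1) + ∑ i ∈ range k, ‖B i‖ := by
          gcongr
          · exact herr.trans (by gcongr)
          · exact norm_sum_le _ _
  have hpm : (∑ i ∈ range k, ‖B i‖) ^ 4 ≤ k ^ 3 * (C₂ * (X ^ 4 / L ^ 2) * ∑ i ∈ range k, F i) := by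
    rcases Nat.eq_zero_or_pos k with h0 | h0
    · simp [h0]
    · have := pow_sum_div_card_le_sum_pow (s := range k) (n := 3)
        (f := fun i => ‖B i‖) (fun _ _ => norm_nonneg _)
      rw [card_range, div_le_iff₀ (pow_pos (by exact_mod_cast h0) 3)] at this
      refine this.trans ?_
      rw [mul_comm (∑ i ∈ range k, ‖B i‖ ^ (3 + 1))]
      refine mul_le_mul_of_nonneg_left ?_ (by positivity)
      rw [mul_sum]
      exact sum_le_sum hblock
  set E := C₁ * (1 / c₀ ^ 2 + 1) with hE
  have hE0 : 0 ≤ E := by positivity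
  set Y : ℝ := X ^ 4 / L ^ 2 * ∑ i ∈ range k, F i with hY
  have hY0 : 0 ≤ Y := mul_nonneg (by positivity) (sum_nonneg fun i _ => hF0 i)
  calc ‖smoothSum c X l‖ ^ 4 ≤ (E + ∑ i ∈ range k, ‖B i‖) ^ 4 := by gcongr
    _ ≤ 8 * (E ^ 4 + (∑ i ∈ range k, ‖B i‖) ^ 4) := by
      have := add_pow_le hE0 (sum_nonneg fun i _ => norm_nonneg _ : 0 ≤ ∑ i ∈ range k, ‖B i‖) 4
      norm_num at this ⊢
      exact this
    _ ≤ 8 * (E ^ 4 + k ^ 3 * (C₂ * Y)) := by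
      gcongr
      rw [hY, ← mul_assoc C₂]
      exact hpm
    _ ≤ 8 * (E ^ 4 + k ^ 3 * C₂) * (1 + Y) := by
      have h6 : 0 ≤ E ^ 4 * Y := by positivity
      have h7 : 0 ≤ (k : ℝ) ^ 3 * C₂ := by positivity
      nlinarith

/-- The count of quadruples at the critical scale `T = N ^ (2 - d)` is `O(N ^ (2 + ε))`. -/
def CountBound (ε d : ℝ) : Prop :=
  ∃ D : ℝ, 0 < D ∧ ∀ N : ℝ, 0 < N → smoothCount d N (N ^ (2 - d)) ≤ D * N ^ (2 + ε)

lemma exists_integral_smoothSum_le {c c₀ ε : ℝ} (hc : 1 < c) (hc₀ : 0 < c₀) (hε : 0 ≤ ε)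
    (hP : CountBound ε (c / (c - 1))) :
    ∃ C c₁ : ℝ, 0 < C ∧ 0 < c₁ ∧ ∀ X L : ℝ, 1 ≤ X → c₀ * X ≤ L → L ≤ c₁ * X ^ 2 →
      ∫ l in Set.Icc L (2 * L), ‖smoothSum c X l‖ ^ 4 ≤ C * (X ^ 2 * L * (L / X) ^ ε) := by
  obtain ⟨D, hD, hP⟩ := hP
  obtain ⟨C₁, β, k, hC₁, hβ, h₁⟩ := exists_smoothSum_pow_four_le hc hc₀
  obtain ⟨C₂, hC₂, h₂⟩ := exists_integral_dualSum_le hc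
  have hc1 : 0 < c - 1 := by linarith
  have hc0 : 0 < c := by linarith
  set d := c / (c - 1) with hd
  set W : ℝ := 1 + ∑ i ∈ range k, (2 ^ i * β) ^ (2 - d) with hW
  have hW0 : 0 < W := by
    have : 0 ≤ ∑ i ∈ range k, (2 ^ i * β) ^ (2 - d) := sum_nonneg fun i _ => by positivity
    linarith
  set Q : ℝ := ∑ i ∈ range k, C₂ * D * (1 + 2 * (2 ^ i * β)) * (2 ^ i * β) ^ (2 + ε) with hQ
  have hQ0 : 0 ≤ Q := sum_nonneg fun i _ => by positivity
  refine ⟨C₁ * (1 / c₀ ^ ε + Q) + 1, (c - 1) / c ^ d / W, by positivity, by positivity, ?_⟩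
  intro X L hX hL hLX
  have hX0 : 0 < X := by linarith
  have hL0 : 0 < L := lt_of_lt_of_le (by positivity) hL
  set R : ℝ := L / X with hR
  have hR0 : 0 < R := by positivity
  have hRc : c₀ ≤ R := by rw [hR, le_div_iff₀ hX0]; exact hL
  have hLR : L = R * X := by rw [hR]; field_simp
  have hmoment : ∀ i ∈ range k, ∀ n ≤ ⌊2 * (2 ^ i * (β * L / X))⌋₊,
      ∫ l in Set.Icc L (2 * L), ‖dualSum c ⌊2 ^ i * (β * L / X)⌋₊ n (dualFreq c X l)‖ ^ 4 ≤
        C₂ * D * L * ((2 ^ i * β) ^ (2 + ε) * R ^ (2 + ε)) := by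
    intro i hi n hn
    have hN : 2 ^ i * (β * L / X) = 2 ^ i * β * R := by rw [hR]; ring
    refine (h₂ X L _ hX0 hL0 n hn).trans ?_
    rw [hN]
    have hbR : 0 < 2 ^ i * β * R := by positivity
    have hZ : (2 ^ i * β * R) ^ (2 - d) ≤ dualFreq c X L := by
      have hb : (2 ^ i * β) ^ (2 - d) ≤ W := by
        have := single_le_sum (f := fun i => (2 ^ i * β) ^ (2 - d)) (s := range k)
          (fun j _ => by positivity) hi
        linarith
      have hdf : dualFreq c X L = (c - 1) / c ^ d * (L * R ^ (-d)) := by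
        rw [dualFreq, ← hd, show X / (c * L) = 1 / (c * R) by rw [hR]; field_simp,
          Real.div_rpow (by norm_num) (by positivity), Real.one_rpow,
          Real.mul_rpow hc0.le hR0.le, Real.rpow_neg hR0.le]
        field_simp
      rw [hdf, Real.mul_rpow (by positivity) hR0.le, sub_eq_add_neg, Real.rpow_add hR0,
        ← sub_eq_add_neg, Real.rpow_two]
      have h3 : W * R ^ 2 ≤ (c - 1) / c ^ d * L := by
        rw [div_mul_eq_mul_div, le_div_iff₀ hW0] at hLX
        have h4 : L * (L * W) ≤ L * ((c - 1) / c ^ d * X ^ 2) := by gcongr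
        rw [hR, div_pow, mul_div_assoc', div_le_iff₀ (by positivity)]
        linarith
      calc _ ≤ W * (R ^ 2 * R ^ (-d)) := by gcongr
        _ = W * R ^ 2 * R ^ (-d) := by ring
        _ ≤ (c - 1) / c ^ d * L * R ^ (-d) := by gcongr
        _ = _ := by ring
    calc _ ≤ C₂ * L * (D * (2 ^ i * β * R) ^ (2 + ε)) := by
          gcongr
          exact (smoothCount_anti _ _ (by positivity) hZ).trans (hP _ hbR)
      _ = _ := by rw [Real.mul_rpow (by positivity) hR0.le]; ring
  have hcd : ∀ p n : ℕ, IntegrableOn (fun l => ‖dualSum c p n (dualFreq c X l)‖ ^ 4)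
      (Set.Icc L (2 * L)) := fun p n =>
    (continuousOn_comp_dualFreq hc hX0 hL0 (h := fun z => ‖dualSum c p n z‖ ^ 4)
      ((continuous_expSum _ _ _).norm.pow 4)).integrableOn_Icc
  have hint : ∀ i ∈ range k, IntegrableOn (fun l =>
      (‖dualSum c ⌊2 ^ i * (β * L / X)⌋₊ ⌊2 * (2 ^ i * (β * L / X))⌋₊ (dualFreq c X l)‖ ^ 4 +
          X / L * ∑ n ∈ Ioc ⌊2 ^ i * (β * L / X)⌋₊ ⌊2 * (2 ^ i * (β * L / X))⌋₊,
            ‖dualSum c ⌊2 ^ i * (β * L / X)⌋₊ n (dualFreq c X l)‖ ^ 4)) (Set.Icc L (2 * L)) :=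
    fun i _ => (hcd _ _).add ((integrable_finsetSum _ fun n _ => hcd _ n).const_mul _)
  have hone : IntegrableOn (fun _ : ℝ => (1 : ℝ)) (Set.Icc L (2 * L)) :=
    continuousOn_const.integrableOn_Icc
  have hpiece : ∀ i ∈ range k, ∫ l in Set.Icc L (2 * L),
      (‖dualSum c ⌊2 ^ i * (β * L / X)⌋₊ ⌊2 * (2 ^ i * (β * L / X))⌋₊ (dualFreq c X l)‖ ^ 4 +
          X / L * ∑ n ∈ Ioc ⌊2 ^ i * (β * L / X)⌋₊ ⌊2 * (2 ^ i * (β * L / X))⌋₊,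
            ‖dualSum c ⌊2 ^ i * (β * L / X)⌋₊ n (dualFreq c X l)‖ ^ 4) ≤
      C₂ * D * (1 + 2 * (2 ^ i * β)) * (2 ^ i * β) ^ (2 + ε) * (L * R ^ (2 + ε)) := by
    intro i hi
    rw [integral_add (hcd _ _) ((integrable_finsetSum _ fun n _ => hcd _ n).const_mul _),
      integral_const_mul, integral_finsetSum _ fun n _ => hcd _ n]
    set M := C₂ * D * L * ((2 ^ i * β) ^ (2 + ε) * R ^ (2 + ε)) with hM
    have hM0 : 0 ≤ M := by positivity
    have h5 : X / L * ∑ n ∈ Ioc ⌊2 ^ i * (β * L / X)⌋₊ ⌊2 * (2 ^ i * (β * L / X))⌋₊,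
        ∫ l in Set.Icc L (2 * L), ‖dualSum c ⌊2 ^ i * (β * L / X)⌋₊ n (dualFreq c X l)‖ ^ 4 ≤
        2 * (2 ^ i * β) * M := by
      calc _ ≤ X / L * ∑ n ∈ Ioc ⌊2 ^ i * (β * L / X)⌋₊ ⌊2 * (2 ^ i * (β * L / X))⌋₊, M := by
            gcongr with n hn
            exact hmoment i hi n (mem_Ioc.1 hn).2
        _ ≤ X / L * (2 * (2 ^ i * (β * L / X)) * M) := by
            rw [sum_const, nsmul_eq_mul]
            gcongr
            exact card_Ioc_floor_le (by positivity)
        _ = _ := by field_simp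
    calc _ ≤ M + 2 * (2 ^ i * β) * M := add_le_add (hmoment i hi _ le_rfl) h5
      _ = _ := by rw [hM]; ring
  calc _ ≤ ∫ l in Set.Icc L (2 * L), C₁ * (1 + X ^ 4 / L ^ 2 * ∑ i ∈ range k,
        (‖dualSum c ⌊2 ^ i * (β * L / X)⌋₊ ⌊2 * (2 ^ i * (β * L / X))⌋₊ (dualFreq c X l)‖ ^ 4 +
          X / L * ∑ n ∈ Ioc ⌊2 ^ i * (β * L / X)⌋₊ ⌊2 * (2 ^ i * (β * L / X))⌋₊,
            ‖dualSum c ⌊2 ^ i * (β * L / X)⌋₊ n (dualFreq c X l)‖ ^ 4)) := by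
        refine setIntegral_mono_on ?_ ?_ measurableSet_Icc fun l hl => h₁ X L hX hL l hl
        · exact (((continuous_expSum _ _ _).norm.pow 4).continuousOn).integrableOn_Icc
        · exact (hone.add ((integrable_finsetSum _ hint).const_mul _)).const_mul _
    _ ≤ C₁ * (L + X ^ 4 / L ^ 2 * (Q * (L * R ^ (2 + ε)))) := by
        rw [integral_const_mul, integral_add hone ((integrable_finsetSum _ hint).const_mul _),
          integral_const_mul, integral_finsetSum _ hint]
        gcongr
        · simp only [integral_const, MeasurableSet.univ, measureReal_restrict_apply, Set.univ_inter,
            Real.volume_real_Icc, smul_eq_mul, mul_one]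
          rw [max_eq_left (by linarith)]
          linarith
        · rw [hQ, sum_mul]
          exact sum_le_sum hpiece
    _ ≤ C₁ * (1 / c₀ ^ ε * (X ^ 2 * L * R ^ ε) + Q * (X ^ 2 * L * R ^ ε)) := by
        gcongr ?_ * (?_ + ?_)
        · have h7 : 1 ≤ 1 / c₀ ^ ε * R ^ ε := by
            rw [one_div, inv_mul_eq_div, le_div_iff₀ (by positivity), one_mul]
            gcongr
          have h8 : 1 ≤ X ^ 2 := one_le_pow₀ hX
          calc L = 1 * L * 1 := by ring
            _ ≤ X ^ 2 * L * (1 / c₀ ^ ε * R ^ ε) := by gcongr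
            _ = _ := by ring
        · refine le_of_eq ?_
          rw [Real.rpow_add hR0, Real.rpow_two, hR]
          field_simp
    _ ≤ _ := by
        have : 0 ≤ X ^ 2 * L * R ^ ε := by positivity
        linarith

lemma countBound_of_forall_ge {ε d D X₀ : ℝ} (hε : 0 ≤ ε) (hX₀ : 0 < X₀) (hD : 0 ≤ D)
    (h : ∀ N : ℝ, X₀ ≤ N → smoothCount d N (N ^ (2 - d)) ≤ D * N ^ (2 + ε)) : CountBound ε d := by
  refine ⟨D + 16 * X₀ ^ 4 * 2 ^ (2 + ε), by positivity, fun N hN => ?_⟩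
  have hsplit : D * N ^ (2 + ε) ≤ (D + 16 * X₀ ^ 4 * 2 ^ (2 + ε)) * N ^ (2 + ε) := by
    gcongr
    linarith [show 0 ≤ 16 * X₀ ^ 4 * (2 : ℝ) ^ (2 + ε) by positivity]
  rcases le_or_gt X₀ N with h1 | h1
  · exact (h N h1).trans hsplit
  rcases lt_or_ge (2 * N) 1 with h2 | h2
  · have : smoothCount d N (N ^ (2 - d)) = 0 := by
      rw [smoothCount, Nat.floor_eq_zero.2 h2]
      simp [quads]
    rw [this]
    positivity
  · refine (smoothCount_le d _ hN.le).trans ?_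
    have h3 : (1 : ℝ) ≤ 2 ^ (2 + ε) * N ^ (2 + ε) := by
      rw [← Real.mul_rpow (by norm_num) hN.le]
      exact Real.one_le_rpow h2 (by linarith)
    calc 16 * N ^ 4 ≤ 16 * X₀ ^ 4 * 1 := by rw [mul_one]; gcongr
      _ ≤ 16 * X₀ ^ 4 * (2 ^ (2 + ε) * N ^ (2 + ε)) := by gcongr
      _ ≤ _ := by
        have : 0 ≤ D * N ^ (2 + ε) := by positivity
        linarith

lemma countBound_two (d : ℝ) : CountBound 2 d := by
  refine countBound_of_forall_ge (D := 16) (X₀ := 1) (by norm_num) one_pos (by norm_num) ?_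
  intro N hN
  have hN0 : 0 ≤ N := by linarith
  refine (smoothCount_le d _ hN0).trans (le_of_eq ?_)
  rw [show (2 : ℝ) + 2 = ((4 : ℕ) : ℝ) by norm_num, Real.rpow_natCast]

lemma CountBound.mono {ε ε' d : ℝ} (hε : 0 ≤ ε) (hεε : ε ≤ ε') (h : CountBound ε d) :
    CountBound ε' d := by
  obtain ⟨D, hD, h⟩ := h
  refine countBound_of_forall_ge (D := D) (X₀ := 1) (by linarith) one_pos hD.le fun N hN => ?_
  refine (h N (by linarith)).trans ?_
  gcongr

/-- The fourth moment of `smoothSum` against a Gaussian of width `Λ` dominates the count at scale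
`Λ X ^ (-c)`. -/
lemma smoothCount_le_integral_smoothSum (c : ℝ) {X Λ : ℝ} (hX : 1 ≤ X) (hΛ : 0 < Λ) :
    Λ * smoothCount c X (Λ * X ^ (-c)) ≤
      ∫ l : ℝ, Real.exp (-(Real.pi / Λ ^ 2) * l ^ 2) * ‖smoothSum c X l‖ ^ 4 := by
  have hX0 : 0 < X := by linarith
  unfold smoothSum
  rw [integral_gaussian_expSum hΛ]
  refine mul_le_mul_of_nonneg_left ?_ hΛ.le
  have hsub : Ioc ⌊X⌋₊ ⌊2 * X⌋₊ ⊆ range (⌊4 * X⌋₊ + 1) := by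
    intro n hn
    rw [mem_Ioc] at hn
    rw [mem_range]
    have : ⌊2 * X⌋₊ ≤ ⌊4 * X⌋₊ := Nat.floor_mono (by linarith)
    omega
  have hone : ∀ n ∈ Ioc ⌊X⌋₊ ⌊2 * X⌋₊, bump ((n : ℝ) / X) = 1 := by
    intro n hn
    rw [mem_Ioc] at hn
    refine bump_eq_one ?_ ?_
    · rw [le_div_iff₀ hX0, one_mul]
      exact ((Nat.floor_lt hX0.le).1 hn.1).le
    · rw [div_le_iff₀ hX0]
      exact (Nat.le_floor_iff (by positivity)).1 hn.2
  have hgap : ∀ q : (ℕ × ℕ) × (ℕ × ℕ), gap (fun n : ℕ => ((n : ℝ) / X) ^ c) q =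
      X ^ (-c) * gap (fun n : ℕ => (n : ℝ) ^ c) q := by
    intro q
    simp only [gap, Real.div_rpow (Nat.cast_nonneg _) hX0.le, Real.rpow_neg hX0.le]
    ring
  calc smoothCount c X (Λ * X ^ (-c)) = ∑ q ∈ quads (Ioc ⌊X⌋₊ ⌊2 * X⌋₊),
        bump ((q.1.1 : ℝ) / X) * bump ((q.1.2 : ℝ) / X) *
          (bump ((q.2.1 : ℝ) / X) * bump ((q.2.2 : ℝ) / X)) *
          Real.exp (-Real.pi * Λ ^ 2 * gap (fun n : ℕ => ((n : ℝ) / X) ^ c) q ^ 2) := by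
        refine sum_congr rfl fun q hq => ?_
        simp only [quads, mem_product] at hq
        rw [hone _ hq.1.1, hone _ hq.1.2, hone _ hq.2.1, hone _ hq.2.2, hgap]
        simp only [one_mul]
        congr 1
        ring
    _ ≤ _ := by
        refine sum_le_sum_of_subset_of_nonneg (product_subset_product
          (product_subset_product hsub hsub) (product_subset_product hsub hsub)) fun q _ _ => ?_
        have := fun x : ℝ => bump.nonneg' x
        exact mul_nonneg (mul_nonneg (mul_nonneg (this _) (this _))
          (mul_nonneg (this _) (this _))) (Real.exp_pos _).le

lemma norm_smoothSum_le (c l : ℝ) {X : ℝ} (hX : 1 ≤ X) : ‖smoothSum c X l‖ ≤ 5 * X := by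
  refine (norm_expSum_le _ _ _ _).trans ?_
  calc _ ≤ ∑ _n ∈ range (⌊4 * X⌋₊ + 1), (1 : ℝ) := by
        refine sum_le_sum fun n _ => ?_
        rw [abs_of_nonneg (bump.nonneg' _)]
        exact bump.le_one
    _ = ⌊4 * X⌋₊ + 1 := by simp
    _ ≤ _ := by linarith [Nat.floor_le (by linarith : 0 ≤ 4 * X)]

lemma continuous_smoothSum_pow (c X : ℝ) : Continuous fun l => ‖smoothSum c X l‖ ^ 4 :=
  (continuous_expSum _ _ _).norm.pow 4

/-- Below the first stationary frequency `smoothSum` decays. -/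
lemma exists_integral_smoothSum_small_le {c : ℝ} (hc : 1 < c) :
    ∃ C c₀ : ℝ, 0 < C ∧ 0 < c₀ ∧ ∀ X : ℝ, 1 ≤ X →
      ∫ l in Set.Ioc 0 (c₀ * X), ‖smoothSum c X l‖ ^ 4 ≤ C * X ^ 4 := by
  obtain ⟨C, β₀, β₁, hC, hβ₀, hβ₁, h⟩ := exists_norm_smoothSum_sub_le hc
  refine ⟨8 * C ^ 4 * (Real.pi + 1 / β₁) + 1, 1 / β₁, by positivity, by positivity, ?_⟩
  intro X hX
  have hX0 : 0 < X := by linarith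
  have hpt : ∀ l ∈ Set.Ioc 0 (1 / β₁ * X),
      ‖smoothSum c X l‖ ^ 4 ≤ 8 * C ^ 4 * (X ^ 4 * (1 + l ^ 2)⁻¹ + 1) := by
    intro l hl
    have hl0 : 0 < l := hl.1
    have hlX : β₁ * l ≤ X := by
      have := hl.2
      rw [one_div, inv_mul_eq_div, le_div_iff₀ hβ₁] at this
      linarith
    have hV := h X l hX0 hl0.le ∅ (by simp) (by
      intro m _ hm
      rcases lt_or_gt_of_ne hm with hm | hm
      · left
        have : (m : ℝ) ≤ 0 := by exact_mod_cast hm.le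
        nlinarith [mul_pos hβ₀ hl0]
      · right
        have : (1 : ℝ) ≤ m := by exact_mod_cast hm
        nlinarith)
    rw [sum_empty, sub_zero] at hV
    have h1 : (X / (1 + l) ^ 2) ^ 4 ≤ X ^ 4 * (1 + l ^ 2)⁻¹ := by
      rw [div_pow, div_eq_mul_inv]
      gcongr
      calc 1 + l ^ 2 ≤ (1 + l) ^ 2 := by nlinarith
        _ ≤ ((1 + l) ^ 2) ^ 4 := le_self_pow₀ (one_le_pow₀ (by linarith)) (by norm_num)
    have h2 : (1 / X) ^ 4 ≤ 1 := pow_le_one₀ (by positivity) (by rw [div_le_one hX0]; exact hX)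
    calc _ ≤ (C * (X / (1 + l) ^ 2 + 1 / X)) ^ 4 := by gcongr
      _ = C ^ 4 * (X / (1 + l) ^ 2 + 1 / X) ^ 4 := by ring
      _ ≤ C ^ 4 * (8 * ((X / (1 + l) ^ 2) ^ 4 + (1 / X) ^ 4)) := by
        gcongr
        have := add_pow_le (by positivity : 0 ≤ X / (1 + l) ^ 2) (by positivity : 0 ≤ 1 / X) 4
        norm_num at this ⊢
        exact this
      _ ≤ C ^ 4 * (8 * (X ^ 4 * (1 + l ^ 2)⁻¹ + 1)) := by gcongr
      _ = _ := by ring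
  have hint : Integrable fun l : ℝ => X ^ 4 * (1 + l ^ 2)⁻¹ := integrable_inv_one_add_sq.const_mul _
  have hone : IntegrableOn (fun _ : ℝ => (1 : ℝ)) (Set.Ioc 0 (1 / β₁ * X)) := by simp
  calc _ ≤ ∫ l in Set.Ioc 0 (1 / β₁ * X), 8 * C ^ 4 * (X ^ 4 * (1 + l ^ 2)⁻¹ + 1) := by
        refine setIntegral_mono_on ?_ ((hint.integrableOn.add hone).const_mul _)
          measurableSet_Ioc hpt
        exact ((continuous_smoothSum_pow c X).integrableOn_Icc).mono_set Set.Ioc_subset_Icc_self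
    _ ≤ 8 * C ^ 4 * (X ^ 4 * Real.pi + 1 / β₁ * X) := by
        rw [integral_const_mul, integral_add hint.integrableOn hone]
        gcongr
        · refine (setIntegral_le_integral hint
            (Filter.Eventually.of_forall fun l => by positivity)).trans ?_
          rw [integral_const_mul, integral_univ_inv_one_add_sq]
        · simp only [integral_const, MeasurableSet.univ, measureReal_restrict_apply, Set.univ_inter,
            Real.volume_real_Ioc, smul_eq_mul, mul_one, sub_zero]
          rw [max_eq_left (by positivity)]
    _ ≤ 8 * C ^ 4 * (X ^ 4 * Real.pi + 1 / β₁ * X ^ 4) := by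
        gcongr
        exact le_self_pow₀ hX (by norm_num)
    _ ≤ _ := by
        have : 0 ≤ X ^ 4 := by positivity
        linarith

/-- Gaussian tail beyond `Λ X ^ τ`. -/
lemma exists_integral_smoothSum_tail_le (c : ℝ) {τ : ℝ} (hτ : 0 < τ) :
    ∃ C : ℝ, 0 < C ∧ ∀ X Λ Y : ℝ, 1 ≤ X → 0 < Λ → Λ * X ^ τ ≤ Y →
      ∫ l in Set.Ioi Y, Real.exp (-(Real.pi / Λ ^ 2) * l ^ 2) * ‖smoothSum c X l‖ ^ 4 ≤
        C * (Λ * X ^ 2) := by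
  obtain ⟨k, hk⟩ := exists_nat_gt (1 / τ)
  have hk : 1 ≤ τ * k := by rw [div_lt_iff₀ hτ] at hk; linarith
  refine ⟨625 * k.factorial * 2, by positivity, fun X Λ Y hX hΛ hY => ?_⟩
  have hX0 : 0 < X := by linarith
  set y : ℝ := (X ^ τ) ^ 2 with hy
  have hy0 : 0 < y := by positivity
  have hexp : X ^ 4 * Real.exp (-y) ≤ k.factorial * X ^ 2 := by
    have h1 := Real.pow_div_factorial_le_exp y hy0.le k
    have h2 : X ^ 2 ≤ y ^ k := by
      rw [hy, ← pow_mul, mul_comm 2 k, pow_mul, ← Real.rpow_natCast (X ^ τ) k,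
        ← Real.rpow_mul hX0.le]
      gcongr
      exact Real.self_le_rpow_of_one_le hX hk
    rw [Real.exp_neg, ← div_eq_mul_inv, div_le_iff₀ (Real.exp_pos y)]
    calc X ^ 4 = k.factorial * X ^ 2 * (X ^ 2 / k.factorial) := by field_simp
      _ ≤ k.factorial * X ^ 2 * Real.exp y := by
        gcongr
        exact le_trans (by gcongr) h1
  have hpt : ∀ l ∈ Set.Ioi Y, Real.exp (-(Real.pi / Λ ^ 2) * l ^ 2) * ‖smoothSum c X l‖ ^ 4 ≤
      625 * X ^ 4 * Real.exp (-y) * Real.exp (-(1 / Λ ^ 2) * l ^ 2) := by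
    intro l hl
    have hl' : Λ * X ^ τ ≤ l := hY.trans (le_of_lt hl)
    have h3 : y ≤ l ^ 2 / Λ ^ 2 := by
      rw [le_div_iff₀ (by positivity), hy, ← mul_pow, mul_comm]
      gcongr
    have h4 : Real.exp (-(Real.pi / Λ ^ 2) * l ^ 2) ≤
        Real.exp (-y) * Real.exp (-(1 / Λ ^ 2) * l ^ 2) := by
      rw [← Real.exp_add, Real.exp_le_exp]
      have h5 : Real.pi / Λ ^ 2 * l ^ 2 = Real.pi * (l ^ 2 / Λ ^ 2) := by ring
      have h6 : 1 / Λ ^ 2 * l ^ 2 = l ^ 2 / Λ ^ 2 := by ring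
      have h7 : 3 * (l ^ 2 / Λ ^ 2) ≤ Real.pi * (l ^ 2 / Λ ^ 2) := by
        gcongr
        exact Real.pi_gt_three.le
      linarith
    have h8 : ‖smoothSum c X l‖ ^ 4 ≤ 625 * X ^ 4 := by
      calc _ ≤ (5 * X) ^ 4 := by
            gcongr
            exact norm_smoothSum_le c l hX
        _ = _ := by ring
    calc _ ≤ Real.exp (-y) * Real.exp (-(1 / Λ ^ 2) * l ^ 2) * (625 * X ^ 4) := by gcongr
      _ = _ := by ring
  have hint : Integrable fun l : ℝ => Real.exp (-(1 / Λ ^ 2) * l ^ 2) :=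
    integrable_exp_neg_mul_sq (by positivity)
  calc _ ≤ ∫ l in Set.Ioi Y, 625 * X ^ 4 * Real.exp (-y) * Real.exp (-(1 / Λ ^ 2) * l ^ 2) :=
        setIntegral_mono_on (integrable_gaussian_expSum hΛ _ _ _).integrableOn
          (hint.const_mul _).integrableOn measurableSet_Ioi hpt
    _ ≤ ∫ l : ℝ, 625 * X ^ 4 * Real.exp (-y) * Real.exp (-(1 / Λ ^ 2) * l ^ 2) :=
        setIntegral_le_integral (hint.const_mul _)
          (Filter.Eventually.of_forall fun l => by positivity)
    _ = 625 * (X ^ 4 * Real.exp (-y)) * (√Real.pi * Λ) := by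
        rw [integral_const_mul, integral_gaussian, div_div_eq_mul_div, div_one,
          Real.sqrt_mul Real.pi_pos.le, Real.sqrt_sq hΛ.le]
        ring
    _ ≤ 625 * (k.factorial * X ^ 2) * (2 * Λ) := by
        gcongr
        rw [Real.sqrt_le_left (by norm_num)]
        linarith [Real.pi_le_four]
    _ = _ := by ring

lemma integral_Ioc_two_pow {h : ℝ → ℝ} (hh : Continuous h) {a : ℝ} (ha : 0 ≤ a) (n : ℕ) :
    ∫ l in Set.Ioc a (2 ^ n * a), h l =
      ∑ i ∈ range n, ∫ l in Set.Icc (2 ^ i * a) (2 * (2 ^ i * a)), h l := by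
  have hle : ∀ i : ℕ, 2 ^ i * a ≤ 2 * (2 ^ i * a) := fun i => by
    have : 0 ≤ 2 ^ i * a := by positivity
    linarith
  rw [← intervalIntegral.integral_of_le
    (le_mul_of_one_le_left ha (one_le_pow₀ (by norm_num : (1 : ℝ) ≤ 2)))]
  have := intervalIntegral.sum_integral_adjacent_intervals (f := h) (μ := volume)
    (a := fun i : ℕ => 2 ^ i * a) (n := n) fun i _ => hh.intervalIntegrable _ _
  simp only [pow_zero, one_mul] at this
  rw [← this]
  refine sum_congr rfl fun i _ => ?_
  rw [integral_Icc_eq_integral_Ioc, ← intervalIntegral.integral_of_le (hle i),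
    show (2 : ℝ) ^ (i + 1) * a = 2 * (2 ^ i * a) by ring]

lemma integral_gaussian_smoothSum_eq (c X : ℝ) (Λ : ℝ) :
    ∫ l : ℝ, Real.exp (-(Real.pi / Λ ^ 2) * l ^ 2) * ‖smoothSum c X l‖ ^ 4 =
      2 * ∫ l in Set.Ioi (0 : ℝ),
        Real.exp (-(Real.pi / Λ ^ 2) * l ^ 2) * ‖smoothSum c X l‖ ^ 4 := by
  rw [← integral_comp_abs (f := fun l =>
    Real.exp (-(Real.pi / Λ ^ 2) * l ^ 2) * ‖smoothSum c X l‖ ^ 4)]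
  congr 1
  ext l
  rw [sq_abs]
  rcases abs_choice l with h | h <;> rw [h]
  rw [show ‖smoothSum c X (-l)‖ = ‖smoothSum c X l‖ from expSum_neg _ _ _ _]

/-- Splitting the Gaussian fourth moment at `a` and `b`. -/
lemma integral_gaussian_smoothSum_le (c X : ℝ) {Λ a b : ℝ} (hΛ : 0 < Λ) (ha : 0 ≤ a) (hab : a ≤ b) :
    ∫ l : ℝ, Real.exp (-(Real.pi / Λ ^ 2) * l ^ 2) * ‖smoothSum c X l‖ ^ 4 ≤
      2 * ((∫ l in Set.Ioc 0 a, ‖smoothSum c X l‖ ^ 4) + (∫ l in Set.Ioc a b, ‖smoothSum c X l‖ ^ 4) +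
        ∫ l in Set.Ioi b, Real.exp (-(Real.pi / Λ ^ 2) * l ^ 2) * ‖smoothSum c X l‖ ^ 4) := by
  have hint : Integrable fun l : ℝ =>
      Real.exp (-(Real.pi / Λ ^ 2) * l ^ 2) * ‖smoothSum c X l‖ ^ 4 :=
    integrable_gaussian_expSum hΛ _ _ _
  have hle : ∀ p q : ℝ, ∫ l in Set.Ioc p q,
      Real.exp (-(Real.pi / Λ ^ 2) * l ^ 2) * ‖smoothSum c X l‖ ^ 4 ≤
      ∫ l in Set.Ioc p q, ‖smoothSum c X l‖ ^ 4 := by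
    intro p q
    refine setIntegral_mono_on hint.integrableOn ?_ measurableSet_Ioc fun l _ => ?_
    · exact ((continuous_smoothSum_pow c X).integrableOn_Icc).mono_set Set.Ioc_subset_Icc_self
    · refine mul_le_of_le_one_left (by positivity) (Real.exp_le_one_iff.2 ?_)
      have : 0 ≤ Real.pi / Λ ^ 2 * l ^ 2 := by positivity
      linarith
  rw [integral_gaussian_smoothSum_eq, ← Set.Ioc_union_Ioi_eq_Ioi (ha.trans hab),
    setIntegral_union (Set.Ioc_disjoint_Ioi le_rfl) measurableSet_Ioi hint.integrableOn
      hint.integrableOn, ← Set.Ioc_union_Ioc_eq_Ioc ha hab,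
    setIntegral_union (Set.Ioc_disjoint_Ioc_of_le le_rfl) measurableSet_Ioc hint.integrableOn
      hint.integrableOn]
  exact mul_le_mul_of_nonneg_left
    (add_le_add (add_le_add (hle _ _) (hle _ _)) le_rfl) zero_le_two

lemma sum_two_pow_mul_le {a Y : ℝ} (ha : 0 ≤ a) (hY : 0 ≤ Y) {n : ℕ}
    (h : ∀ i < n, 2 ^ i * a ≤ Y) : ∑ i ∈ range n, 2 ^ i * a ≤ 2 * Y := by
  rcases n with _ | n
  · simpa using hY
  · rw [← sum_mul, geom_sum_eq (by norm_num)]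
    have := h n n.lt_succ_self
    rw [pow_succ]
    nlinarith

/-- Improving the exponent for `c` from the exponent for the conjugate `c / (c - 1)`. -/
lemma CountBound.improve {c ε : ℝ} (hc : 1 < c) (hε : 0 < ε) (hε2 : ε ≤ 2)
    (hP : CountBound ε (c / (c - 1))) : CountBound (ε - ε ^ 2 / 8) c := by
  obtain ⟨C₁, c₀, hC₁, hc₀, h₁⟩ := exists_integral_smoothSum_small_le hc
  obtain ⟨C₂, c₁, hC₂, hc₁, h₂⟩ := exists_integral_smoothSum_le hc hc₀ hε.le hP
  set τ : ℝ := ε ^ 2 / 8 with hτ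
  have hτ0 : 0 < τ := by positivity
  obtain ⟨C₃, hC₃, h₃⟩ := exists_integral_smoothSum_tail_le c hτ0
  have hδ : 0 < ε / 2 - τ := by rw [hτ]; nlinarith
  obtain ⟨X₀, hX₀⟩ := Filter.eventually_atTop.1
    ((tendsto_rpow_neg_atTop hδ).eventually (ge_mem_nhds hc₁))
  refine countBound_of_forall_ge (D := 2 * (C₁ + 2 * C₂ + C₃)) (X₀ := max X₀ 1)
    (by rw [hτ]; nlinarith) (by positivity) (by positivity) fun X hX => ?_
  have hX1 : 1 ≤ X := (le_max_right _ _).trans hX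
  have hX0 : 0 < X := by linarith
  set Λ : ℝ := X ^ (2 - ε / 2) with hΛ
  have hΛ0 : 0 < Λ := by positivity
  set Y : ℝ := Λ * X ^ τ with hY
  have hY0 : 0 < Y := by positivity
  have hYX : Y ≤ c₁ * X ^ 2 := by
    have h := hX₀ X ((le_max_left _ _).trans hX)
    calc Y = X ^ (-(ε / 2 - τ)) * X ^ 2 := by
          rw [hY, hΛ, ← Real.rpow_two, ← Real.rpow_add hX0, ← Real.rpow_add hX0]
          congr 1
          ring
      _ ≤ c₁ * X ^ 2 := by gcongr
  set a : ℝ := c₀ * X with ha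
  have ha0 : 0 < a := by positivity
  have hex : ∃ n : ℕ, Y ≤ 2 ^ n * a := by
    obtain ⟨n, hn⟩ := pow_unbounded_of_one_lt (Y / a) (by norm_num : (1 : ℝ) < 2)
    exact ⟨n, ((div_lt_iff₀ ha0).1 hn).le⟩
  classical
  set n := Nat.find hex
  have hn : Y ≤ 2 ^ n * a := Nat.find_spec hex
  have hmin : ∀ i < n, 2 ^ i * a ≤ Y := fun i hi => (not_le.1 (Nat.find_min hex hi)).le
  have hmid : ∫ l in Set.Ioc a (2 ^ n * a), ‖smoothSum c X l‖ ^ 4 ≤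
      2 * C₂ * (X ^ 2 * Y * (Y / X) ^ ε) := by
    rw [integral_Ioc_two_pow (continuous_smoothSum_pow c X) ha0.le]
    calc _ ≤ ∑ i ∈ range n, C₂ * X ^ 2 * (Y / X) ^ ε * (2 ^ i * a) := by
          refine sum_le_sum fun i hi => ?_
          have hi' := hmin i (mem_range.1 hi)
          have h2i : (1 : ℝ) ≤ 2 ^ i := one_le_pow₀ (by norm_num)
          refine (h₂ X (2 ^ i * a) hX1 (le_mul_of_one_le_left ha0.le h2i)
            (hi'.trans hYX)).trans ?_
          calc C₂ * (X ^ 2 * (2 ^ i * a) * (2 ^ i * a / X) ^ ε) ≤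
              C₂ * (X ^ 2 * (2 ^ i * a) * (Y / X) ^ ε) := by gcongr
            _ = _ := by ring
      _ = C₂ * X ^ 2 * (Y / X) ^ ε * ∑ i ∈ range n, 2 ^ i * a := by rw [mul_sum]
      _ ≤ C₂ * X ^ 2 * (Y / X) ^ ε * (2 * Y) := by
          gcongr
          exact sum_two_pow_mul_le ha0.le hY0.le hmin
      _ = _ := by ring
  have hcount : Λ * smoothCount c X (X ^ (2 - c)) ≤
      2 * (C₁ * X ^ 4 + 2 * C₂ * (X ^ 2 * Y * (Y / X) ^ ε) + C₃ * (Λ * X ^ 2)) := by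
    calc _ ≤ Λ * smoothCount c X (Λ * X ^ (-c)) := by
          refine mul_le_mul_of_nonneg_left (smoothCount_anti _ _ (by positivity) ?_) hΛ0.le
          rw [hΛ, ← Real.rpow_add hX0]
          exact Real.rpow_le_rpow_of_exponent_le hX1 (by linarith)
      _ ≤ _ := smoothCount_le_integral_smoothSum c hX1 hΛ0
      _ ≤ _ := integral_gaussian_smoothSum_le c X hΛ0 ha0.le
          (le_mul_of_one_le_left ha0.le (one_le_pow₀ (by norm_num : (1 : ℝ) ≤ 2)) :
            a ≤ 2 ^ n * a)
      _ ≤ _ := by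
          gcongr
          · exact h₁ X hX1
          · exact h₃ X Λ _ hX1 hΛ0 hn
  have hpow : ∀ s : ℝ, s ≤ 2 - ε / 2 + (2 + (ε - τ)) → X ^ s ≤ Λ * X ^ (2 + (ε - τ)) := by
    intro s hs
    rw [hΛ, ← Real.rpow_add hX0]
    exact Real.rpow_le_rpow_of_exponent_le hX1 hs
  have e₁ : X ^ 4 ≤ Λ * X ^ (2 + (ε - τ)) := by
    have := hpow ((4 : ℕ) : ℝ) (by push_cast; linarith)
    rwa [Real.rpow_natCast] at this
  have e₂ : X ^ 2 * Y * (Y / X) ^ ε ≤ Λ * X ^ (2 + (ε - τ)) := by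
    have hYe : Y = X ^ (2 - ε / 2 + τ) := by rw [hY, hΛ, ← Real.rpow_add hX0]
    have hYX' : Y / X = X ^ (1 - ε / 2 + τ) := by
      rw [hYe, ← Real.rpow_sub_one hX0.ne']
      congr 1
      ring
    rw [hYX', hYe, ← Real.rpow_two, ← Real.rpow_add hX0, ← Real.rpow_mul hX0.le,
      ← Real.rpow_add hX0]
    refine hpow _ ?_
    have : τ * ε ≤ τ * 2 := by gcongr
    nlinarith
  have e₃ : Λ * X ^ 2 ≤ Λ * X ^ (2 + (ε - τ)) := by
    rw [← Real.rpow_two]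
    gcongr
    linarith
  have hfin : Λ * smoothCount c X (X ^ (2 - c)) ≤
      Λ * (2 * (C₁ + 2 * C₂ + C₃) * X ^ (2 + (ε - τ))) := by
    refine hcount.trans ?_
    calc _ ≤ 2 * (C₁ * (Λ * X ^ (2 + (ε - τ))) + 2 * C₂ * (Λ * X ^ (2 + (ε - τ))) +
          C₃ * (Λ * X ^ (2 + (ε - τ)))) := by gcongr
      _ = _ := by ring
  exact le_of_mul_le_mul_left hfin hΛ0

/-- The smoothed count of quadruples is `O(N ^ (2 + ε))` for every `ε > 0`. -/
theorem countBound {c ε : ℝ} (hc : 1 < c) (hε : 0 < ε) : CountBound ε c := by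
  have key : ∀ k : ℕ, ∀ c : ℝ, 1 < c → CountBound (8 / (k + 4)) c := by
    intro k
    induction k with
    | zero =>
      intro c _
      convert countBound_two c using 1
      norm_num
    | succ k ih =>
      intro c hc
      have hc' : 1 < c / (c - 1) := by
        rw [lt_div_iff₀ (by linarith)]
        linarith
      have hk : (0 : ℝ) ≤ k := Nat.cast_nonneg k
      have h8 : (8 : ℝ) / (k + 4) ≤ 2 := by
        rw [div_le_iff₀ (by positivity)]
        linarith
      have h := (ih _ hc').improve hc (by positivity) h8
      have h8' : 0 < (8 : ℝ) / (k + 4) := by positivity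
      refine h.mono (by nlinarith) ?_
      push_cast
      rw [div_pow, div_div, div_sub_div _ _ (by positivity) (by positivity),
        div_le_div_iff₀ (by positivity) (by positivity)]
      have : (0 : ℝ) ≤ (k + 4) ^ 2 := by positivity
      nlinarith
  obtain ⟨k, hk⟩ := exists_nat_gt (8 / ε)
  refine (key k c hc).mono (by positivity) ?_
  rw [div_lt_iff₀ hε] at hk
  rw [div_le_iff₀ (by positivity)]
  nlinarith

lemma exists_log_pow_ten_le {δ : ℝ} (hδ : 0 < δ) :
    ∃ B : ℝ, 0 < B ∧ ∀ X : ℝ, 1 ≤ X → Real.log X ^ 10 ≤ B * X ^ δ := by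
  refine ⟨(1 / (δ / 10)) ^ 10, by positivity, fun X hX => ?_⟩
  have hX0 : 0 ≤ X := by linarith
  have h := Real.log_le_rpow_div hX0 (by positivity : 0 < δ / 10)
  calc Real.log X ^ 10 ≤ (X ^ (δ / 10) / (δ / 10)) ^ 10 := by
        have := Real.log_nonneg hX
        gcongr
    _ = (1 / (δ / 10)) ^ 10 * (X ^ (δ / 10)) ^ 10 := by ring
    _ = _ := by
        rw [← Real.rpow_natCast (X ^ (δ / 10)) 10, ← Real.rpow_mul hX0]
        congr 2
        push_cast
        ring

/-- Dyadic decomposition of the truncated reciprocal. -/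
lemma min_one_div_abs_le {K u : ℝ} {n : ℕ} (hn : |u| < 2 ^ n) :
    (if u = 0 then K else min K (1 / |u|)) ≤
      (if |u| < 1 then K else 0) + ∑ j ∈ range n, (if |u| < 2 ^ (j + 1) then 1 / 2 ^ j else 0) := by
  have hsum : ∀ j ∈ range n, (0 : ℝ) ≤ if |u| < 2 ^ (j + 1) then 1 / 2 ^ j else 0 := by
    intro j _
    split_ifs <;> positivity
  rcases lt_or_ge |u| 1 with h | h
  · rw [if_pos h]
    refine le_add_of_le_of_nonneg ?_ (sum_nonneg hsum)
    split_ifs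
    · exact le_rfl
    · exact min_le_left _ _
  · have hu : u ≠ 0 := by
      rintro rfl
      norm_num at h
    rw [if_neg hu, if_neg h.not_gt, zero_add]
    obtain ⟨j, hj₁, hj₂⟩ := exists_nat_pow_near h (by norm_num : (1 : ℝ) < 2)
    have hjn : j < n := (pow_lt_pow_iff_right₀ (by norm_num : (1 : ℝ) < 2)).1 (hj₁.trans_lt hn)
    refine le_trans ?_ (single_le_sum hsum (mem_range.2 hjn))
    rw [if_pos hj₂]
    exact (min_le_right _ _).trans (by gcongr)

/-- The sum of truncated reciprocals of gaps in terms of the numbers of small gaps. -/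
lemma sum_min_one_div_abs_gap_le (J : Finset ℕ) (f : ℕ → ℝ) {K : ℝ} {n : ℕ}
    (hn : ∀ q ∈ quads J, |gap f q| < 2 ^ n) :
    ∑ q ∈ quads J, (if gap f q = 0 then K else min K (1 / |gap f q|)) ≤
      K * ((quads J).filter fun q => |gap f q| < 1).card +
        ∑ j ∈ range n, 1 / 2 ^ j * (((quads J).filter fun q => |gap f q| < 2 ^ (j + 1)).card : ℝ) := by
  calc _ ≤ ∑ q ∈ quads J, ((if |gap f q| < 1 then K else 0) +
        ∑ j ∈ range n, (if |gap f q| < 2 ^ (j + 1) then 1 / 2 ^ j else 0)) :=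
        sum_le_sum fun q hq => min_one_div_abs_le (hn q hq)
    _ = _ := by
        rw [sum_add_distrib, sum_comm, ← sum_filter, sum_const, nsmul_eq_mul, mul_comm]
        congr 1
        refine sum_congr rfl fun j _ => ?_
        rw [← sum_filter, sum_const, nsmul_eq_mul, mul_comm]

lemma card_gap_lt_one_le (c X : ℝ) :
    (((quads (Ioc ⌊X⌋₊ ⌊2 * X⌋₊)).filter
      fun q => |gap (fun n : ℕ => (n : ℝ) ^ c) q| < 1).card : ℝ) ≤
      Real.exp Real.pi * smoothCount c X 1 := by
  rw [card_eq_sum_ones, sum_filter, smoothCount, mul_sum]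
  push_cast
  refine sum_le_sum fun q _ => ?_
  split_ifs with h
  · rw [← Real.exp_add, Real.one_le_exp_iff]
    have : gap (fun n : ℕ => (n : ℝ) ^ c) q ^ 2 ≤ 1 := by
      rw [sq_le_one_iff_abs_le_one]
      exact h.le
    nlinarith [Real.pi_pos]
  · positivity

lemma abs_gap_le {c X : ℝ} (hc : 0 ≤ c) (hX : 0 ≤ X) {q : (ℕ × ℕ) × (ℕ × ℕ)}
    (hq : q ∈ quads (Ioc ⌊X⌋₊ ⌊2 * X⌋₊)) :
    |gap (fun n : ℕ => (n : ℝ) ^ c) q| ≤ 2 * (2 * X) ^ c := by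
  have h : ∀ n ∈ Ioc ⌊X⌋₊ ⌊2 * X⌋₊, 0 ≤ (n : ℝ) ^ c ∧ (n : ℝ) ^ c ≤ (2 * X) ^ c := by
    intro n hn
    refine ⟨by positivity, ?_⟩
    gcongr
    exact (Nat.le_floor_iff (by positivity)).1 (mem_Ioc.1 hn).2
  simp only [quads, mem_product] at hq
  have h1 := h _ hq.1.1
  have h2 := h _ hq.1.2
  have h3 := h _ hq.2.1
  have h4 := h _ hq.2.2
  simp only [gap]
  rw [abs_le]
  constructor <;> linarith

lemma exists_two_pow_gt {c : ℝ} (hc : 2 < c) :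
    ∃ B : ℝ, 0 < B ∧ ∀ X : ℝ, 1 ≤ X → ∃ n : ℕ, 2 * (2 * X) ^ c < 2 ^ n ∧
      n * X ^ (4 - c) ≤ B * X ^ 2 := by
  set δ : ℝ := (c - 2) / c with hδ
  have hc0 : 0 < c := by linarith
  have hδ0 : 0 < δ := div_pos (by linarith) hc0
  set B₀ : ℝ := 2 * 2 ^ c with hB₀
  refine ⟨2 * (B₀ ^ δ / δ) + 1, by positivity, fun X hX => ?_⟩
  have hX0 : 0 < X := by linarith
  set M : ℝ := 2 * (2 * X) ^ c with hM
  have hM1 : 1 < M := by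
    have : (1 : ℝ) ≤ (2 * X) ^ c := Real.one_le_rpow (by linarith) hc0.le
    linarith
  have hMB : M = B₀ * X ^ c := by
    rw [hM, hB₀, Real.mul_rpow (by norm_num) hX0.le]
    ring
  have hlogM : 0 < Real.log M := Real.log_pos hM1
  refine ⟨⌊2 * Real.log M⌋₊ + 1, ?_, ?_⟩
  · rw [← Real.log_lt_log_iff (by linarith) (by positivity), Real.log_pow]
    have h1 := Nat.lt_floor_add_one (2 * Real.log M)
    have h2 := Real.log_two_gt_d9
    push_cast
    calc Real.log M < 2 * Real.log M * Real.log 2 := by nlinarith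
      _ ≤ _ := by gcongr
  · have h1 : ((⌊2 * Real.log M⌋₊ + 1 : ℕ) : ℝ) ≤ 2 * Real.log M + 1 := by
      push_cast
      linarith [Nat.floor_le (by positivity : 0 ≤ 2 * Real.log M)]
    have h2 : Real.log M ≤ B₀ ^ δ / δ * X ^ (c - 2) := by
      refine (Real.log_le_rpow_div (by linarith) hδ0).trans (le_of_eq ?_)
      rw [hMB, Real.mul_rpow (by positivity) (by positivity), ← Real.rpow_mul hX0.le, hδ,
        mul_div_cancel₀ _ hc0.ne']
      ring
    have h3 : (1 : ℝ) ≤ X ^ (c - 2) := Real.one_le_rpow hX (by linarith)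
    calc _ ≤ (2 * (B₀ ^ δ / δ * X ^ (c - 2)) + X ^ (c - 2)) * X ^ (4 - c) := by
          gcongr
          linarith
      _ = (2 * (B₀ ^ δ / δ) + 1) * (X ^ (c - 2) * X ^ (4 - c)) := by ring
      _ = _ := by
          rw [← Real.rpow_add hX0, ← Real.rpow_two]
          congr 2
          ring

/-- Truncated-reciprocal sum over all quadruples, from the counting hypothesis at `γ ≥ 1` and the
smoothed count near the diagonal. -/
lemma exists_sum_min_le {c η C₁ : ℝ} (hc : 2 < c) (hη : 0 < η) (hC₁ : 0 < C₁) :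
    ∃ C : ℝ, 0 < C ∧ ∀ X : ℝ, 1 ≤ X →
      (∀ γ : ℝ, 0 < γ → (((quads (Ioc ⌊X⌋₊ ⌊2 * X⌋₊)).filter
        fun q => |gap (fun n : ℕ => (n : ℝ) ^ c) q| < γ).card : ℝ) ≤
          C₁ * (γ * X ^ (4 - c) + X ^ 2) * X ^ η) →
      ∑ q ∈ quads (Ioc ⌊X⌋₊ ⌊2 * X⌋₊), (if gap (fun n : ℕ => (n : ℝ) ^ c) q = 0 then
        Real.log X ^ 10 else min (Real.log X ^ 10) (1 / |gap (fun n : ℕ => (n : ℝ) ^ c) q|)) ≤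
        C * X ^ (2 + η) := by
  obtain ⟨D, hD, hcount⟩ := countBound (c := c) (by linarith) (half_pos hη)
  obtain ⟨B, hB, hlog⟩ := exists_log_pow_ten_le (half_pos hη)
  obtain ⟨B', hB', hpow⟩ := exists_two_pow_gt hc
  refine ⟨B * (Real.exp Real.pi * D) + C₁ * (2 * B' + 2), by positivity, fun X hX hA => ?_⟩
  have hX0 : 0 < X := by linarith
  obtain ⟨n, hn, hnX⟩ := hpow X hX
  have hK : 0 ≤ Real.log X ^ 10 := pow_nonneg (Real.log_nonneg hX) 10
  refine (sum_min_one_div_abs_gap_le _ _ (n := n) fun q hq =>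
    (abs_gap_le (by linarith) hX0.le hq).trans_lt hn).trans ?_
  have hX1 : X ^ (2 - c) ≤ 1 := Real.rpow_le_one_of_one_le_of_nonpos hX (by linarith)
  have hnear : Real.log X ^ 10 * (((quads (Ioc ⌊X⌋₊ ⌊2 * X⌋₊)).filter
      fun q => |gap (fun n : ℕ => (n : ℝ) ^ c) q| < 1).card : ℝ) ≤
      B * (Real.exp Real.pi * D) * X ^ (2 + η) := by
    calc _ ≤ B * X ^ (η / 2) * (Real.exp Real.pi * (D * X ^ (2 + η / 2))) := by
          gcongr
          · exact hlog X hX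
          · refine (card_gap_lt_one_le c X).trans ?_
            gcongr
            exact (smoothCount_anti _ _ (by positivity) hX1).trans (hcount X hX0)
      _ = B * (Real.exp Real.pi * D) * (X ^ (η / 2) * X ^ (2 + η / 2)) := by ring
      _ = _ := by
          rw [← Real.rpow_add hX0]
          congr 2
          ring
  have hfar : ∑ j ∈ range n, 1 / 2 ^ j * (((quads (Ioc ⌊X⌋₊ ⌊2 * X⌋₊)).filter
      fun q => |gap (fun n : ℕ => (n : ℝ) ^ c) q| < 2 ^ (j + 1)).card : ℝ) ≤
      C₁ * (2 * B' + 2) * X ^ (2 + η) := by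
    calc _ ≤ ∑ j ∈ range n, 1 / 2 ^ j * (C₁ * (2 ^ (j + 1) * X ^ (4 - c) + X ^ 2) * X ^ η) := by
          gcongr with j hj
          exact hA _ (by positivity)
      _ = ∑ j ∈ range n, C₁ * X ^ η * (2 * X ^ (4 - c) + (1 / 2) ^ j * X ^ 2) := by
          refine sum_congr rfl fun j _ => ?_
          rw [one_div_pow, pow_succ]
          field_simp
      _ = C₁ * X ^ η * (2 * (n * X ^ (4 - c)) + (∑ j ∈ range n, (1 / 2 : ℝ) ^ j) * X ^ 2) := by
          rw [← mul_sum, sum_add_distrib, sum_const, card_range, nsmul_eq_mul, ← sum_mul]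
          ring
      _ ≤ C₁ * X ^ η * (2 * (B' * X ^ 2) + 2 * X ^ 2) := by
          gcongr
          exact sum_geometric_two_le n
      _ = C₁ * (2 * B' + 2) * (X ^ (2 : ℝ) * X ^ η) := by rw [Real.rpow_two]; ring
      _ = _ := by rw [← Real.rpow_add hX0]
  calc _ ≤ _ := add_le_add hnear hfar
    _ = _ := by ring

/-- Fourth moment of the exponential sum over primes. -/
lemma exists_integral_primes_le {c η : ℝ} (hc : 2 < c) (hη : 0 < η) :
    ∃ C : ℝ, 0 < C ∧ ∀ X : ℝ, 3 ≤ X → ∀ Φ : ℝ → ℂ, (∀ x, ‖Φ x‖ ≤ Real.log X ^ (-4 : ℤ)) →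
      ∫ x in Set.Ioo (X ^ (1 - c - η)) (Real.log X ^ 10),
        ‖expSum ((Ioc ⌊X⌋₊ ⌊2 * X⌋₊).filter Nat.Prime) (fun p => Real.log p)
          (fun p => (p : ℝ) ^ c) x‖ ^ 4 * ‖Φ x‖ ≤ C * X ^ (2 + η) := by
  obtain ⟨D, hD, hcount⟩ := countBound (c := c) (by linarith) (half_pos hη)
  obtain ⟨B, hB, hlog⟩ := exists_log_pow_ten_le (half_pos hη)
  refine ⟨16 * Real.exp Real.pi * (B * D), by positivity, fun X hX Φ hΦ => ?_⟩
  have hX0 : 0 < X := by linarith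
  have hX1 : 1 ≤ X := by linarith
  have hlog1 : 1 ≤ Real.log X := by
    rw [Real.le_log_iff_exp_le hX0]
    linarith [Real.exp_one_lt_d9]
  set K : ℝ := Real.log X ^ 10 with hK
  have hK1 : 1 ≤ K := one_le_pow₀ hlog1
  set J := Ioc ⌊X⌋₊ ⌊2 * X⌋₊ with hJ
  set S := expSum (J.filter Nat.Prime) (fun p => Real.log p) (fun p => (p : ℝ) ^ c)
  have hXc : X ^ (2 - c) ≤ K :=
    (Real.rpow_le_one_of_one_le_of_nonpos hX1 (by linarith)).trans hK1
  have hlogp : ∀ p ∈ J.filter Nat.Prime, 0 ≤ Real.log p ∧ Real.log p ≤ 2 * Real.log X := by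
    intro p hp
    rw [mem_filter, hJ, mem_Ioc] at hp
    have hp0 : (0 : ℝ) < p := by exact_mod_cast hp.2.pos
    refine ⟨Real.log_natCast_nonneg p, ?_⟩
    have h1 : (p : ℝ) ≤ 2 * X := (Nat.le_floor_iff (by positivity)).1 hp.1.2
    calc Real.log p ≤ Real.log (X ^ 2) := Real.log_le_log hp0 (by nlinarith)
      _ = _ := by rw [Real.log_pow]; norm_num
  have hmoment : ∫ x in Set.Ioo (X ^ (1 - c - η)) K, ‖S x‖ ^ 4 ≤
      Real.log X ^ 4 * (16 * Real.exp Real.pi * (B * D) * X ^ (2 + η)) := by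
    have hpos : 0 < X ^ (1 - c - η) := by positivity
    calc _ ≤ Real.exp Real.pi * (K * ∑ q ∈ quads (J.filter Nat.Prime),
          Real.log q.1.1 * Real.log q.1.2 * (Real.log q.2.1 * Real.log q.2.2) *
            Real.exp (-Real.pi * K ^ 2 * gap (fun p : ℕ => (p : ℝ) ^ c) q ^ 2)) :=
          setIntegral_expSum_le (T := K) (zero_lt_one.trans_le hK1) (J.filter Nat.Prime)
            (fun p => Real.log p) (fun p => (p : ℝ) ^ c) measurableSet_Ioo fun x hx => by
            rw [abs_of_pos (hpos.trans hx.1)]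
            exact hx.2.le
      _ ≤ Real.exp Real.pi * (K * ((2 * Real.log X) ^ 4 * smoothCount c X K)) := by
          refine mul_le_mul_of_nonneg_left (mul_le_mul_of_nonneg_left ?_ (by linarith))
            (Real.exp_pos _).le
          rw [smoothCount, mul_sum]
          have hsub : quads (J.filter Nat.Prime) ⊆ quads J := product_subset_product
            (product_subset_product (filter_subset _ _) (filter_subset _ _))
            (product_subset_product (filter_subset _ _) (filter_subset _ _))
          refine le_trans (sum_le_sum fun q hq => ?_)
            (sum_le_sum_of_subset_of_nonneg hsub fun q _ _ => by positivity)
          simp only [quads, mem_product] at hq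
          obtain ⟨a₁, b₁⟩ := hlogp _ hq.1.1
          obtain ⟨a₂, b₂⟩ := hlogp _ hq.1.2
          obtain ⟨a₃, b₃⟩ := hlogp _ hq.2.1
          obtain ⟨a₄, b₄⟩ := hlogp _ hq.2.2
          have h4 : (2 * Real.log X) ^ 4 = 2 * Real.log X * (2 * Real.log X) *
            (2 * Real.log X * (2 * Real.log X)) := by ring
          rw [h4]
          gcongr
      _ ≤ Real.exp Real.pi * (B * X ^ (η / 2) * ((2 * Real.log X) ^ 4 *
            (D * X ^ (2 + η / 2)))) := by
          have h5 := hlog X hX1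
          have h6 := (smoothCount_anti c X (by positivity) hXc).trans (hcount X hX0)
          have h7 := smoothCount_nonneg c X K
          gcongr
      _ = Real.log X ^ 4 * (16 * Real.exp Real.pi * (B * D) * (X ^ (η / 2) * X ^ (2 + η / 2))) := by
          ring
      _ = _ := by
          rw [← Real.rpow_add hX0]
          congr 3
          ring
  have hS : Continuous fun x => ‖S x‖ ^ 4 := (continuous_expSum _ _ _).norm.pow 4
  calc _ ≤ ∫ x in Set.Ioo (X ^ (1 - c - η)) K, ‖S x‖ ^ 4 * Real.log X ^ (-4 : ℤ) := by
        refine integral_mono_of_nonneg (Filter.Eventually.of_forall fun x => by positivity) ?_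
          (Filter.Eventually.of_forall fun x => ?_)
        · exact (hS.integrableOn_Icc.mono_set Set.Ioo_subset_Icc_self).mul_const _
        · exact mul_le_mul_of_nonneg_left (hΦ x) (by positivity)
    _ = (∫ x in Set.Ioo (X ^ (1 - c - η)) K, ‖S x‖ ^ 4) * Real.log X ^ (-4 : ℤ) :=
        integral_mul_const _ _
    _ ≤ Real.log X ^ 4 * (16 * Real.exp Real.pi * (B * D) * X ^ (2 + η)) *
          Real.log X ^ (-4 : ℤ) := by gcongr
    _ = _ := by
        rw [zpow_neg, show (4 : ℤ) = ((4 : ℕ) : ℤ) by rfl, zpow_natCast]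
        field_simp

end RobertSargos

/-- Assuming the Robert–Sargos bound, the fourth moment of `S(x)` against `|Φ(x)| ≤ log⁻⁴X`
over `τ < x < K` is `≪ X^{2+η}`. -/
theorem stmt_12 (c η : ℝ) (hc : 2 < c) (hη : 0 < η) (C₁ : ℝ) (hC₁ : 0 < C₁) :
    ∃ C X₀ : ℝ, 0 < C ∧ ∀ X : ℝ, X₀ ≤ X →
      (∀ γ : ℝ, 0 < γ →
        (((((Finset.Ioc ⌊X⌋₊ ⌊2 * X⌋₊) ×ˢ (Finset.Ioc ⌊X⌋₊ ⌊2 * X⌋₊)) ×ˢ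
            ((Finset.Ioc ⌊X⌋₊ ⌊2 * X⌋₊) ×ˢ (Finset.Ioc ⌊X⌋₊ ⌊2 * X⌋₊))).filter
          (fun q => |(q.1.1 : ℝ) ^ c + (q.1.2 : ℝ) ^ c - (q.2.1 : ℝ) ^ c - (q.2.2 : ℝ) ^ c| <
            γ)).card : ℝ) ≤ C₁ * (γ * X ^ (4 - c) + X ^ 2) * X ^ η) →
      ((∑ q ∈ ((Finset.Ioc ⌊X⌋₊ ⌊2 * X⌋₊) ×ˢ (Finset.Ioc ⌊X⌋₊ ⌊2 * X⌋₊)) ×ˢ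
            ((Finset.Ioc ⌊X⌋₊ ⌊2 * X⌋₊) ×ˢ (Finset.Ioc ⌊X⌋₊ ⌊2 * X⌋₊)),
          (if (q.1.1 : ℝ) ^ c + (q.1.2 : ℝ) ^ c - (q.2.1 : ℝ) ^ c - (q.2.2 : ℝ) ^ c = 0 then
            Real.log X ^ 10
          else
            min (Real.log X ^ 10)
              (1 / |(q.1.1 : ℝ) ^ c + (q.1.2 : ℝ) ^ c - (q.2.1 : ℝ) ^ c - (q.2.2 : ℝ) ^ c|))) ≤
          C * X ^ (2 + η)) ∧
      ∀ Φ : ℝ → ℂ, (∀ x : ℝ, ‖Φ x‖ ≤ (Real.log X) ^ (-4 : ℤ)) →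
        (∫ x in Set.Ioo (X ^ (1 - c - η)) (Real.log X ^ 10),
          ‖∑ p ∈ (Finset.Ioc ⌊X⌋₊ ⌊2 * X⌋₊).filter Nat.Prime,
            (Real.log p : ℂ) * Complex.exp (2 * Real.pi * Complex.I * (((p : ℝ) ^ c * x : ℝ) : ℂ))‖ ^ 4
            * ‖Φ x‖) ≤ C * X ^ (2 + η) := by
  obtain ⟨C, hC, hsum⟩ := RobertSargos.exists_sum_min_le hc hη hC₁
  obtain ⟨C', hC', hint⟩ := RobertSargos.exists_integral_primes_le hc hη
  refine ⟨C + C', 3, by positivity, fun X hX hA => ?_⟩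
  have hX0 : 0 < X := by linarith
  have hpos : 0 < X ^ (2 + η) := by positivity
  refine ⟨(hsum X (by linarith) hA).trans ?_, fun Φ hΦ => (hint X hX Φ hΦ).trans ?_⟩
  · exact mul_le_mul_of_nonneg_right (by linarith) hpos.le
  · exact mul_le_mul_of_nonneg_right (by linarith) hpos.le
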